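/- Let d ≥ 2 and let u : ℝ × ℝ^d → ℂ be the solution of the free wave equation ∂_t² u = Δ u with radial Schwartz initial data (u(0,·), ∂_t u(0,·)) = (u₀, u₁). Suppose 2 ≤ p ≤ ∞, 2 ≤ q < ∞, and γ ∈ ℝ satisfy 1/p + (d−1)/q < (d−1)/2 and 1/p + d/q = d/2 − γ. Then there is a constant C depending only on d, p, q such that ‖u‖_{L^p_t L^q_x(ℝ × ℝ^d)} ≤ C (‖u₀‖_{Ḣ^γ} + ‖u₁‖_{Ḣ^{γ−1}}). -/

import Mathlib

noncomputable section

open MeasureTheory Real Set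
open scoped ENNReal

/-- Euclidean space `ℝ^d`. -/
abbrev Euc (d : ℕ) := EuclideanSpace ℝ (Fin d)

/-- The time derivative `∂ₜ u` of `u : ℝ × ℝ^d → ℂ` (in curried form). -/
def timeDerivC (d : ℕ) (u : ℝ → Euc d → ℂ) (t : ℝ) (x : Euc d) : ℂ :=
  deriv (fun s => u s x) t

/-- The second time derivative `∂ₜ² u`. -/
def timeDeriv2C (d : ℕ) (u : ℝ → Euc d → ℂ) (t : ℝ) (x : Euc d) : ℂ :=
  deriv (deriv (fun s => u s x)) t

/-- The spatial Laplacian `Δf = ∑ⱼ ∂²f/∂xⱼ²`. -/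
def spatialLapC (d : ℕ) (f : Euc d → ℂ) (x : Euc d) : ℂ :=
  ∑ i : Fin d,
    fderiv ℝ (fun y => fderiv ℝ f y (EuclideanSpace.single i 1)) x (EuclideanSpace.single i 1)

/-- A function on `ℝ^d` is radial if it depends only on `|x|`. -/
def IsRadialC (d : ℕ) (f : Euc d → ℂ) : Prop := ∃ g : ℝ → ℂ, ∀ x, f x = g ‖x‖

/-- `f : ℝ^d → ℂ` agrees with a Schwartz function. -/
def IsSchwartzC (d : ℕ) (f : Euc d → ℂ) : Prop :=
  ∃ φ : SchwartzMap (Euc d) ℂ, ∀ x, f x = φ x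

/-- The homogeneous Sobolev norm `‖f‖_{Ḣ^s} = (∫ |ξ|^{2s} |f̂(ξ)|² dξ)^{1/2}`,
valued in `[0, ∞]`. -/
def sobolevNormC (d : ℕ) (s : ℝ) (f : Euc d → ℂ) : ℝ≥0∞ :=
  (∫⁻ ξ : Euc d,
    ENNReal.ofReal (‖ξ‖ ^ (2 * s) * ‖FourierTransform.fourier f ξ‖ ^ 2)) ^ ((1 : ℝ) / 2)

/-- The mixed space-time norm `‖u‖_{L^p_t L^q_x(I × ℝ^d)}`, valued in `[0, ∞]`. -/
def mixedNorm (d : ℕ) (p q : ℝ≥0∞) (I : Set ℝ) (u : ℝ → Euc d → ℂ) : ℝ≥0∞ :=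
  if p = ∞ then essSup (fun t => eLpNorm (u t) q volume) (volume.restrict I)
  else (∫⁻ t in I, (eLpNorm (u t) q volume) ^ p.toReal) ^ (1 / p.toReal)

/-- The norm `‖u‖_{L^∞_t Ḣ^s_x(I × ℝ^d)}`, valued in `[0, ∞]`. -/
def LinftySobolev (d : ℕ) (s : ℝ) (I : Set ℝ) (u : ℝ → Euc d → ℂ) : ℝ≥0∞ :=
  essSup (fun t => sobolevNormC d s (u t)) (volume.restrict I)

open scoped FourierTransform

/-- The half-wave with Fourier profile `f`. -/
def halfWave (d : ℕ) (f : Euc d → ℂ) (t : ℝ) (x : Euc d) : ℂ :=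
  ∫ ξ : Euc d, Complex.exp (((2 * π * (inner ℝ ξ x + t * ‖ξ‖) : ℝ) : ℂ) * Complex.I) * f ξ

/-- The inner product of `ℝ^d` as a continuous bilinear form. -/
def eucInner (d : ℕ) : Euc d →L[ℝ] Euc d →L[ℝ] ℝ := innerSL ℝ

lemma eucInner_apply (d : ℕ) (v w : Euc d) : eucInner d v w = inner ℝ v w := rfl

/-- The bilinear form on space-time used to write half-waves as Fourier integrals. -/
def coneForm (d : ℕ) : (ℝ × Euc d) →L[ℝ] (ℝ × Euc d) →L[ℝ] ℝ :=
  -((ContinuousLinearMap.mul ℝ ℝ).bilinearComp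
      (ContinuousLinearMap.fst ℝ ℝ (Euc d)) (ContinuousLinearMap.fst ℝ ℝ (Euc d)) +
    (eucInner d).bilinearComp
      (ContinuousLinearMap.snd ℝ ℝ (Euc d)) (ContinuousLinearMap.snd ℝ ℝ (Euc d)))

lemma coneForm_apply (d : ℕ) (v w : ℝ × Euc d) :
    coneForm d v w = -(v.1 * w.1 + inner ℝ v.2 w.2) := by
  simp [coneForm, eucInner_apply, add_comm]

/-- The measure on the light cone pushed forward from frequency space. -/
def coneMeasure (d : ℕ) : Measure (ℝ × Euc d) :=
  (volume : Measure (Euc d)).map (fun ξ => (‖ξ‖, ξ))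

lemma coneEmb_measurableEmbedding (d : ℕ) :
    MeasurableEmbedding (fun ξ : Euc d => ((‖ξ‖, ξ) : ℝ × Euc d)) := by
  refine Topology.IsClosedEmbedding.measurableEmbedding ?_
  refine Topology.IsClosedEmbedding.of_continuous_injective_isClosedMap (by fun_prop) ?_ ?_
  · intro a b h
    exact (Prod.mk.inj h).2
  · intro s hs
    have : (fun ξ : Euc d => ((‖ξ‖, ξ) : ℝ × Euc d)) '' s = {p | p.1 = ‖p.2‖} ∩ Prod.snd ⁻¹' s := by
      ext ⟨a, b⟩
      simp only [mem_image, Prod.mk.injEq, mem_inter_iff, mem_ofPred_eq, mem_preimage]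
      constructor
      · rintro ⟨x, hx, rfl, rfl⟩
        exact ⟨rfl, hx⟩
      · rintro ⟨rfl, h⟩
        exact ⟨b, h, rfl, rfl⟩
    rw [this]
    exact (isClosed_eq (by fun_prop) (by fun_prop)).inter (hs.preimage continuous_snd)

lemma halfWave_eq_fourierIntegral (d : ℕ) (f : Euc d → ℂ) (p : ℝ × Euc d) :
    halfWave d f p.1 p.2 = VectorFourier.fourierIntegral 𝐞 (coneMeasure d)
      (coneForm d).toLinearMap₁₂ (fun v => f v.2) p := by
  unfold halfWave VectorFourier.fourierIntegral coneMeasure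
  rw [(coneEmb_measurableEmbedding d).integral_map]
  congr 1 with ξ
  rw [ContinuousLinearMap.toLinearMap₁₂_apply_apply_apply, coneForm_apply, Circle.smul_def,
    Real.fourierChar_apply, smul_eq_mul]
  congr 4
  simp only [neg_neg]
  ring

lemma integrable_cone_iff (d : ℕ) {F : Type*} [NormedAddCommGroup F] (g : ℝ × Euc d → F) :
    Integrable g (coneMeasure d) ↔ Integrable (fun ξ : Euc d => g (‖ξ‖, ξ)) :=
  (coneEmb_measurableEmbedding d).integrable_map_iff

lemma norm_cone (d : ℕ) (ξ : Euc d) : ‖((‖ξ‖, ξ) : ℝ × Euc d)‖ = ‖ξ‖ := by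
  simp [Prod.norm_def]

lemma contDiff_halfWave (d : ℕ) {f : Euc d → ℂ}
    (hf : ∀ n : ℕ, Integrable (fun ξ => ‖ξ‖ ^ n * ‖f ξ‖)) :
    ContDiff ℝ (⊤ : ℕ∞) (fun p : ℝ × Euc d => halfWave d f p.1 p.2) := by
  have := VectorFourier.contDiff_fourierIntegral (N := (⊤ : ℕ∞)) (μ := coneMeasure d) (coneForm d)
    (f := fun v => f v.2) (fun n _ => by
      rw [integrable_cone_iff]
      simpa only [norm_cone] using hf n)
  convert! this using 1
  ext p
  exact halfWave_eq_fourierIntegral d f p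

lemma hasFDerivAt_halfWave (d : ℕ) {f : Euc d → ℂ} (hf : Integrable f)
    (hf' : Integrable (fun ξ => ‖ξ‖ * ‖f ξ‖)) (p : ℝ × Euc d) :
    ∃ D : (ℝ × Euc d) →L[ℝ] ℂ,
      HasFDerivAt (fun p : ℝ × Euc d => halfWave d f p.1 p.2) D p ∧
      ∀ h, D h = halfWave d
        (fun ξ => 2 * π * Complex.I * ((inner ℝ ξ h.2 + ‖ξ‖ * h.1 : ℝ) : ℂ) * f ξ) p.1 p.2 := by
  have h1 : Integrable (fun v : ℝ × Euc d => f v.2) (coneMeasure d) := by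
    rw [integrable_cone_iff]; exact hf
  have h2 : Integrable (fun v : ℝ × Euc d => ‖v‖ * ‖f v.2‖) (coneMeasure d) := by
    rw [integrable_cone_iff]; simpa only [norm_cone] using hf'
  refine ⟨VectorFourier.fourierIntegral 𝐞 (coneMeasure d) (coneForm d).toLinearMap₁₂
    (VectorFourier.fourierSMulRight (coneForm d) (fun v => f v.2)) p, ?_, ?_⟩
  · have := VectorFourier.hasFDerivAt_fourierIntegral (coneForm d) h1 h2 p
    convert! this using 1
    ext p
    exact halfWave_eq_fourierIntegral d f p
  · intro h
    rw [VectorFourier.fourierIntegral_continuousLinearMap_apply Real.continuous_fourierChar (by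
      refine Integrable.mono' (g := fun v => 2 * π * ‖coneForm d‖ * (‖v‖ * ‖f v.2‖))
        (h2.const_mul _) (h1.1.fourierSMulRight (L := coneForm d)) (Filter.Eventually.of_forall fun v => ?_)
      simpa [mul_assoc] using VectorFourier.norm_fourierSMulRight_le (coneForm d) (fun v => f v.2) v)]
    rw [halfWave_eq_fourierIntegral]
    unfold VectorFourier.fourierIntegral coneMeasure
    rw [(coneEmb_measurableEmbedding d).integral_map, (coneEmb_measurableEmbedding d).integral_map]
    congr 1 with ξ
    congr 1
    simp only [VectorFourier.fourierSMulRight_apply, coneForm_apply, smul_eq_mul, Complex.real_smul]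
    push_cast
    ring

lemma hasDerivAt_halfWave_time (d : ℕ) {f : Euc d → ℂ} (hf : Integrable f)
    (hf' : Integrable (fun ξ => ‖ξ‖ * ‖f ξ‖)) (t : ℝ) (x : Euc d) :
    HasDerivAt (fun s => halfWave d f s x)
      (halfWave d (fun ξ => 2 * π * Complex.I * (‖ξ‖ : ℂ) * f ξ) t x) t := by
  obtain ⟨D, hD, hD'⟩ := hasFDerivAt_halfWave d hf hf' (t, x)
  have := hD.comp_hasDerivAt t ((hasDerivAt_id t).prodMk (hasDerivAt_const t x))
  rw [hD'] at this
  simpa using! this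

lemma fderiv_halfWave_space (d : ℕ) {f : Euc d → ℂ} (hf : Integrable f)
    (hf' : Integrable (fun ξ => ‖ξ‖ * ‖f ξ‖)) (t : ℝ) (x h : Euc d) :
    DifferentiableAt ℝ (halfWave d f t) x ∧ fderiv ℝ (halfWave d f t) x h =
      halfWave d (fun ξ => 2 * π * Complex.I * ((inner ℝ ξ h : ℝ) : ℂ) * f ξ) t x := by
  obtain ⟨D, hD, hD'⟩ := hasFDerivAt_halfWave d hf hf' (t, x)
  have := hD.comp x ((hasFDerivAt_const t x).prodMk (hasFDerivAt_id x))
  have h2 : HasFDerivAt (halfWave d f t) (D ∘L (ContinuousLinearMap.prod 0 (ContinuousLinearMap.id ℝ (Euc d)))) x := this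
  refine ⟨h2.differentiableAt, ?_⟩
  rw [h2.fderiv]
  simp [hD']

/-- Directional derivative of a real-valued function on space-time. -/
def dirDeriv {F : Type*} [NormedAddCommGroup F] [NormedSpace ℝ F]
    (v : F) (g : F → ℝ) (p : F) : ℝ := fderiv ℝ g p v

section DirDeriv
variable {F : Type*} [NormedAddCommGroup F] [NormedSpace ℝ F]

lemma contDiff_dirDeriv (v : F) {g : F → ℝ} (hg : ContDiff ℝ (⊤ : ℕ∞) g) :
    ContDiff ℝ (⊤ : ℕ∞) (dirDeriv v g) := by
  unfold dirDeriv
  exact (hg.fderiv_right (m := (⊤ : ℕ∞)) (by simp)).clm_apply contDiff_const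

lemma dirDeriv_mul (v : F) {g h : F → ℝ} (hg : ContDiff ℝ (⊤ : ℕ∞) g)
    (hh : ContDiff ℝ (⊤ : ℕ∞) h) (p : F) :
    dirDeriv v (fun p => g p * h p) p = dirDeriv v g p * h p + g p * dirDeriv v h p := by
  unfold dirDeriv
  rw [fderiv_fun_mul (hg.differentiable (by simp) p) (hh.differentiable (by simp) p)]
  simp
  ring

lemma dirDeriv_comm (v w : F) {g : F → ℝ} (hg : ContDiff ℝ (⊤ : ℕ∞) g) (p : F) :
    dirDeriv v (dirDeriv w g) p = dirDeriv w (dirDeriv v g) p := by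
  have h1 : DifferentiableAt ℝ (fderiv ℝ g) p :=
    (hg.fderiv_right (m := (⊤ : ℕ∞)) (by simp)).differentiable (by simp) p
  have h2 : IsSymmSndFDerivAt ℝ g p :=
    ((contDiff_infty.1 hg 2).contDiffAt (x := p)).isSymmSndFDerivAt (by simp)
  have h3 : ∀ a b : F, dirDeriv a (dirDeriv b g) p = fderiv ℝ (fderiv ℝ g) p a b := by
    intro a b
    unfold dirDeriv
    rw [fderiv_clm_apply h1 (differentiableAt_const b)]
    simp
  rw [h3, h3]
  exact h2 v w

lemma integral_dirDeriv_eq_zero [MeasurableSpace F] [BorelSpace F] [FiniteDimensional ℝ F]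
    (μ : Measure F) [μ.IsAddHaarMeasure] (v : F) {g : F → ℝ} (hg : ContDiff ℝ 1 g)
    (hc : HasCompactSupport g) : ∫ x, dirDeriv v g x ∂μ = 0 := by
  have h1 : Continuous (fun x => fderiv ℝ g x v) :=
    (hg.continuous_fderiv (by simp)).clm_apply continuous_const
  have h2 : HasCompactSupport (fun x => fderiv ℝ g x v) := hc.fderiv_apply ℝ v
  have := integral_mul_fderiv_eq_neg_fderiv_mul_of_integrable (μ := μ) (f := fun _ : F => (1 : ℝ))
    (g := g) (v := v) (by simp) (by simpa using h1.integrable_of_hasCompactSupport h2)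
    (by simpa using hg.continuous.integrable_of_hasCompactSupport hc) (fun x _ => by fun_prop)
    (fun x _ => hg.differentiable (by simp) x)
  simpa [dirDeriv] using this

end DirDeriv

/-- The unit time direction. -/
def tDir (d : ℕ) : ℝ × Euc d := (1, 0)

/-- The unit spatial directions. -/
def xDir (d : ℕ) (i : Fin d) : ℝ × Euc d := (0, EuclideanSpace.single i 1)

/-- Smooth cutoff, nonincreasing along the light cone. -/
def coneCutoff (d : ℕ) (M : ℝ) (p : ℝ × Euc d) : ℝ :=
  Real.smoothTransition (M - p.1 - √(1 + ‖p.2‖ ^ 2))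

lemma contDiff_coneCutoff (d : ℕ) (M : ℝ) : ContDiff ℝ (⊤ : ℕ∞) (coneCutoff d M) := by
  unfold coneCutoff
  refine Real.smoothTransition.contDiff.comp ?_
  refine (contDiff_const.sub contDiff_fst).sub (ContDiff.sqrt ?_ ?_)
  · exact contDiff_const.add (contDiff_snd.norm_sq ℝ)
  · intro x; positivity

lemma coneCutoff_nonneg (d : ℕ) (M : ℝ) (p : ℝ × Euc d) : 0 ≤ coneCutoff d M p :=
  Real.smoothTransition.nonneg _

lemma coneCutoff_eq_zero (d : ℕ) (M : ℝ) {p : ℝ × Euc d} (hp : 0 ≤ p.1) (hx : M ≤ ‖p.2‖) :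
    coneCutoff d M p = 0 := by
  apply Real.smoothTransition.zero_of_nonpos
  have : ‖p.2‖ ≤ √(1 + ‖p.2‖ ^ 2) := Real.le_sqrt_of_sq_le (by linarith)
  linarith

lemma dirDeriv_coneCutoff (d : ℕ) (M : ℝ) (p : ℝ × Euc d) :
    ∃ ψ : ℝ, 0 ≤ ψ ∧ dirDeriv (tDir d) (coneCutoff d M) p = -ψ ∧
      ∀ i, dirDeriv (xDir d i) (coneCutoff d M) p = -ψ * (p.2 i / √(1 + ‖p.2‖ ^ 2)) := by
  have hsm : ∀ x, HasDerivAt Real.smoothTransition (deriv Real.smoothTransition x) x := fun x =>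
    ((Real.smoothTransition.contDiff (n := 1)).differentiable (by simp) x).hasDerivAt
  have hpos : (1 + ‖p.2‖ ^ 2) ≠ 0 := by positivity
  have h1 : HasFDerivAt (fun p : ℝ × Euc d => ‖p.2‖ ^ 2)
      (2 • (innerSL ℝ p.2).comp (ContinuousLinearMap.snd ℝ ℝ (Euc d))) p :=
    (hasFDerivAt_snd (p := p)).norm_sq
  have h2 := ((hasFDerivAt_fst (𝕜 := ℝ) (p := p)).const_sub M).sub ((h1.const_add 1).sqrt hpos)
  have h3 := (hsm (M - p.1 - √(1 + ‖p.2‖ ^ 2))).comp_hasFDerivAt p h2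
  have h4 : fderiv ℝ (coneCutoff d M) p = _ := h3.fderiv
  refine ⟨deriv Real.smoothTransition (M - p.1 - √(1 + ‖p.2‖ ^ 2)),
    Real.smoothTransition.monotone.deriv_nonneg, ?_, fun i => ?_⟩
  · simp [dirDeriv, h4, tDir]
  · simp [dirDeriv, h4, xDir, EuclideanSpace.inner_single_right]
    ring_nf
    exact Or.inl trivial

/-- Local energy density, as a function on space-time. -/
def energyDensity (d : ℕ) (w : ℝ × Euc d → ℝ) (p : ℝ × Euc d) : ℝ :=
  (dirDeriv (tDir d) w p * dirDeriv (tDir d) w p +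
    ∑ i, dirDeriv (xDir d i) w p * dirDeriv (xDir d i) w p) * (1 / 2)

lemma contDiff_energyDensity (d : ℕ) {w : ℝ × Euc d → ℝ} (hw : ContDiff ℝ (⊤ : ℕ∞) w) :
    ContDiff ℝ (⊤ : ℕ∞) (energyDensity d w) := by
  have h1 := contDiff_dirDeriv (tDir d) hw
  have h2 := fun i => contDiff_dirDeriv (xDir d i) hw
  unfold energyDensity
  fun_prop

lemma dirDeriv_energyDensity (d : ℕ) {w : ℝ × Euc d → ℝ} (hw : ContDiff ℝ (⊤ : ℕ∞) w)
    (heq : ∀ p, dirDeriv (tDir d) (dirDeriv (tDir d) w) p =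
      ∑ i, dirDeriv (xDir d i) (dirDeriv (xDir d i) w) p) (p : ℝ × Euc d) :
    dirDeriv (tDir d) (energyDensity d w) p =
      ∑ i, dirDeriv (xDir d i)
        (fun p => dirDeriv (tDir d) w p * dirDeriv (xDir d i) w p) p := by
  have h1 := contDiff_dirDeriv (tDir d) hw
  have h2 := fun i => contDiff_dirDeriv (xDir d i) hw
  have h3 : dirDeriv (tDir d) (energyDensity d w) p =
      dirDeriv (tDir d) w p * dirDeriv (tDir d) (dirDeriv (tDir d) w) p +
      ∑ i, dirDeriv (xDir d i) w p * dirDeriv (tDir d) (dirDeriv (xDir d i) w) p := by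
    have e1 := dirDeriv_mul (tDir d) h1 h1 p
    have e2 := fun i => dirDeriv_mul (tDir d) (h2 i) (h2 i) p
    have d1 : DifferentiableAt ℝ (fun p => dirDeriv (tDir d) w p * dirDeriv (tDir d) w p) p :=
      (h1.mul h1).differentiable (by simp) p
    have d2 : ∀ i, DifferentiableAt ℝ
        (fun p => dirDeriv (xDir d i) w p * dirDeriv (xDir d i) w p) p :=
      fun i => ((h2 i).mul (h2 i)).differentiable (by simp) p
    unfold energyDensity
    rw [dirDeriv, fderiv_mul_const (d1.fun_add (DifferentiableAt.fun_sum fun i _ => d2 i)),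
      fderiv_fun_add d1 (DifferentiableAt.fun_sum fun i _ => d2 i),
      fderiv_fun_sum (fun i _ => d2 i)]
    unfold dirDeriv at e1 e2 ⊢
    simp only [smul_apply, add_apply,
      sum_apply, smul_eq_mul, e1, e2, mul_add, Finset.mul_sum]
    congr 1
    · ring
    · refine Finset.sum_congr rfl fun i _ => ?_
      ring
  rw [h3, heq, Finset.mul_sum, ← Finset.sum_add_distrib]
  refine Finset.sum_congr rfl fun i _ => ?_
  rw [dirDeriv_mul _ h1 (h2 i), dirDeriv_comm (xDir d i) (tDir d) hw]
  ring

lemma dirDeriv_slice (d : ℕ) {g : ℝ × Euc d → ℝ} (hg : ContDiff ℝ (⊤ : ℕ∞) g) (t : ℝ) (v x : Euc d) :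
    dirDeriv v (fun y => g (t, y)) x = dirDeriv ((0 : ℝ), v) g (t, x) := by
  have := (hg.differentiable (by simp) (t, x)).hasFDerivAt.comp x
    ((hasFDerivAt_const t x).prodMk (hasFDerivAt_id x))
  have h2 : HasFDerivAt (fun y => g (t, y)) _ x := this
  simp [dirDeriv, h2.fderiv]

lemma hasDerivAt_slice (d : ℕ) {g : ℝ × Euc d → ℝ} (hg : ContDiff ℝ (⊤ : ℕ∞) g) (t : ℝ) (x : Euc d) :
    HasDerivAt (fun s => g (s, x)) (dirDeriv (tDir d) g (t, x)) t := by
  have := (hg.differentiable (by simp) (t, x)).hasFDerivAt.comp_hasDerivAt t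
    ((hasDerivAt_id t).prodMk (hasDerivAt_const t x))
  simpa [dirDeriv, tDir] using! this

lemma hasCompactSupport_coneCutoff_mul (d : ℕ) (M : ℝ) {t : ℝ} (ht : 0 ≤ t)
    (g : ℝ × Euc d → ℝ) :
    HasCompactSupport (fun x => coneCutoff d M (t, x) * g (t, x)) := by
  refine HasCompactSupport.intro (isCompact_closedBall (0 : Euc d) M) fun x hx => ?_
  rw [coneCutoff_eq_zero d M ht, zero_mul]
  simp at hx
  exact hx.le

/-- The localized energy is nonincreasing. -/
lemma integral_dirDeriv_cutoff_energy_nonpos (d : ℕ) (M : ℝ) {w : ℝ × Euc d → ℝ}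
    (hw : ContDiff ℝ (⊤ : ℕ∞) w)
    (heq : ∀ p, dirDeriv (tDir d) (dirDeriv (tDir d) w) p =
      ∑ i, dirDeriv (xDir d i) (dirDeriv (xDir d i) w) p) {t : ℝ} (ht : 0 ≤ t) :
    ∫ x, dirDeriv (tDir d) (fun p => coneCutoff d M p * energyDensity d w p) (t, x) ≤ 0 := by
  have hc := contDiff_coneCutoff d M
  have he := contDiff_energyDensity d hw
  have h1 := contDiff_dirDeriv (tDir d) hw
  have h2 := fun i => contDiff_dirDeriv (xDir d i) hw
  have hprod : ∀ i, ContDiff ℝ (⊤ : ℕ∞)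
      (fun p => dirDeriv (tDir d) w p * dirDeriv (xDir d i) w p) := fun i => h1.mul (h2 i)
  set G : Fin d → Euc d → ℝ := fun i x =>
    coneCutoff d M (t, x) * (dirDeriv (tDir d) w (t, x) * dirDeriv (xDir d i) w (t, x)) with hG
  have hGc : ∀ i, ContDiff ℝ (⊤ : ℕ∞) (G i) := fun i =>
    (hc.mul (hprod i)).comp (contDiff_const.prodMk contDiff_id)
  have hGs : ∀ i, HasCompactSupport (G i) := fun i => hasCompactSupport_coneCutoff_mul d M ht
    (fun p => dirDeriv (tDir d) w p * dirDeriv (xDir d i) w p)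
  have key : ∀ x, dirDeriv (tDir d) (fun p => coneCutoff d M p * energyDensity d w p) (t, x) ≤
      ∑ i, dirDeriv (EuclideanSpace.single i (1 : ℝ)) (G i) x := by
    intro x
    have e1 : ∀ i, dirDeriv (EuclideanSpace.single i (1 : ℝ)) (G i) x =
        dirDeriv (xDir d i) (coneCutoff d M) (t, x) *
          (dirDeriv (tDir d) w (t, x) * dirDeriv (xDir d i) w (t, x)) +
        coneCutoff d M (t, x) * dirDeriv (xDir d i)
          (fun p => dirDeriv (tDir d) w p * dirDeriv (xDir d i) w p) (t, x) := by
      intro i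
      rw [← dirDeriv_mul (xDir d i) hc (hprod i)]
      exact dirDeriv_slice d (hc.mul (hprod i)) t _ x
    rw [dirDeriv_mul _ hc he, dirDeriv_energyDensity d hw heq, Finset.mul_sum]
    simp only [e1, Finset.sum_add_distrib]
    gcongr
    obtain ⟨ψ, hψ, ht', hx'⟩ := dirDeriv_coneCutoff d M (t, x)
    simp only [ht', hx']
    set a : Fin d → ℝ := fun i => x i / √(1 + ‖x‖ ^ 2) with ha
    have hasum : ∑ i, a i ^ 2 ≤ 1 := by
      simp only [ha, div_pow, ← Finset.sum_div]
      rw [Real.sq_sqrt (by positivity), div_le_one (by positivity), EuclideanSpace.norm_sq_eq]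
      simp
    set A := dirDeriv (tDir d) w (t, x)
    set B : Fin d → ℝ := fun i => dirDeriv (xDir d i) w (t, x)
    have hen : energyDensity d w (t, x) = (A * A + ∑ i, B i * B i) * (1 / 2) := rfl
    have hsum : ∑ i, a i * (A * B i) ≤ energyDensity d w (t, x) := by
      calc ∑ i, a i * (A * B i) ≤ ∑ i, (A ^ 2 * a i ^ 2 + B i * B i) * (1 / 2) := by
            refine Finset.sum_le_sum fun i _ => ?_
            nlinarith [sq_nonneg (A * a i - B i)]
        _ = (A ^ 2 * ∑ i, a i ^ 2 + ∑ i, B i * B i) * (1 / 2) := by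
            rw [← Finset.sum_mul, Finset.sum_add_distrib, Finset.mul_sum]
        _ ≤ _ := by
            rw [hen]
            nlinarith [mul_le_mul_of_nonneg_left hasum (sq_nonneg A)]
    calc -ψ * energyDensity d w (t, x) ≤ -ψ * ∑ i, a i * (A * B i) := by
          nlinarith [mul_le_mul_of_nonneg_left hsum hψ]
      _ = _ := by
          rw [Finset.mul_sum]
          refine Finset.sum_congr rfl fun i _ => ?_
          ring
  have hGint : ∀ i, Integrable (dirDeriv (EuclideanSpace.single i (1 : ℝ)) (G i)) := fun i =>
    (contDiff_dirDeriv _ (hGc i)).continuous.integrable_of_hasCompactSupport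
      ((hGs i).fderiv_apply ℝ _)
  by_cases hIntegrable : Integrable (fun x => dirDeriv (tDir d)
      (fun p => coneCutoff d M p * energyDensity d w p) (t, x))
  swap
  · rw [integral_undef hIntegrable]
  calc _ ≤ ∫ x, ∑ i, dirDeriv (EuclideanSpace.single i (1 : ℝ)) (G i) x :=
        integral_mono hIntegrable (integrable_finsetSum _ fun i _ => hGint i) key
    _ = 0 := by
        rw [integral_finsetSum _ fun i _ => hGint i]
        exact Finset.sum_eq_zero fun i _ =>
          integral_dirDeriv_eq_zero volume _ ((hGc i).of_le (by exact_mod_cast le_top)) (hGs i)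

lemma cutoff_energy_le_zero (d : ℕ) (M : ℝ) {w : ℝ × Euc d → ℝ}
    (hw : ContDiff ℝ (⊤ : ℕ∞) w)
    (heq : ∀ p, dirDeriv (tDir d) (dirDeriv (tDir d) w) p =
      ∑ i, dirDeriv (xDir d i) (dirDeriv (xDir d i) w) p)
    (hzero : ∀ x, energyDensity d w (0, x) = 0) {T : ℝ} (hT : 0 ≤ T) :
    ∫ x, coneCutoff d M (T, x) * energyDensity d w (T, x) ≤ 0 := by
  have hc := contDiff_coneCutoff d M
  have he := contDiff_energyDensity d hw
  set F : ℝ × Euc d → ℝ := fun p => coneCutoff d M p * energyDensity d w p with hF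
  have hFc : ContDiff ℝ (⊤ : ℕ∞) F := hc.mul he
  have hDc := (contDiff_dirDeriv (tDir d) hFc).continuous
  have hftc : ∀ x, F (T, x) = ∫ s in (0 : ℝ)..T, dirDeriv (tDir d) F (s, x) := by
    intro x
    rw [intervalIntegral.integral_eq_sub_of_hasDerivAt (f := fun s => F (s, x))
      (fun s _ => hasDerivAt_slice d hFc s x)
      ((hDc.comp (by fun_prop : Continuous fun s : ℝ => (s, x))).intervalIntegrable _ _)]
    simp [hF, hzero]
  have hvanish : ∀ s : ℝ, 0 < s → ∀ x : Euc d, M < ‖x‖ → dirDeriv (tDir d) F (s, x) = 0 := by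
    intro s hs x hx
    have : F =ᶠ[nhds (s, x)] fun _ => 0 := by
      have o1 : IsOpen {p : ℝ × Euc d | 0 < p.1 ∧ M < ‖p.2‖} :=
        (isOpen_lt continuous_const continuous_fst).inter
          (isOpen_lt continuous_const continuous_snd.norm)
      filter_upwards [o1.mem_nhds (show (s, x) ∈ _ from ⟨hs, hx⟩)] with p hp
      simp only [hF]
      rw [coneCutoff_eq_zero d M hp.1.le hp.2.le, zero_mul]
    unfold dirDeriv
    rw [this.fderiv_eq]
    simp
  have hIntegrable : Integrable (Function.uncurry fun (s : ℝ) (x : Euc d) => dirDeriv (tDir d) F (s, x))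
      ((volume.restrict (Ioc 0 T)).prod volume) := by
    have h1 : IntegrableOn (dirDeriv (tDir d) F) (Icc 0 T ×ˢ Metric.closedBall 0 M)
        (volume.prod volume) :=
      hDc.continuousOn.integrableOn_compact (isCompact_Icc.prod (isCompact_closedBall _ _))
    have h2 : IntegrableOn (dirDeriv (tDir d) F) (Ioc 0 T ×ˢ univ) (volume.prod volume) := by
      refine h1.of_forall_sdiff_eq_zero (measurableSet_Ioc.prod MeasurableSet.univ) ?_
      rintro ⟨s, x⟩ ⟨⟨hs, -⟩, hx⟩
      refine hvanish s hs.1 x ?_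
      by_contra hcon
      exact hx ⟨Ioc_subset_Icc_self hs, by simpa using hcon⟩
    have h3 := h2
    rw [IntegrableOn, ← Measure.prod_restrict, Measure.restrict_univ] at h3
    exact h3
  calc ∫ x, F (T, x) = ∫ x, ∫ s in Ioc 0 T, dirDeriv (tDir d) F (s, x) := by
        congr 1 with x
        rw [hftc, intervalIntegral.integral_of_le hT]
    _ = ∫ s in Ioc 0 T, ∫ x, dirDeriv (tDir d) F (s, x) := (integral_integral_swap hIntegrable).symm
    _ ≤ 0 := setIntegral_nonpos measurableSet_Ioc fun s hs =>
        integral_dirDeriv_cutoff_energy_nonpos d M hw heq hs.1.le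

/-- Forward uniqueness for smooth real solutions of the wave equation. -/
lemma wave_unique_forward (d : ℕ) {w : ℝ × Euc d → ℝ}
    (hw : ContDiff ℝ (⊤ : ℕ∞) w)
    (heq : ∀ p, dirDeriv (tDir d) (dirDeriv (tDir d) w) p =
      ∑ i, dirDeriv (xDir d i) (dirDeriv (xDir d i) w) p)
    (h0 : ∀ x, w (0, x) = 0) (h1 : ∀ x, dirDeriv (tDir d) w (0, x) = 0)
    {t : ℝ} (ht : 0 ≤ t) (x : Euc d) : w (t, x) = 0 := by
  have he := contDiff_energyDensity d hw
  have hnn : ∀ p, 0 ≤ energyDensity d w p := fun p => by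
    unfold energyDensity
    have : 0 ≤ ∑ i, dirDeriv (xDir d i) w p * dirDeriv (xDir d i) w p :=
      Finset.sum_nonneg fun i _ => mul_self_nonneg _
    nlinarith [mul_self_nonneg (dirDeriv (tDir d) w p)]
  have hzero : ∀ x, energyDensity d w (0, x) = 0 := fun x => by
    have : ∀ i, dirDeriv (xDir d i) w (0, x) = 0 := fun i => by
      have := dirDeriv_slice d hw 0 (EuclideanSpace.single i 1) x
      rw [xDir, ← this]
      simp [dirDeriv, h0]
    simp [energyDensity, h1, this]
  have hen : ∀ s : ℝ, 0 ≤ s → energyDensity d w (s, x) = 0 := by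
    intro s hs
    set M : ℝ := s + √(1 + ‖x‖ ^ 2) + 1 with hM
    have hcont : Continuous fun y => coneCutoff d M (s, y) * energyDensity d w (s, y) :=
      ((contDiff_coneCutoff d M).mul he).continuous.comp (by fun_prop)
    have hcs := hasCompactSupport_coneCutoff_mul d M hs (energyDensity d w)
    have hz : ∫ y, coneCutoff d M (s, y) * energyDensity d w (s, y) = 0 :=
      le_antisymm (cutoff_energy_le_zero d M hw heq hzero hs)
        (integral_nonneg fun y => mul_nonneg (coneCutoff_nonneg d M _) (hnn _))
    have h2 := (integral_eq_zero_iff_of_nonneg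
      (fun y => mul_nonneg (coneCutoff_nonneg d M _) (hnn _))
      (hcont.integrable_of_hasCompactSupport hcs)).1 hz
    have h3 := congrFun ((hcont.ae_eq_iff_eq volume continuous_zero).1 h2) x
    have h4 : coneCutoff d M (s, x) ≠ 0 := by
      refine (Real.smoothTransition.pos_of_pos ?_).ne'
      simp only [hM]
      linarith
    simpa [h4] using h3
  have hd : ∀ s : ℝ, 0 ≤ s → dirDeriv (tDir d) w (s, x) = 0 := by
    intro s hs
    have h2 := hen s hs
    unfold energyDensity at h2
    have : 0 ≤ ∑ i, dirDeriv (xDir d i) w (s, x) * dirDeriv (xDir d i) w (s, x) :=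
      Finset.sum_nonneg fun i _ => mul_self_nonneg _
    exact mul_self_eq_zero.1 (by nlinarith [mul_self_nonneg (dirDeriv (tDir d) w (s, x))])
  have hftc := intervalIntegral.integral_eq_sub_of_hasDerivAt (f := fun s => w (s, x))
      (a := 0) (b := t) (fun s _ => hasDerivAt_slice d hw s x)
      (((contDiff_dirDeriv (tDir d) hw).continuous.comp
        (by fun_prop : Continuous fun s : ℝ => (s, x))).intervalIntegrable _ _)
  rw [intervalIntegral.integral_congr (g := fun _ => 0)] at hftc
  · simp [h0] at hftc
    exact hftc.symm
  · intro s hs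
    rw [uIcc_of_le ht] at hs
    exact hd s hs.1

lemma dirDeriv_timeReflect (d : ℕ) {g : ℝ × Euc d → ℝ} (hg : ContDiff ℝ (⊤ : ℕ∞) g)
    (v p : ℝ × Euc d) :
    dirDeriv v (fun p : ℝ × Euc d => g (-p.1, p.2)) p = dirDeriv (-v.1, v.2) g (-p.1, p.2) := by
  have := (hg.differentiable (by simp) (-p.1, p.2)).hasFDerivAt.comp p
    ((hasFDerivAt_fst (𝕜 := ℝ) (p := p)).neg.prodMk (hasFDerivAt_snd))
  have h2 : HasFDerivAt (fun p : ℝ × Euc d => g (-p.1, p.2)) _ p := this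
  simp [dirDeriv, h2.fderiv]

/-- Uniqueness for smooth real solutions of the wave equation. -/
lemma wave_unique (d : ℕ) {w : ℝ × Euc d → ℝ}
    (hw : ContDiff ℝ (⊤ : ℕ∞) w)
    (heq : ∀ p, dirDeriv (tDir d) (dirDeriv (tDir d) w) p =
      ∑ i, dirDeriv (xDir d i) (dirDeriv (xDir d i) w) p)
    (h0 : ∀ x, w (0, x) = 0) (h1 : ∀ x, dirDeriv (tDir d) w (0, x) = 0)
    (p : ℝ × Euc d) : w p = 0 := by
  rcases le_total 0 p.1 with h | h
  · exact wave_unique_forward d hw heq h0 h1 h p.2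
  · have hneg : ∀ p, dirDeriv (tDir d) (fun p : ℝ × Euc d => w (-p.1, p.2)) p =
        -dirDeriv (tDir d) w (-p.1, p.2) := fun p => by
      rw [dirDeriv_timeReflect d hw]
      have : ((-(tDir d).1, (tDir d).2) : ℝ × Euc d) = -tDir d := by simp [tDir]
      rw [this]
      simp [dirDeriv]
    have hx : ∀ i, dirDeriv (xDir d i) (fun p : ℝ × Euc d => w (-p.1, p.2)) =
        fun p => dirDeriv (xDir d i) w (-p.1, p.2) := fun i => by
      ext p
      rw [dirDeriv_timeReflect d hw]
      simp [xDir]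
    have hsm : ContDiff ℝ (⊤ : ℕ∞) (fun p : ℝ × Euc d => ((-p.1, p.2) : ℝ × Euc d)) := by fun_prop
    have := wave_unique_forward d (w := fun p => w (-p.1, p.2)) (hw.comp hsm)
      (fun p => by
        simp only [hx]
        have e : dirDeriv (tDir d) (fun p : ℝ × Euc d => w (-p.1, p.2)) =
          fun p => (fun q => -dirDeriv (tDir d) w q) (-p.1, p.2) := by ext p; exact hneg p
        rw [e, dirDeriv_timeReflect d (contDiff_dirDeriv _ hw).neg]
        have e2 : ((-(tDir d).1, (tDir d).2) : ℝ × Euc d) = -tDir d := by simp [tDir]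
        rw [e2]
        have e3 : dirDeriv (-tDir d) (fun q => -dirDeriv (tDir d) w q) (-p.1, p.2) =
          dirDeriv (tDir d) (dirDeriv (tDir d) w) (-p.1, p.2) := by
          unfold dirDeriv
          rw [fderiv_fun_neg]
          simp
        rw [e3, heq]
        refine Finset.sum_congr rfl fun i _ => ?_
        rw [dirDeriv_timeReflect d (contDiff_dirDeriv _ hw)]
        simp [xDir])
      (fun x => by simpa using h0 x) (fun x => by rw [hneg]; simp [h1])
      (t := -p.1) (by linarith) p.2
    simpa using this

/-- The Fourier transform of a centred Gaussian of width `R`. -/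
lemma integral_gaussian_mul_phase {V : Type*} [NormedAddCommGroup V] [InnerProductSpace ℝ V]
    [FiniteDimensional ℝ V] [MeasurableSpace V] [BorelSpace V] {R : ℝ} (hR : 0 < R) (ζ : V) :
    ∫ x : V, ((rexp (-(π / R ^ 2) * ‖x‖ ^ 2) : ℝ) : ℂ) *
        Complex.exp (((2 * π * inner ℝ ζ x : ℝ) : ℂ) * Complex.I) =
      ((R ^ Module.finrank ℝ V * rexp (-π * R ^ 2 * ‖ζ‖ ^ 2) : ℝ) : ℂ) := by
  have hb : 0 < (((π / R ^ 2 : ℝ) : ℂ)).re := by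
    rw [Complex.ofReal_re]; positivity
  have h := GaussianFourier.integral_cexp_neg_mul_sq_norm_add hb (2 * π * Complex.I) ζ
  have h2 : ((π : ℂ) / ((π / R ^ 2 : ℝ) : ℂ)) ^ (Module.finrank ℝ V / 2 : ℂ) =
      ((R ^ Module.finrank ℝ V : ℝ) : ℂ) := by
    have : ((π : ℂ) / ((π / R ^ 2 : ℝ) : ℂ)) = ((R ^ 2 : ℝ) : ℂ) := by
      rw [← Complex.ofReal_div]; congr 1; field_simp
    have e2 : (Module.finrank ℝ V / 2 : ℂ) = ((Module.finrank ℝ V / 2 : ℝ) : ℂ) := by push_cast; rfl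
    rw [this, e2, ← Complex.ofReal_cpow (by positivity), ← Real.rpow_natCast R 2,
      ← Real.rpow_mul hR.le]
    congr 1
    rw [show ((2 : ℕ) : ℝ) * (Module.finrank ℝ V / 2 : ℝ) = (Module.finrank ℝ V : ℕ) by
      push_cast; ring, Real.rpow_natCast]
  rw [h2] at h
  have h3 : Complex.exp ((2 * π * Complex.I) ^ 2 * ‖ζ‖ ^ 2 / (4 * ((π / R ^ 2 : ℝ) : ℂ))) =
      ((rexp (-π * R ^ 2 * ‖ζ‖ ^ 2) : ℝ) : ℂ) := by
    rw [Complex.ofReal_exp]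
    congr 1
    have : (R : ℂ) ≠ 0 := by exact_mod_cast hR.ne'
    have : (π : ℂ) ≠ 0 := by exact_mod_cast pi_pos.ne'
    push_cast
    rw [mul_pow, Complex.I_sq]
    field_simp
    ring
  rw [h3, ← Complex.ofReal_mul] at h
  rw [← h]
  congr 1
  ext x
  rw [Complex.ofReal_exp, ← Complex.exp_add]
  congr 1
  push_cast
  ring

lemma integrable_gaussian {V : Type*} [NormedAddCommGroup V] [InnerProductSpace ℝ V]
    [FiniteDimensional ℝ V] [MeasurableSpace V] [BorelSpace V] {R : ℝ} (hR : 0 < R) :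
    Integrable (fun x : V => rexp (-(π / R ^ 2) * ‖x‖ ^ 2)) := by
  have hb : 0 < (((π / R ^ 2 : ℝ) : ℂ)).re := by
    rw [Complex.ofReal_re]; positivity
  have := (GaussianFourier.integrable_cexp_neg_mul_sq_norm_add hb 0 (0 : V)).norm
  refine this.congr (Filter.Eventually.of_forall fun x => ?_)
  simp only [Complex.norm_exp]
  congr 1
  simp [← Complex.ofReal_pow]

/-- Schur's test for the `T T^*` kernel of an oscillatory integral operator. -/
lemma lintegral_oscillatory_sq_le {X Y : Type*} [MeasurableSpace X] [MeasurableSpace Y]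
    {μ : Measure X} [SFinite μ] {ν : Measure Y} [SFinite ν] {w : Y → ℝ} (hw : Integrable w ν)
    (hw0 : ∀ y, 0 ≤ w y) {φ : Y → X → ℝ} (hφ : Measurable (Function.uncurry φ)) {f : X → ℂ}
    (hf : Integrable f μ) {K : X → X → ℝ≥0∞} (hKm : Measurable (Function.uncurry K))
    (hKs : ∀ ξ η, K ξ η = K η ξ)
    (hK : ∀ ξ η, ‖∫ y, (w y : ℂ) * Complex.exp (((φ y ξ - φ y η : ℝ) : ℂ) * Complex.I) ∂ν‖ₑ ≤ K ξ η)
    {S : Set X} (hS : MeasurableSet S) (hfS : ∀ ξ, ξ ∉ S → f ξ = 0) {A : ℝ≥0∞}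
    (hA : ∀ ξ ∈ S, ∫⁻ η in S, K ξ η ∂μ ≤ A) :
    ∫⁻ y, ENNReal.ofReal (w y) *
        ‖∫ ξ, Complex.exp ((φ y ξ : ℂ) * Complex.I) * f ξ ∂μ‖ₑ ^ 2 ∂ν ≤
      A * ∫⁻ ξ, ‖f ξ‖ₑ ^ 2 ∂μ := by
  set U : Y → ℂ := fun y => ∫ ξ, Complex.exp ((φ y ξ : ℂ) * Complex.I) * f ξ ∂μ with hU
  set F : Y × (X × X) → ℂ := fun z => (w z.1 : ℂ) *
    (Complex.exp (((φ z.1 z.2.1 - φ z.1 z.2.2 : ℝ) : ℂ) * Complex.I) *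
      (f z.2.1 * starRingEnd ℂ (f z.2.2))) with hF
  have hff : Integrable (fun p : X × X => f p.1 * starRingEnd ℂ (f p.2)) (μ.prod μ) := by
    refine Integrable.mul_prod (f := f) (g := fun x => starRingEnd ℂ (f x)) hf ?_
    exact (Complex.conjLIE.toContinuousLinearEquiv.toContinuousLinearMap.integrable_comp hf)
  have hFint : Integrable F (ν.prod (μ.prod μ)) := by
    have h1 : Integrable (fun z : Y × (X × X) => (w z.1 : ℂ) * (f z.2.1 * starRingEnd ℂ (f z.2.2)))
        (ν.prod (μ.prod μ)) :=
      Integrable.mul_prod (f := fun y => (w y : ℂ))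
        (g := fun p : X × X => f p.1 * starRingEnd ℂ (f p.2)) hw.ofReal hff
    have h2 : Measurable (fun z : Y × (X × X) =>
        Complex.exp (((φ z.1 z.2.1 - φ z.1 z.2.2 : ℝ) : ℂ) * Complex.I)) := by
      have a1 : Measurable (fun z : Y × (X × X) => φ z.1 z.2.1) :=
        hφ.comp (measurable_fst.prodMk measurable_snd.fst)
      have a2 : Measurable (fun z : Y × (X × X) => φ z.1 z.2.2) :=
        hφ.comp (measurable_fst.prodMk measurable_snd.snd)
      fun_prop
    refine (h1.bdd_mul (c := 1) h2.aestronglyMeasurable (Filter.Eventually.of_forall fun z => ?_)).congr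
      (Filter.Eventually.of_forall fun z => ?_)
    · rw [Complex.norm_exp_ofReal_mul_I]
    · simp only [hF]; ring
  have hUU : ∀ y, ∫ p, F (y, p) ∂(μ.prod μ) = ((w y * ‖U y‖ ^ 2 : ℝ) : ℂ) := by
    intro y
    have : ∀ p : X × X, F (y, p) = (w y : ℂ) * ((Complex.exp ((φ y p.1 : ℂ) * Complex.I) * f p.1) *
        starRingEnd ℂ (Complex.exp ((φ y p.2 : ℂ) * Complex.I) * f p.2)) := by
      intro p
      simp only [hF, map_mul, ← Complex.exp_conj, Complex.conj_ofReal, Complex.conj_I]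
      push_cast
      rw [sub_mul, sub_eq_add_neg, Complex.exp_add]
      ring_nf
    simp_rw [this]
    rw [integral_const_mul, integral_prod_mul
      (f := fun ξ => Complex.exp ((φ y ξ : ℂ) * Complex.I) * f ξ)
      (g := fun ξ => starRingEnd ℂ (Complex.exp ((φ y ξ : ℂ) * Complex.I) * f ξ)), integral_conj,
      Complex.mul_conj]
    push_cast
    rw [Complex.normSq_eq_norm_sq]
    simp [hU]
  have hIntegrable : Integrable (fun y => w y * ‖U y‖ ^ 2) ν := by
    have := hFint.integral_prod_left
    simp_rw [hUU] at this
    exact this.re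
  have e1 : ∫⁻ y, ENNReal.ofReal (w y) * ‖U y‖ₑ ^ 2 ∂ν = ENNReal.ofReal (∫ y, w y * ‖U y‖ ^ 2 ∂ν) := by
    rw [ofReal_integral_eq_lintegral_ofReal hIntegrable
      (Filter.Eventually.of_forall fun y => mul_nonneg (hw0 y) (sq_nonneg _))]
    congr 1
    ext y
    rw [ENNReal.ofReal_mul (hw0 y), ENNReal.ofReal_pow (norm_nonneg _), ofReal_norm]
  have e2 : ((∫ y, w y * ‖U y‖ ^ 2 ∂ν : ℝ) : ℂ) = ∫ p : X × X, ∫ y, F (y, p) ∂ν ∂(μ.prod μ) := by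
    rw [← integral_integral_swap (f := fun y p => F (y, p)) hFint, ← integral_complex_ofReal]
    congr 1
    ext y
    rw [hUU]
  have hfe : AEMeasurable (fun ξ => ‖f ξ‖ₑ) μ := hf.aestronglyMeasurable.enorm
  have e3 : ENNReal.ofReal (∫ y, w y * ‖U y‖ ^ 2 ∂ν) ≤
      ∫⁻ p : X × X, ‖f p.1‖ₑ * ‖f p.2‖ₑ * K p.1 p.2 ∂(μ.prod μ) := by
    have a0 : 0 ≤ ∫ y, w y * ‖U y‖ ^ 2 ∂ν :=
      integral_nonneg fun y => mul_nonneg (hw0 y) (sq_nonneg _)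
    have : ENNReal.ofReal (∫ y, w y * ‖U y‖ ^ 2 ∂ν) =
        ‖((∫ y, w y * ‖U y‖ ^ 2 ∂ν : ℝ) : ℂ)‖ₑ := by
      rw [← ofReal_norm, Complex.norm_real, Real.norm_of_nonneg a0]
    rw [this, e2]
    refine (enorm_integral_le_lintegral_enorm _).trans (lintegral_mono fun p => ?_)
    have : ∀ y, F (y, p) = ((w y : ℂ) * Complex.exp (((φ y p.1 - φ y p.2 : ℝ) : ℂ) * Complex.I)) *
        (f p.1 * starRingEnd ℂ (f p.2)) := by
      intro y; simp only [hF]; ring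
    simp_rw [this]
    rw [integral_mul_const, enorm_mul, enorm_mul, mul_comm]
    have hc : ‖starRingEnd ℂ (f p.2)‖ₑ = ‖f p.2‖ₑ := by
      rw [← ofReal_norm, ← ofReal_norm, Complex.norm_conj]
    rw [hc]
    gcongr
    exact hK _ _
  have hSz : ∀ ξ, ‖f ξ‖ₑ = S.indicator (fun ξ => ‖f ξ‖ₑ) ξ := by
    intro ξ
    by_cases h : ξ ∈ S
    · simp [h]
    · simp [h, hfS ξ h]
  have hI : ∫⁻ p : X × X, ‖f p.1‖ₑ ^ 2 * S.indicator 1 p.2 * K p.1 p.2 ∂(μ.prod μ) ≤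
      A * ∫⁻ ξ, ‖f ξ‖ₑ ^ 2 ∂μ := by
    have m1 : AEMeasurable (fun p : X × X => ‖f p.1‖ₑ ^ 2 * S.indicator 1 p.2 * K p.1 p.2)
        (μ.prod μ) := by
      refine AEMeasurable.mul (AEMeasurable.mul ?_ ?_) hKm.aemeasurable
      · exact (hfe.comp_quasiMeasurePreserving Measure.quasiMeasurePreserving_fst).pow_const 2
      · exact ((measurable_one.indicator hS).comp measurable_snd).aemeasurable
    rw [lintegral_prod _ m1, ← lintegral_const_mul'' _ (hfe.pow_const 2)]
    refine lintegral_mono fun ξ => ?_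
    dsimp only
    by_cases hξ : ξ ∈ S
    · have : ∀ η, ‖f ξ‖ₑ ^ 2 * S.indicator 1 η * K ξ η =
          ‖f ξ‖ₑ ^ 2 * (S.indicator (K ξ) η) := by
        intro η
        by_cases h : η ∈ S <;> simp [h]
      simp_rw [this]
      have hKξ : Measurable (K ξ) := hKm.comp (measurable_const.prodMk measurable_id)
      rw [lintegral_const_mul _ (hKξ.indicator hS), lintegral_indicator hS, mul_comm]
      gcongr
      exact hA ξ hξ
    · simp [hfS ξ hξ]
  have hI' : ∫⁻ p : X × X, ‖f p.2‖ₑ ^ 2 * S.indicator 1 p.1 * K p.1 p.2 ∂(μ.prod μ) ≤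
      A * ∫⁻ ξ, ‖f ξ‖ₑ ^ 2 ∂μ := by
    rw [← lintegral_prod_swap]
    refine le_trans (le_of_eq ?_) hI
    congr 1
    ext p
    rw [Prod.fst_swap, Prod.snd_swap, hKs]
  have hadd : 2 * ∫⁻ p : X × X, ‖f p.1‖ₑ * ‖f p.2‖ₑ * K p.1 p.2 ∂(μ.prod μ) ≤
      2 * (A * ∫⁻ ξ, ‖f ξ‖ₑ ^ 2 ∂μ) := by
    have m1 : AEMeasurable (fun p : X × X => ‖f p.1‖ₑ ^ 2 * S.indicator 1 p.2 * K p.1 p.2)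
        (μ.prod μ) := by
      refine AEMeasurable.mul (AEMeasurable.mul ?_ ?_) hKm.aemeasurable
      · exact (hfe.comp_quasiMeasurePreserving Measure.quasiMeasurePreserving_fst).pow_const 2
      · exact ((measurable_one.indicator hS).comp measurable_snd).aemeasurable
    rw [← lintegral_const_mul' _ _ (by simp), two_mul (A * _)]
    refine le_trans ?_ (add_le_add hI hI')
    rw [← lintegral_add_left' m1]
    refine lintegral_mono fun p => ?_
    dsimp only
    by_cases h1 : p.1 ∈ S
    · by_cases h2 : p.2 ∈ S
      · simp only [h1, h2, indicator_of_mem, Pi.one_apply, mul_one]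
        rw [← add_mul, ← mul_assoc, ← mul_assoc]
        gcongr
        rw [← ofReal_norm, ← ofReal_norm, ← ENNReal.ofReal_pow (norm_nonneg _),
          ← ENNReal.ofReal_pow (norm_nonneg _), ← ENNReal.ofReal_add (by positivity) (by positivity),
          mul_assoc, ← ENNReal.ofReal_mul (by positivity)]
        rw [show (2 : ℝ≥0∞) = ENNReal.ofReal 2 by simp, ← ENNReal.ofReal_mul (by positivity)]
        apply ENNReal.ofReal_le_ofReal
        nlinarith [sq_nonneg (‖f p.1‖ - ‖f p.2‖)]
      · simp [hfS _ h2]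
    · simp [hfS _ h1]
  rw [e1]
  refine e3.trans ?_
  exact (ENNReal.mul_le_mul_iff_right (by simp) (by simp)).1 hadd

lemma lintegral_comp_smul_eq {V : Type*} [NormedAddCommGroup V] [NormedSpace ℝ V]
    [FiniteDimensional ℝ V] [MeasurableSpace V] [BorelSpace V] (μ : Measure V) [μ.IsAddHaarMeasure]
    {g : V → ℝ≥0∞} {s : ℝ} (hs : 0 < s) :
    ∫⁻ x, g x ∂μ = ENNReal.ofReal (s ^ Module.finrank ℝ V) * ∫⁻ x, g (s • x) ∂μ := by
  have h1 := Measure.map_addHaar_smul μ hs.ne'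
  have h2 : ∫⁻ x, g (s • x) ∂μ = ∫⁻ x, g x ∂(Measure.map (s • ·) μ) := by
    exact ((Homeomorph.smulOfNeZero s hs.ne').toMeasurableEquiv.measurableEmbedding.lintegral_map
      g).symm
  rw [h2, h1, lintegral_smul_measure, smul_eq_mul, ← mul_assoc,
    ← ENNReal.ofReal_mul (by positivity), abs_of_pos (by positivity),
    mul_inv_cancel₀ (by positivity), ENNReal.ofReal_one, one_mul]

lemma lintegral_gaussian_eq_one {V : Type*} [NormedAddCommGroup V] [InnerProductSpace ℝ V]
    [FiniteDimensional ℝ V] [MeasurableSpace V] [BorelSpace V] {R : ℝ} (hR : 0 < R) :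
    ∫⁻ x : V, ENNReal.ofReal (R ^ Module.finrank ℝ V * rexp (-π * R ^ 2 * ‖x‖ ^ 2)) = 1 := by
  have h := integral_gaussian_mul_phase (V := V) (inv_pos.2 hR) 0
  have hi := integrable_gaussian (V := V) (inv_pos.2 hR)
  have e : ∀ x : V, -(π / R⁻¹ ^ 2) * ‖x‖ ^ 2 = -π * R ^ 2 * ‖x‖ ^ 2 := by
    intro x; field_simp
  simp only [e] at h hi
  simp only [inner_zero_left, mul_zero, Complex.ofReal_zero, zero_mul, Complex.exp_zero, mul_one,
    norm_zero, ne_eq, OfNat.ofNat_ne_zero, not_false_eq_true, zero_pow, Real.exp_zero] at h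
  rw [integral_complex_ofReal] at h
  have h' := Complex.ofReal_injective h
  rw [← ofReal_integral_eq_lintegral_ofReal (hi.const_mul _)
    (Filter.Eventually.of_forall fun x => by positivity), integral_const_mul, h', inv_pow,
    mul_inv_cancel₀ (by positivity), ENNReal.ofReal_one]

/-- The dyadic shell `{lam ≤ ‖ξ‖ < 2 lam}`. -/
def shell (d : ℕ) (lam : ℝ) : Set (Euc d) := {ξ | lam ≤ ‖ξ‖ ∧ ‖ξ‖ < 2 * lam}

lemma measurableSet_shell (d : ℕ) (lam : ℝ) : MeasurableSet (shell d lam) :=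
  (measurableSet_le measurable_const measurable_norm).inter
    (measurableSet_lt measurable_norm measurable_const)

/-- The kernel of the Gaussian-localised half-wave operator at a fixed time. -/
def spaceKernel (d : ℕ) (R : ℝ) (ξ η : Euc d) : ℝ := R ^ d * rexp (-π * R ^ 2 * ‖ξ - η‖ ^ 2)

/-- The time factor of the kernel of the Gaussian-localised space-time half-wave operator. -/
def timeKernel (d : ℕ) (T : ℝ) (ξ η : Euc d) : ℝ := T * rexp (-π * T ^ 2 * (‖ξ‖ - ‖η‖) ^ 2)

lemma spaceKernel_nonneg (d : ℕ) {R : ℝ} (hR : 0 < R) (ξ η : Euc d) : 0 ≤ spaceKernel d R ξ η := by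
  unfold spaceKernel; positivity

lemma timeKernel_nonneg (d : ℕ) {T : ℝ} (hT : 0 < T) (ξ η : Euc d) : 0 ≤ timeKernel d T ξ η := by
  unfold timeKernel; positivity

lemma lintegral_spaceKernel (d : ℕ) {R : ℝ} (hR : 0 < R) (ξ : Euc d) :
    ∫⁻ η, ENNReal.ofReal (spaceKernel d R ξ η) = 1 := by
  rw [← lintegral_gaussian_eq_one (V := Euc d) hR]
  simp only [finrank_euclideanSpace, Fintype.card_fin, spaceKernel]
  exact lintegral_sub_left_eq_self (μ := volume)
    (fun x : Euc d => ENNReal.ofReal (R ^ d * rexp (-π * R ^ 2 * ‖x‖ ^ 2))) ξ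

/-- Dilating `η` costs only a constant in the spatial kernel. -/
lemma spaceKernel_smul_le (d : ℕ) {R s : ℝ} (hR : 0 < R) {ξ : Euc d} (hξ : 0 < ‖ξ‖)
    (hs : 1 ≤ s) (hs' : s ≤ 1 + 1 / (R * ‖ξ‖)) (η : Euc d) :
    spaceKernel d R ξ (s • η) ≤ rexp π * 2 ^ d * spaceKernel d (R / 2) ξ η := by
  have hs0 : 0 < s := by linarith
  have h1 : ‖ξ - η‖ ≤ ‖ξ - s • η‖ + 1 / R := by
    have e : s • (ξ - η) = (ξ - s • η) + (s - 1) • ξ := by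
      rw [smul_sub, sub_smul, one_smul]; abel
    have e2 : s * ‖ξ - η‖ ≤ ‖ξ - s • η‖ + 1 / R := by
      calc s * ‖ξ - η‖ = ‖s • (ξ - η)‖ := by rw [norm_smul, Real.norm_of_nonneg hs0.le]
        _ ≤ ‖ξ - s • η‖ + ‖(s - 1) • ξ‖ := by rw [e]; exact norm_add_le _ _
        _ ≤ ‖ξ - s • η‖ + 1 / R := by
          gcongr
          rw [norm_smul, Real.norm_of_nonneg (by linarith)]
          calc (s - 1) * ‖ξ‖ ≤ (1 / (R * ‖ξ‖)) * ‖ξ‖ := by gcongr; linarith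
            _ = 1 / R := by field_simp
    nlinarith [norm_nonneg (ξ - η)]
  have h2 : (R * ‖ξ - η‖) ^ 2 ≤ 2 * (R * ‖ξ - s • η‖) ^ 2 + 2 := by
    have : R * ‖ξ - η‖ ≤ R * ‖ξ - s • η‖ + 1 := by
      calc R * ‖ξ - η‖ ≤ R * (‖ξ - s • η‖ + 1 / R) := by gcongr
        _ = _ := by field_simp
    have h0 : 0 ≤ R * ‖ξ - η‖ := by positivity
    nlinarith [sq_nonneg (R * ‖ξ - s • η‖ - 1)]
  unfold spaceKernel
  have e3 : rexp π * 2 ^ d * ((R / 2) ^ d * rexp (-π * (R / 2) ^ 2 * ‖ξ - η‖ ^ 2)) =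
      R ^ d * rexp (π - π * (R / 2) ^ 2 * ‖ξ - η‖ ^ 2) := by
    rw [sub_eq_add_neg π, Real.exp_add, div_pow R 2 d, ← neg_mul, ← neg_mul]
    field_simp
  rw [e3]
  gcongr
  nlinarith [pi_pos, sq_nonneg (R * ‖ξ - s • η‖)]

lemma lintegral_timeKernel_smul_le (d : ℕ) {T : ℝ} (hT : 0 < T) (ξ : Euc d) {η : Euc d}
    (hη : 0 < ‖η‖) :
    ∫⁻ s : ℝ in Ici 0, ENNReal.ofReal (timeKernel d T ξ (s • η)) ≤ ENNReal.ofReal (1 / ‖η‖) := by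
  have h1 : ∫⁻ s : ℝ in Ici 0, ENNReal.ofReal (timeKernel d T ξ (s • η)) ≤
      ∫⁻ s : ℝ, ENNReal.ofReal (T * rexp (-π * T ^ 2 * ‖‖ξ‖ - ‖η‖ * s‖ ^ 2)) := by
    refine (lintegral_mono_ae ?_).trans (setLIntegral_le_lintegral (Ici 0) _)
    filter_upwards [ae_restrict_mem measurableSet_Ici] with s hs
    apply ENNReal.ofReal_le_ofReal
    unfold timeKernel
    rw [norm_smul, Real.norm_of_nonneg hs, Real.norm_eq_abs, sq_abs, mul_comm s]
  have h2 : ∫⁻ s : ℝ, ENNReal.ofReal (T * rexp (-π * T ^ 2 * ‖‖ξ‖ - s‖ ^ 2)) = 1 := by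
    rw [lintegral_sub_left_eq_self (μ := volume)
      (fun x : ℝ => ENNReal.ofReal (T * rexp (-π * T ^ 2 * ‖x‖ ^ 2))) ‖ξ‖]
    simpa using lintegral_gaussian_eq_one (V := ℝ) hT
  rw [lintegral_comp_smul_eq volume hη] at h2
  simp only [Module.finrank_self, pow_one, smul_eq_mul] at h2
  refine h1.trans (le_of_eq ?_)
  rw [one_div, ENNReal.ofReal_inv_of_pos hη]
  exact ENNReal.eq_inv_of_mul_eq_one_left (by rw [mul_comm]; exact h2)

/-- Constant in the bound for the cone kernel. -/
def coneConst (d : ℕ) : ℝ := 2 * (2 ^ d * (rexp π * 2 ^ d) * 2)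

lemma coneConst_pos (d : ℕ) : 0 < coneConst d := by unfold coneConst; positivity

lemma lintegral_coneKernel_le_of_one_le (d : ℕ) {lam R T : ℝ} (hlam : 0 < lam) (hR : 0 < R)
    (hT : 0 < T) (hlR : 1 ≤ lam * R) {ξ : Euc d} (hξ : ξ ∈ shell d lam) :
    ∫⁻ η in shell d lam, ENNReal.ofReal (timeKernel d T ξ η * spaceKernel d R ξ η) ≤
      ENNReal.ofReal (coneConst d * R) := by
  have hξ0 : 0 < ‖ξ‖ := hlam.trans_le hξ.1
  set h : ℝ := 1 / (R * ‖ξ‖) with hh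
  have hh0 : 0 < h := by positivity
  have hh1 : h ≤ 1 := by
    rw [hh, div_le_one (by positivity)]
    calc 1 ≤ lam * R := hlR
      _ ≤ R * ‖ξ‖ := by rw [mul_comm]; gcongr; exact hξ.1
  set G : Euc d → ℝ≥0∞ := (shell d lam).indicator
    (fun η => ENNReal.ofReal (timeKernel d T ξ η * spaceKernel d R ξ η)) with hG
  have hcont : Continuous (fun η : Euc d => timeKernel d T ξ η * spaceKernel d R ξ η) := by
    unfold timeKernel spaceKernel; fun_prop
  have hGm : Measurable G := (hcont.measurable.ennreal_ofReal).indicator (measurableSet_shell d lam)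
  rw [← lintegral_indicator (measurableSet_shell d lam)]
  change ∫⁻ η, G η ≤ _
  have h1 : ∀ s ∈ Icc (1 : ℝ) (1 + h), ∫⁻ η, G η ≤ ENNReal.ofReal (2 ^ d) * ∫⁻ η, G (s • η) := by
    intro s hs
    rw [lintegral_comp_smul_eq (volume : Measure (Euc d)) (s := s) (by linarith [hs.1])]
    gcongr
    simp only [finrank_euclideanSpace, Fintype.card_fin]
    gcongr
    · linarith [hs.1]
    · linarith [hs.2]
  have h2 : ENNReal.ofReal h * ∫⁻ η, G η ≤
      ENNReal.ofReal (2 ^ d) * ∫⁻ η, ∫⁻ s in Icc (1 : ℝ) (1 + h), G (s • η) := by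
    rw [← lintegral_lintegral_swap
      (f := fun (s : ℝ) (η : Euc d) => G (s • η)) (by
        refine (hGm.comp (?_ : Measurable fun p : ℝ × Euc d => p.1 • p.2)).aemeasurable
        fun_prop)]
    rw [← lintegral_const_mul' (ENNReal.ofReal (2 ^ d)) _ (by simp)]
    calc ENNReal.ofReal h * ∫⁻ η, G η = ∫⁻ s in Icc (1 : ℝ) (1 + h), ∫⁻ η, G η := by
          rw [lintegral_const, Measure.restrict_apply MeasurableSet.univ, univ_inter,
            Real.volume_Icc, mul_comm, add_sub_cancel_left]
      _ ≤ _ := by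
        refine setLIntegral_mono' measurableSet_Icc fun s hs => h1 s hs
  have h3 : ∀ η, ∫⁻ s in Icc (1 : ℝ) (1 + h), G (s • η) ≤
      ENNReal.ofReal (rexp π * 2 ^ d * (2 / lam)) * ENNReal.ofReal (spaceKernel d (R / 2) ξ η) := by
    intro η
    by_cases hη : lam / 2 ≤ ‖η‖
    · have hη0 : 0 < ‖η‖ := by linarith
      calc ∫⁻ s in Icc (1 : ℝ) (1 + h), G (s • η)
          ≤ ∫⁻ s in Icc (1 : ℝ) (1 + h), ENNReal.ofReal (timeKernel d T ξ (s • η)) *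
              ENNReal.ofReal (rexp π * 2 ^ d * spaceKernel d (R / 2) ξ η) := by
            refine setLIntegral_mono' measurableSet_Icc fun s hs => ?_
            rw [← ENNReal.ofReal_mul (timeKernel_nonneg d hT _ _)]
            refine (indicator_le_self' (by simp) _).trans ?_
            apply ENNReal.ofReal_le_ofReal
            gcongr
            · exact timeKernel_nonneg d hT _ _
            · exact spaceKernel_smul_le d hR hξ0 hs.1 hs.2 η
        _ ≤ (∫⁻ s in Ici (0 : ℝ), ENNReal.ofReal (timeKernel d T ξ (s • η))) *
              ENNReal.ofReal (rexp π * 2 ^ d * spaceKernel d (R / 2) ξ η) := by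
            rw [lintegral_mul_const' _ _ (by simp)]
            gcongr
            intro s hs
            exact le_trans zero_le_one hs.1
        _ ≤ ENNReal.ofReal (2 / lam) *
              ENNReal.ofReal (rexp π * 2 ^ d * spaceKernel d (R / 2) ξ η) := by
            gcongr
            refine (lintegral_timeKernel_smul_le d hT ξ hη0).trans (ENNReal.ofReal_le_ofReal ?_)
            rw [div_le_div_iff₀ hη0 hlam]
            linarith
        _ = _ := by
            rw [← ENNReal.ofReal_mul (by positivity), ← ENNReal.ofReal_mul (by positivity)]
            congr 1; ring
    · have : ∫⁻ s in Icc (1 : ℝ) (1 + h), G (s • η) = 0 := by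
        rw [setLIntegral_congr_fun (g := fun _ => 0) measurableSet_Icc]
        · simp
        · intro s hs
          apply indicator_of_notMem
          intro hm
          have := hm.1
          rw [norm_smul, Real.norm_of_nonneg (by linarith [hs.1])] at this
          have h2 : s * ‖η‖ ≤ 2 * ‖η‖ := by
            gcongr
            linarith [hs.2]
          push Not at hη
          linarith
      rw [this]
      exact zero_le
  have h4 : ENNReal.ofReal h * ∫⁻ η, G η ≤
      ENNReal.ofReal (2 ^ d) * ENNReal.ofReal (rexp π * 2 ^ d * (2 / lam)) := by
    refine h2.trans ?_
    gcongr
    refine (lintegral_mono h3).trans ?_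
    rw [lintegral_const_mul' _ _ (by simp), lintegral_spaceKernel d (by positivity), mul_one]
  have h5 : ∫⁻ η, G η = ENNReal.ofReal (R * ‖ξ‖) * (ENNReal.ofReal h * ∫⁻ η, G η) := by
    rw [← mul_assoc, ← ENNReal.ofReal_mul (by positivity), hh, mul_one_div_cancel (by positivity)]
    simp
  rw [h5]
  calc _ ≤ ENNReal.ofReal (R * (2 * lam)) *
        (ENNReal.ofReal (2 ^ d) * ENNReal.ofReal (rexp π * 2 ^ d * (2 / lam))) := by
        gcongr
        exact hξ.2.le
    _ = _ := by
        rw [← ENNReal.ofReal_mul (by positivity), ← ENNReal.ofReal_mul (by positivity)]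
        congr 1
        unfold coneConst
        field_simp

/-- Constant in the fixed-time local energy bound. -/
def spaceConst (d : ℕ) : ℝ := 1 + 2 ^ d * (volume (Metric.ball (0 : Euc d) 1)).toReal

lemma spaceConst_pos (d : ℕ) : 0 < spaceConst d := by unfold spaceConst; positivity

lemma lintegral_spaceKernel_le (d : ℕ) {lam R : ℝ} (hlam : 0 < lam) (hR : 0 < R) (ξ : Euc d) :
    ∫⁻ η in shell d lam, ENNReal.ofReal (spaceKernel d R ξ η) ≤
      ENNReal.ofReal (spaceConst d * min 1 (lam * R) ^ d) := by
  rcases le_total 1 (lam * R) with h | h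
  · rw [min_eq_left h, one_pow, mul_one]
    refine (setLIntegral_le_lintegral _ _).trans ?_
    rw [lintegral_spaceKernel d hR, ← ENNReal.ofReal_one]
    apply ENNReal.ofReal_le_ofReal
    unfold spaceConst
    have : 0 ≤ 2 ^ d * (volume (Metric.ball (0 : Euc d) 1)).toReal := by positivity
    linarith
  · rw [min_eq_right h]
    have hsub : shell d lam ⊆ Metric.ball (0 : Euc d) (2 * lam) := fun ξ hξ => by
      simpa using hξ.2
    calc ∫⁻ η in shell d lam, ENNReal.ofReal (spaceKernel d R ξ η)
        ≤ ∫⁻ η in Metric.ball (0 : Euc d) (2 * lam), ENNReal.ofReal (R ^ d) := by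
          refine (lintegral_mono_set hsub).trans (lintegral_mono fun η => ?_)
          apply ENNReal.ofReal_le_ofReal
          unfold spaceKernel
          refine mul_le_of_le_one_right (by positivity) (Real.exp_le_one_iff.2 ?_)
          have : 0 ≤ π * R ^ 2 * ‖ξ - η‖ ^ 2 := by positivity
          linarith
      _ = ENNReal.ofReal (2 ^ d * (volume (Metric.ball (0 : Euc d) 1)).toReal * (lam * R) ^ d) := by
          rw [setLIntegral_const, Measure.addHaar_ball_of_pos _ _ (by positivity : 0 < 2 * lam),
            ← ENNReal.ofReal_toReal (measure_ball_lt_top (μ := volume) (x := (0 : Euc d)) (r := 1)).ne,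
            ← ENNReal.ofReal_mul (by positivity), ← ENNReal.ofReal_mul (by positivity)]
          simp only [finrank_euclideanSpace, Fintype.card_fin]
          rw [ENNReal.toReal_ofReal (by positivity)]
          congr 1
          rw [mul_pow, mul_pow]; ring
      _ ≤ _ := by
          apply ENNReal.ofReal_le_ofReal
          unfold spaceConst
          gcongr
          linarith

/-- Constant in the space-time local energy bound. -/
def timeConst (d : ℕ) : ℝ := rexp (16 * π) * coneConst d

lemma timeConst_pos (d : ℕ) : 0 < timeConst d := by
  unfold timeConst; have := coneConst_pos d; positivity

lemma lintegral_coneKernel_le {d : ℕ} (hd : 1 ≤ d) {lam R T : ℝ} (hlam : 0 < lam) (hR : 0 < R)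
    (hT : 0 < T) {ξ : Euc d} (hξ : ξ ∈ shell d lam) :
    ∫⁻ η in shell d lam, ENNReal.ofReal (timeKernel d T ξ η * spaceKernel d R ξ η) ≤
      ENNReal.ofReal (timeConst d * (R * min 1 (lam * R) ^ (d - 1))) := by
  have hc := coneConst_pos d
  rcases le_total 1 (lam * R) with h | h
  · rw [min_eq_left h, one_pow, mul_one]
    refine (lintegral_coneKernel_le_of_one_le d hlam hR hT h hξ).trans
      (ENNReal.ofReal_le_ofReal ?_)
    unfold timeConst
    gcongr
    refine le_mul_of_one_le_left hc.le (Real.one_le_exp (by positivity))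
  · rw [min_eq_right h]
    have hl := lintegral_coneKernel_le_of_one_le d hlam (inv_pos.2 hlam) hT
      (mul_inv_cancel₀ hlam.ne').ge hξ
    have hk : ∀ η ∈ shell d lam, spaceKernel d R ξ η ≤
        (lam * R) ^ d * rexp (16 * π) * spaceKernel d lam⁻¹ ξ η := by
      intro η hη
      unfold spaceKernel
      have h4 : ‖ξ - η‖ ≤ 4 * lam := by
        have := norm_sub_le ξ η
        linarith [hξ.2, hη.2]
      have h5 : rexp (-π * R ^ 2 * ‖ξ - η‖ ^ 2) ≤ 1 := by
        refine Real.exp_le_one_iff.2 ?_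
        have : 0 ≤ π * R ^ 2 * ‖ξ - η‖ ^ 2 := by positivity
        linarith
      have h6 : 1 ≤ rexp (16 * π) * rexp (-π * lam⁻¹ ^ 2 * ‖ξ - η‖ ^ 2) := by
        rw [← Real.exp_add]
        apply Real.one_le_exp
        have : lam⁻¹ ^ 2 * ‖ξ - η‖ ^ 2 ≤ 16 := by
          rw [← mul_pow]
          have a1 : lam⁻¹ * ‖ξ - η‖ ≤ 4 := by
            rw [inv_mul_le_iff₀ hlam]; linarith
          have a0 : 0 ≤ lam⁻¹ * ‖ξ - η‖ := by positivity
          nlinarith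
        nlinarith [pi_pos]
      calc R ^ d * rexp (-π * R ^ 2 * ‖ξ - η‖ ^ 2) ≤ R ^ d * 1 := by gcongr
        _ ≤ R ^ d * (rexp (16 * π) * rexp (-π * lam⁻¹ ^ 2 * ‖ξ - η‖ ^ 2)) := by gcongr
        _ = _ := by
          rw [mul_pow, inv_pow]
          field_simp
          rw [← mul_pow, mul_one_div_cancel hlam.ne', one_pow]
    calc ∫⁻ η in shell d lam, ENNReal.ofReal (timeKernel d T ξ η * spaceKernel d R ξ η)
        ≤ ∫⁻ η in shell d lam, ENNReal.ofReal ((lam * R) ^ d * rexp (16 * π)) *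
            ENNReal.ofReal (timeKernel d T ξ η * spaceKernel d lam⁻¹ ξ η) := by
          refine setLIntegral_mono' (measurableSet_shell d lam) fun η hη => ?_
          rw [← ENNReal.ofReal_mul (by positivity)]
          apply ENNReal.ofReal_le_ofReal
          calc _ ≤ timeKernel d T ξ η * ((lam * R) ^ d * rexp (16 * π) * spaceKernel d lam⁻¹ ξ η) := by
                gcongr
                · exact timeKernel_nonneg d hT _ _
                · exact hk η hη
            _ = _ := by ring
      _ ≤ ENNReal.ofReal ((lam * R) ^ d * rexp (16 * π)) * ENNReal.ofReal (coneConst d * lam⁻¹) := by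
          rw [lintegral_const_mul' _ _ (by simp)]
          gcongr
      _ = _ := by
          rw [← ENNReal.ofReal_mul (by positivity)]
          congr 1
          unfold timeConst
          obtain ⟨n, rfl⟩ : ∃ n, d = n + 1 := ⟨d - 1, by omega⟩
          rw [Nat.add_sub_cancel, pow_succ]
          field_simp

lemma integrable_moment_of_shell (d : ℕ) {f : Euc d → ℂ} (hf : Integrable f) {lam : ℝ}
    (hfS : ∀ ξ, ξ ∉ shell d lam → f ξ = 0) (n : ℕ) : Integrable (fun ξ => ‖ξ‖ ^ n * ‖f ξ‖) := by
  refine (hf.norm.const_mul ((2 * |lam|) ^ n)).mono'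
    ((continuous_norm.pow n).aestronglyMeasurable.mul hf.norm.aestronglyMeasurable)
    (Filter.Eventually.of_forall fun ξ => ?_)
  rw [Real.norm_of_nonneg (by positivity)]
  by_cases h : ξ ∈ shell d lam
  · gcongr
    exact h.2.le.trans (by gcongr; exact le_abs_self _)
  · simp [hfS ξ h]

lemma continuous_halfWave_of_shell (d : ℕ) {f : Euc d → ℂ} (hf : Integrable f) {lam : ℝ}
    (hfS : ∀ ξ, ξ ∉ shell d lam → f ξ = 0) :
    Continuous (fun p : ℝ × Euc d => halfWave d f p.1 p.2) :=
  (contDiff_halfWave d (integrable_moment_of_shell d hf hfS)).continuous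

lemma exp_neg_four_pi_le_gaussian (d : ℕ) {R : ℝ} (hR : 0 < R) {x : Euc d}
    (hx : x ∈ Metric.ball (0 : Euc d) (2 * R)) :
    rexp (-(4 * π)) ≤ rexp (-(π / R ^ 2) * ‖x‖ ^ 2) := by
  apply Real.exp_le_exp.2
  have h : ‖x‖ < 2 * R := by simpa using hx
  have : ‖x‖ ^ 2 ≤ 4 * R ^ 2 := by nlinarith [norm_nonneg x]
  rw [neg_mul, neg_le_neg_iff, div_mul_eq_mul_div, div_le_iff₀ (by positivity)]
  nlinarith [pi_pos]

/-- Local energy bound for frequency-localised half-waves at a fixed time. -/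
lemma lintegral_ball_halfWave_le (d : ℕ) {f : Euc d → ℂ} (hf : Integrable f) {lam R : ℝ}
    (hlam : 0 < lam) (hR : 0 < R) (hfS : ∀ ξ, ξ ∉ shell d lam → f ξ = 0) (t : ℝ) :
    ∫⁻ x in Metric.ball (0 : Euc d) (2 * R), ‖halfWave d f t x‖ₑ ^ 2 ≤
      ENNReal.ofReal (rexp (4 * π) * spaceConst d * min 1 (lam * R) ^ d) * ∫⁻ ξ, ‖f ξ‖ₑ ^ 2 := by
  have key := lintegral_oscillatory_sq_le (μ := (volume : Measure (Euc d)))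
    (ν := (volume : Measure (Euc d))) (w := fun x => rexp (-(π / R ^ 2) * ‖x‖ ^ 2))
    (integrable_gaussian hR) (fun y => (Real.exp_pos _).le)
    (φ := fun x ξ => 2 * π * (inner ℝ ξ x + t * ‖ξ‖))
    (Continuous.measurable (by fun_prop)) hf
    (K := fun ξ η => ENNReal.ofReal (spaceKernel d R ξ η))
    (ENNReal.measurable_ofReal.comp (Continuous.measurable (by
      unfold spaceKernel; fun_prop : Continuous fun p : Euc d × Euc d => spaceKernel d R p.1 p.2)))
    (fun ξ η => by simp only [spaceKernel, norm_sub_rev])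
    (fun ξ η => by
      have h := integral_gaussian_mul_phase hR (ξ - η)
      have e : ∀ x : Euc d, Complex.exp (((2 * π * (inner ℝ ξ x + t * ‖ξ‖) -
            2 * π * (inner ℝ η x + t * ‖η‖) : ℝ) : ℂ) * Complex.I) =
          Complex.exp (((2 * π * inner ℝ (ξ - η) x : ℝ) : ℂ) * Complex.I) *
            Complex.exp (((2 * π * t * (‖ξ‖ - ‖η‖) : ℝ) : ℂ) * Complex.I) := by
        intro x
        rw [← Complex.exp_add, inner_sub_left]
        congr 1
        push_cast
        ring
      simp_rw [e, ← mul_assoc]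
      rw [integral_mul_const, h, enorm_mul]
      rw [← ofReal_norm (Complex.exp _), Complex.norm_exp_ofReal_mul_I, ENNReal.ofReal_one, mul_one,
        ← ofReal_norm, Complex.norm_real, finrank_euclideanSpace, Fintype.card_fin]
      exact ENNReal.ofReal_le_ofReal (le_of_eq (Real.norm_of_nonneg (spaceKernel_nonneg d hR ξ η))))
    (measurableSet_shell d lam) hfS
    (fun ξ _ => lintegral_spaceKernel_le d hlam hR ξ)
  calc ∫⁻ x in Metric.ball (0 : Euc d) (2 * R), ‖halfWave d f t x‖ₑ ^ 2
      ≤ ∫⁻ x in Metric.ball (0 : Euc d) (2 * R), ENNReal.ofReal (rexp (4 * π)) *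
          (ENNReal.ofReal (rexp (-(π / R ^ 2) * ‖x‖ ^ 2)) * ‖halfWave d f t x‖ₑ ^ 2) := by
        refine setLIntegral_mono' measurableSet_ball fun x hx => ?_
        rw [← mul_assoc, ← ENNReal.ofReal_mul (by positivity)]
        refine le_mul_of_one_le_left' ?_
        rw [ENNReal.one_le_ofReal]
        have := exp_neg_four_pi_le_gaussian d hR hx
        calc 1 = rexp (4 * π) * rexp (-(4 * π)) := by rw [← Real.exp_add]; simp
          _ ≤ _ := by gcongr
    _ ≤ ENNReal.ofReal (rexp (4 * π)) * ∫⁻ x,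
          (ENNReal.ofReal (rexp (-(π / R ^ 2) * ‖x‖ ^ 2)) * ‖halfWave d f t x‖ₑ ^ 2) := by
        rw [lintegral_const_mul' _ _ (by simp)]
        gcongr
        exact Measure.restrict_le_self
    _ ≤ _ := by
        rw [mul_assoc, ENNReal.ofReal_mul (by positivity), mul_assoc]
        gcongr
        exact key

/-- Local smoothing bound for frequency-localised half-waves. -/
lemma lintegral_time_ball_halfWave_le {d : ℕ} (hd : 1 ≤ d) {f : Euc d → ℂ} (hf : Integrable f)
    {lam R : ℝ} (hlam : 0 < lam) (hR : 0 < R) (hfS : ∀ ξ, ξ ∉ shell d lam → f ξ = 0) :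
    ∫⁻ t, ∫⁻ x in Metric.ball (0 : Euc d) (2 * R), ‖halfWave d f t x‖ₑ ^ 2 ≤
      ENNReal.ofReal (rexp (5 * π) * timeConst d * (R * min 1 (lam * R) ^ (d - 1))) *
        ∫⁻ ξ, ‖f ξ‖ₑ ^ 2 := by
  have hcont := continuous_halfWave_of_shell d hf hfS
  have key : ∀ T : ℝ, 0 < T → ∫⁻ p : ℝ × Euc d,
      ENNReal.ofReal (rexp (-(π / T ^ 2) * ‖p.1‖ ^ 2) * rexp (-(π / R ^ 2) * ‖p.2‖ ^ 2)) *
        ‖halfWave d f p.1 p.2‖ₑ ^ 2 ≤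
      ENNReal.ofReal (timeConst d * (R * min 1 (lam * R) ^ (d - 1))) * ∫⁻ ξ, ‖f ξ‖ₑ ^ 2 := by
    intro T hT
    refine lintegral_oscillatory_sq_le (μ := (volume : Measure (Euc d)))
      (ν := (volume : Measure (ℝ × Euc d)))
      (w := fun p => rexp (-(π / T ^ 2) * ‖p.1‖ ^ 2) * rexp (-(π / R ^ 2) * ‖p.2‖ ^ 2))
      ((integrable_gaussian hT).mul_prod (integrable_gaussian hR)) (fun y => by positivity)
      (φ := fun p ξ => 2 * π * (inner ℝ ξ p.2 + p.1 * ‖ξ‖))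
      (Continuous.measurable (by fun_prop)) hf
      (K := fun ξ η => ENNReal.ofReal (timeKernel d T ξ η * spaceKernel d R ξ η))
      (ENNReal.measurable_ofReal.comp (Continuous.measurable (by
        unfold timeKernel spaceKernel; fun_prop :
          Continuous fun p : Euc d × Euc d => timeKernel d T p.1 p.2 * spaceKernel d R p.1 p.2)))
      (fun ξ η => by
        simp only [timeKernel, spaceKernel, norm_sub_rev, ← neg_sub ‖ξ‖ ‖η‖, neg_sq])
      (fun ξ η => ?_)
      (measurableSet_shell d lam) hfS
      (fun ξ hξ => lintegral_coneKernel_le hd hlam hR hT hξ)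
    have h := integral_gaussian_mul_phase hR (ξ - η)
    have h' := integral_gaussian_mul_phase hT (‖ξ‖ - ‖η‖)
    have e : ∀ p : ℝ × Euc d,
        ((rexp (-(π / T ^ 2) * ‖p.1‖ ^ 2) * rexp (-(π / R ^ 2) * ‖p.2‖ ^ 2) : ℝ) : ℂ) *
        Complex.exp (((2 * π * (inner ℝ ξ p.2 + p.1 * ‖ξ‖) -
          2 * π * (inner ℝ η p.2 + p.1 * ‖η‖) : ℝ) : ℂ) * Complex.I) =
        (((rexp (-(π / T ^ 2) * ‖p.1‖ ^ 2) : ℝ) : ℂ) *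
          Complex.exp (((2 * π * inner ℝ (‖ξ‖ - ‖η‖) p.1 : ℝ) : ℂ) * Complex.I)) *
        (((rexp (-(π / R ^ 2) * ‖p.2‖ ^ 2) : ℝ) : ℂ) *
          Complex.exp (((2 * π * inner ℝ (ξ - η) p.2 : ℝ) : ℂ) * Complex.I)) := by
      intro p
      have : (((2 * π * (inner ℝ ξ p.2 + p.1 * ‖ξ‖) -
          2 * π * (inner ℝ η p.2 + p.1 * ‖η‖) : ℝ) : ℂ) * Complex.I) =
          ((2 * π * inner ℝ (‖ξ‖ - ‖η‖) p.1 : ℝ) : ℂ) * Complex.I +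
          ((2 * π * inner ℝ (ξ - η) p.2 : ℝ) : ℂ) * Complex.I := by
        rw [inner_sub_left ξ η p.2]
        simp only [RCLike.inner_apply, conj_trivial]
        push_cast
        ring
      rw [this, Complex.exp_add, Complex.ofReal_mul]
      ring
    simp_rw [e]
    rw [show (volume : Measure (ℝ × Euc d)) = (volume : Measure ℝ).prod volume from rfl,
      integral_prod_mul (f := fun t : ℝ => ((rexp (-(π / T ^ 2) * ‖t‖ ^ 2) : ℝ) : ℂ) *
          Complex.exp (((2 * π * inner ℝ (‖ξ‖ - ‖η‖) t : ℝ) : ℂ) * Complex.I))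
        (g := fun x : Euc d => ((rexp (-(π / R ^ 2) * ‖x‖ ^ 2) : ℝ) : ℂ) *
          Complex.exp (((2 * π * inner ℝ (ξ - η) x : ℝ) : ℂ) * Complex.I)), h, h',
      ← Complex.ofReal_mul, ← ofReal_norm, Complex.norm_real, finrank_euclideanSpace,
      Fintype.card_fin, Module.finrank_self, pow_one]
    apply ENNReal.ofReal_le_ofReal
    rw [Real.norm_of_nonneg (by positivity)]
    unfold timeKernel spaceKernel
    rw [Real.norm_eq_abs (‖ξ‖ - ‖η‖), sq_abs]
  set g : ℝ → ℝ≥0∞ := fun t => ∫⁻ x in Metric.ball (0 : Euc d) (2 * R), ‖halfWave d f t x‖ₑ ^ 2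
    with hg
  have hn : ∀ n : ℕ, ∫⁻ t in Metric.ball (0 : ℝ) (n + 1 : ℝ), g t ≤
      ENNReal.ofReal (rexp (5 * π) * timeConst d * (R * min 1 (lam * R) ^ (d - 1))) *
        ∫⁻ ξ, ‖f ξ‖ₑ ^ 2 := by
    intro n
    have hT : (0 : ℝ) < n + 1 := by positivity
    have hm : Measurable (fun p : ℝ × Euc d => ‖halfWave d f p.1 p.2‖ₑ ^ 2) :=
      (hcont.measurable.enorm).pow_const 2
    have e1 : ∫⁻ t in Metric.ball (0 : ℝ) (n + 1 : ℝ), g t =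
        ∫⁻ p in Metric.ball (0 : ℝ) (n + 1 : ℝ) ×ˢ Metric.ball (0 : Euc d) (2 * R),
          ‖halfWave d f p.1 p.2‖ₑ ^ 2 := by
      rw [show (volume : Measure (ℝ × Euc d)) = (volume : Measure ℝ).prod volume from rfl,
        ← Measure.prod_restrict, lintegral_prod _ hm.aemeasurable]
    rw [e1, mul_assoc, ENNReal.ofReal_mul (by positivity), mul_assoc]
    refine le_trans ?_ (mul_le_mul_right (key (n + 1) hT) _)
    rw [← lintegral_const_mul' _ _ (by simp)]
    refine (setLIntegral_mono' (measurableSet_ball.prod measurableSet_ball) fun p hp => ?_).trans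
      (setLIntegral_le_lintegral _ _)
    rw [← mul_assoc, ← ENNReal.ofReal_mul (by positivity)]
    refine le_mul_of_one_le_left' ?_
    rw [ENNReal.one_le_ofReal]
    have h1 := exp_neg_four_pi_le_gaussian d hR hp.2
    have h2 : rexp (-π) ≤ rexp (-(π / (n + 1 : ℝ) ^ 2) * ‖p.1‖ ^ 2) := by
      apply Real.exp_le_exp.2
      have h : ‖p.1‖ < n + 1 := by simpa using hp.1
      have : ‖p.1‖ ^ 2 ≤ (n + 1 : ℝ) ^ 2 := by gcongr
      rw [neg_mul, neg_le_neg_iff, div_mul_eq_mul_div, div_le_iff₀ (by positivity)]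
      nlinarith [pi_pos]
    calc 1 = rexp (5 * π) * (rexp (-π) * rexp (-(4 * π))) := by
          rw [← Real.exp_add, ← Real.exp_add]; ring_nf; simp
      _ ≤ _ := by gcongr
  have hU : (⋃ n : ℕ, Metric.ball (0 : ℝ) (n + 1 : ℝ)) = univ := by
    refine eq_univ_of_forall fun t => mem_iUnion.2 ?_
    obtain ⟨n, hn⟩ := exists_nat_gt ‖t‖
    exact ⟨n, by simp only [Metric.mem_ball, dist_zero_right]; linarith⟩
  calc ∫⁻ t, g t = ∫⁻ t in ⋃ n : ℕ, Metric.ball (0 : ℝ) (n + 1 : ℝ), g t := by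
        rw [hU, Measure.restrict_univ]
    _ = ⨆ n : ℕ, ∫⁻ t in Metric.ball (0 : ℝ) (n + 1 : ℝ), g t := by
        refine setLIntegral_iUnion_of_directed _ (Monotone.directed_le ?_)
        intro m n hmn
        exact Metric.ball_subset_ball (by gcongr)
    _ ≤ _ := iSup_le hn

/-- One-dimensional Sobolev embedding on `[R, 2R]` with a free scale `m ≥ 1 / R`. -/
lemma sq_norm_le_integral_Icc {φ φ' : ℝ → ℂ} (hφ : ∀ r, HasDerivAt φ (φ' r) r)
    (hφ' : Continuous φ') {R m : ℝ} (hR : 0 < R) (hm : 1 / R ≤ m) {r : ℝ}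
    (hr : r ∈ Icc R (2 * R)) :
    ‖φ r‖ ^ 2 ≤ ∫ s in Icc R (2 * R), (2 * m * ‖φ s‖ ^ 2 + m⁻¹ * ‖φ' s‖ ^ 2) := by
  have hm0 : 0 < m := lt_of_lt_of_le (by positivity) hm
  have hφc : Continuous φ := continuous_iff_continuousAt.2 fun r => (hφ r).continuousAt
  have hI : ∀ g : ℝ → ℝ, Continuous g → IntegrableOn g (Icc R (2 * R)) :=
    fun g hg => hg.continuousOn.integrableOn_Icc
  set M : ℝ := ∫ s in Icc R (2 * R), (m * ‖φ s‖ ^ 2 + m⁻¹ * ‖φ' s‖ ^ 2) with hM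
  have h1 : ∀ s ∈ Icc R (2 * R), ‖φ r‖ ^ 2 ≤ ‖φ s‖ ^ 2 + M := by
    intro s hs
    have hd : ∀ y ∈ uIcc s r, HasDerivAt (fun y => ‖φ y‖ ^ 2) (2 * inner ℝ (φ y) (φ' y)) y :=
      fun y _ => (hφ y).norm_sq
    have hc : Continuous (fun y => 2 * inner ℝ (φ y) (φ' y)) := by fun_prop
    have e := intervalIntegral.integral_eq_sub_of_hasDerivAt hd (hc.intervalIntegrable _ _)
    have e2 : |∫ y in s..r, 2 * inner ℝ (φ y) (φ' y)| ≤ M := by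
      rw [← Real.norm_eq_abs]
      refine (intervalIntegral.norm_integral_le_integral_norm_uIoc).trans ?_
      refine (setIntegral_mono_set (t := Icc R (2 * R)) (hI _ hc.norm)
        (Filter.Eventually.of_forall fun y => norm_nonneg _) ?_).trans ?_
      · refine Filter.Eventually.of_forall fun y hy => ?_
        have := uIoc_subset_uIcc hy
        exact (uIcc_subset_Icc hs hr) this
      · refine setIntegral_mono (hI _ hc.norm) (hI _ (by fun_prop)) fun y => ?_
        have a1 : ‖2 * inner ℝ (φ y) (φ' y)‖ ≤ 2 * (‖φ y‖ * ‖φ' y‖) := by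
          rw [norm_mul, Real.norm_ofNat]
          gcongr
          exact norm_inner_le_norm _ _
        have a2 : 0 ≤ m⁻¹ * (m * ‖φ y‖ - ‖φ' y‖) ^ 2 := by positivity
        have a3 : m⁻¹ * (m * ‖φ y‖ - ‖φ' y‖) ^ 2 =
            m * ‖φ y‖ ^ 2 - 2 * (‖φ y‖ * ‖φ' y‖) + m⁻¹ * ‖φ' y‖ ^ 2 := by
          field_simp
          ring
        dsimp only
        linarith
    have := le_abs_self (∫ y in s..r, 2 * inner ℝ (φ y) (φ' y))
    linarith
  have h2 : R * ‖φ r‖ ^ 2 ≤ (∫ s in Icc R (2 * R), ‖φ s‖ ^ 2) + R * M := by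
    have := setIntegral_mono_on (hI _ continuous_const) (hI _ (by fun_prop)) measurableSet_Icc h1
    rw [integral_add (hI _ (by fun_prop)) (hI _ continuous_const), setIntegral_const,
      setIntegral_const, measureReal_def, Real.volume_Icc, ENNReal.toReal_ofReal (by linarith)] at this
    simp only [smul_eq_mul] at this
    rwa [show 2 * R - R = R by ring] at this
  have h3 : ∫ s in Icc R (2 * R), (2 * m * ‖φ s‖ ^ 2 + m⁻¹ * ‖φ' s‖ ^ 2) =
      m * (∫ s in Icc R (2 * R), ‖φ s‖ ^ 2) + M := by
    rw [hM, ← integral_const_mul, ← integral_add (hI _ (by fun_prop)) (hI _ (by fun_prop))]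
    congr 1
    ext s
    ring
  rw [h3]
  have h4 : 0 ≤ ∫ s in Icc R (2 * R), ‖φ s‖ ^ 2 := integral_nonneg fun s => by positivity
  have h5 : 1 ≤ m * R := by rwa [div_le_iff₀ hR] at hm
  have h6 : R * ‖φ r‖ ^ 2 ≤ R * (m * (∫ s in Icc R (2 * R), ‖φ s‖ ^ 2) + M) := by nlinarith
  exact le_of_mul_le_mul_left h6 hR

/-- The inverse of the surface area of the unit sphere. -/
def radialConst (d : ℕ) : ℝ := ((d : ℝ) * volume.real (Metric.ball (0 : Euc d) 1))⁻¹

lemma radialConst_pos {d : ℕ} (hd : 1 ≤ d) : 0 < radialConst d := by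
  unfold radialConst
  have h1 : (0 : ℝ) < d := by exact_mod_cast hd
  have h2 : 0 < volume.real (Metric.ball (0 : Euc d) 1) :=
    ENNReal.toReal_pos (Metric.measure_ball_pos volume _ one_pos).ne' measure_ball_lt_top.ne
  positivity

lemma pow_mul_integral_Icc_le {d : ℕ} (hd : 1 ≤ d) {h : ℝ → ℝ} (hc : Continuous h)
    (h0 : ∀ r, 0 ≤ h r) {R : ℝ} (hR : 0 < R) :
    R ^ (d - 1) * ∫ s in Icc R (2 * R), h s ≤
      radialConst d * ∫ x : Euc d, (Ico R (2 * R)).indicator h ‖x‖ := by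
  have : Nontrivial (Euc d) := Module.nontrivial_of_finrank_pos (R := ℝ) (by
    simp only [finrank_euclideanSpace, Fintype.card_fin]; omega)
  have e := integral_fun_norm_addHaar (volume : Measure (Euc d)) ((Ico R (2 * R)).indicator h)
  simp only [finrank_euclideanSpace, Fintype.card_fin, nsmul_eq_mul, smul_eq_mul] at e
  have e2 : radialConst d * ∫ x : Euc d, (Ico R (2 * R)).indicator h ‖x‖ =
      ∫ y in Ioi (0 : ℝ), y ^ (d - 1) * (Ico R (2 * R)).indicator h y := by
    have := radialConst_pos hd
    unfold radialConst at this ⊢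
    rw [e, ← mul_assoc, ← mul_assoc, mul_assoc _⁻¹, inv_mul_cancel₀ (inv_pos.1 this).ne', one_mul]
  have e3 : ∫ y in Ioi (0 : ℝ), y ^ (d - 1) * (Ico R (2 * R)).indicator h y =
      ∫ y in Ico R (2 * R), y ^ (d - 1) * h y := by
    have : ∀ y, y ^ (d - 1) * (Ico R (2 * R)).indicator h y =
        (Ico R (2 * R)).indicator (fun y => y ^ (d - 1) * h y) y := by
      intro y; by_cases hy : y ∈ Ico R (2 * R) <;> simp [hy]
    simp_rw [this]
    rw [setIntegral_indicator measurableSet_Ico, inter_eq_self_of_subset_right]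
    intro y hy
    exact hR.trans_le hy.1
  rw [e2, e3, integral_Icc_eq_integral_Ico, ← integral_const_mul]
  refine setIntegral_mono_on ?_ ?_ measurableSet_Ico fun y hy => ?_
  · exact ((continuous_const.mul hc).continuousOn.integrableOn_Icc).mono_set Ico_subset_Icc_self
  · exact (((continuous_id.pow _).mul hc).continuousOn.integrableOn_Icc).mono_set
      Ico_subset_Icc_self
  · gcongr
    · exact h0 y
    · exact hy.1

/-- Radial Sobolev embedding on a dyadic shell. -/
lemma radial_sobolev_shell {d : ℕ} (hd : 1 ≤ d) {v : Euc d → ℂ} (hv : ContDiff ℝ 1 v)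
    (hrad : IsRadialC d v) {R m : ℝ} (hR : 0 < R) (hm : 1 / R ≤ m) {x : Euc d}
    (hx : x ∈ shell d R) :
    ENNReal.ofReal (R ^ (d - 1)) * ‖v x‖ₑ ^ 2 ≤ ENNReal.ofReal (radialConst d) *
      (ENNReal.ofReal (2 * m) * (∫⁻ y in shell d R, ‖v y‖ₑ ^ 2) +
        ENNReal.ofReal m⁻¹ * ∫⁻ y in shell d R, ‖fderiv ℝ v y‖ₑ ^ 2) := by
  have hm0 : 0 < m := lt_of_lt_of_le (by positivity) hm
  have hx0 : 0 < ‖x‖ := hR.trans_le hx.1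
  obtain ⟨g, hg⟩ := hrad
  set e : Euc d := ‖x‖⁻¹ • x with he
  have hline : ∀ (e : Euc d) (r : ℝ), HasDerivAt (fun r : ℝ => v (r • e)) (fderiv ℝ v (r • e) e) r := by
    intro e r
    have h1 : HasDerivAt (fun r : ℝ => r • e) e r := by
      simpa using (hasDerivAt_id r).smul_const e
    exact ((hv.differentiable (by simp) (r • e)).hasFDerivAt).comp_hasDerivAt r h1
  have hφ' : Continuous (fun r : ℝ => fderiv ℝ v (r • e) e) :=
    ((hv.continuous_fderiv (by simp)).comp (by fun_prop)).clm_apply continuous_const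
  have he1 : ‖e‖ = 1 := by
    rw [he, norm_smul, norm_inv, norm_norm, inv_mul_cancel₀ hx0.ne']
  have hxe : ‖x‖ • e = x := by rw [he, smul_smul, mul_inv_cancel₀ hx0.ne', one_smul]
  set h : ℝ → ℝ := fun s => 2 * m * ‖v (s • e)‖ ^ 2 + m⁻¹ * ‖fderiv ℝ v (s • e) e‖ ^ 2 with hh
  have hvc : Continuous v := hv.continuous
  have hc : Continuous h := by
    rw [hh]; fun_prop
  have h0 : ∀ r, 0 ≤ h r := fun r => by rw [hh]; positivity
  have key := sq_norm_le_integral_Icc (hline e) hφ' hR hm (r := ‖x‖) ⟨hx.1, hx.2.le⟩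
  rw [hxe] at key
  have key2 := (mul_le_mul_of_nonneg_left key (by positivity : 0 ≤ R ^ (d - 1))).trans
    (pow_mul_integral_Icc_le hd hc h0 hR)
  have hpt : ∀ y : Euc d, ‖(Ico R (2 * R)).indicator h ‖y‖‖ₑ ≤ (shell d R).indicator
      (fun y => ENNReal.ofReal (2 * m) * ‖v y‖ₑ ^ 2 + ENNReal.ofReal m⁻¹ * ‖fderiv ℝ v y‖ₑ ^ 2) y := by
    intro y
    by_cases hy : y ∈ shell d R
    · have hy' : ‖y‖ ∈ Ico R (2 * R) := hy
      have hy0 : 0 < ‖y‖ := hR.trans_le hy.1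
      rw [indicator_of_mem hy, indicator_of_mem hy']
      have a1 : v (‖y‖ • e) = v y := by
        rw [hg, hg, norm_smul, he1, norm_norm, mul_one]
      have a2 : ‖fderiv ℝ v (‖y‖ • e) e‖ ≤ ‖fderiv ℝ v y‖ := by
        set e' : Euc d := ‖y‖⁻¹ • y with he'
        have he1' : ‖e'‖ = 1 := by
          rw [he', norm_smul, norm_inv, norm_norm, inv_mul_cancel₀ hy0.ne']
        have hye : ‖y‖ • e' = y := by rw [he', smul_smul, mul_inv_cancel₀ hy0.ne', one_smul]
        have : (fun r : ℝ => v (r • e)) = (fun r : ℝ => v (r • e')) := by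
          ext r
          rw [hg, hg, norm_smul r e, norm_smul r e', he1, he1']
        have h1 := hline e ‖y‖
        rw [this] at h1
        rw [h1.unique (hline e' ‖y‖), hye]
        simpa [he1'] using (fderiv ℝ v y).le_opNorm e'
      rw [← ofReal_norm (h ‖y‖), Real.norm_of_nonneg (h0 _), hh]
      dsimp only
      rw [a1, ← ofReal_norm (v y), ← ofReal_norm (fderiv ℝ v y),
        ENNReal.ofReal_add (by positivity) (by positivity), ENNReal.ofReal_mul (by positivity),
        ENNReal.ofReal_mul (p := m⁻¹) (by positivity), ENNReal.ofReal_pow (by positivity),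
        ENNReal.ofReal_pow (by positivity)]
      gcongr
    · have hy' : ‖y‖ ∉ Ico R (2 * R) := hy
      rw [indicator_of_notMem hy']
      simp
  have hfin : ENNReal.ofReal (∫ y : Euc d, (Ico R (2 * R)).indicator h ‖y‖) ≤
      ENNReal.ofReal (2 * m) * (∫⁻ y in shell d R, ‖v y‖ₑ ^ 2) +
        ENNReal.ofReal m⁻¹ * ∫⁻ y in shell d R, ‖fderiv ℝ v y‖ₑ ^ 2 := by
    have hn : 0 ≤ ∫ y : Euc d, (Ico R (2 * R)).indicator h ‖y‖ :=
      integral_nonneg fun y => indicator_nonneg (fun r _ => h0 r) _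
    rw [← Real.norm_of_nonneg hn, ofReal_norm]
    refine (enorm_integral_le_lintegral_enorm _).trans ((lintegral_mono hpt).trans (le_of_eq ?_))
    rw [lintegral_indicator (measurableSet_shell d R), lintegral_add_left
      ((hvc.measurable.enorm.pow_const 2).const_mul _),
      lintegral_const_mul' _ _ ENNReal.ofReal_ne_top,
      lintegral_const_mul' _ _ ENNReal.ofReal_ne_top]
  calc ENNReal.ofReal (R ^ (d - 1)) * ‖v x‖ₑ ^ 2 = ENNReal.ofReal (R ^ (d - 1) * ‖v x‖ ^ 2) := by
        rw [ENNReal.ofReal_mul (by positivity), ENNReal.ofReal_pow (norm_nonneg _), ofReal_norm]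
    _ ≤ ENNReal.ofReal (radialConst d * ∫ y : Euc d, (Ico R (2 * R)).indicator h ‖y‖) :=
        ENNReal.ofReal_le_ofReal key2
    _ ≤ _ := by
        rw [ENNReal.ofReal_mul (radialConst_pos hd).le]
        gcongr

lemma isRadialC_iff {d : ℕ} {F : Euc d → ℂ} :
    IsRadialC d F ↔ ∀ x y, ‖x‖ = ‖y‖ → F x = F y := by
  constructor
  · rintro ⟨g, hg⟩ x y h
    rw [hg, hg, h]
  · intro h
    classical
    refine ⟨fun r => if hr : ∃ x : Euc d, ‖x‖ = r then F hr.choose else 0, fun x => ?_⟩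
    have hr : ∃ y : Euc d, ‖y‖ = ‖x‖ := ⟨x, rfl⟩
    dsimp only
    rw [dif_pos hr]
    exact h _ _ hr.choose_spec.symm

lemma exists_isometry_apply_eq {d : ℕ} {x y : Euc d} (h : ‖x‖ = ‖y‖) :
    ∃ L : Euc d ≃ₗᵢ[ℝ] Euc d, L x = y :=
  ⟨_, Submodule.reflection_sub h⟩

lemma isRadialC_halfWave {d : ℕ} {f : Euc d → ℂ} (hf : IsRadialC d f) (t : ℝ) :
    IsRadialC d (halfWave d f t) := by
  rw [isRadialC_iff] at hf ⊢
  intro x y h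
  obtain ⟨L, rfl⟩ := exists_isometry_apply_eq h
  unfold halfWave
  symm
  rw [← L.measurePreserving.integral_comp L.toHomeomorph.measurableEmbedding]
  congr 1
  ext ξ
  rw [L.inner_map_map, L.norm_map, hf (L ξ) ξ (L.norm_map ξ)]

lemma norm_sq_le_sum_single (d : ℕ) (L : Euc d →L[ℝ] ℂ) :
    ‖L‖ ^ 2 ≤ ∑ i, ‖L (EuclideanSpace.single i 1)‖ ^ 2 := by
  have h : ‖L‖ ≤ √(∑ i, ‖L (EuclideanSpace.single i 1)‖ ^ 2) := by
    refine L.opNorm_le_bound (Real.sqrt_nonneg _) fun x => ?_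
    have hx : x = ∑ i, x i • (EuclideanSpace.single i (1 : ℝ) : Euc d) := by
      have := (EuclideanSpace.basisFun (Fin d) ℝ).sum_repr x
      simpa using this.symm
    calc ‖L x‖ = ‖∑ i, x i • L (EuclideanSpace.single i 1)‖ := by
          conv_lhs => rw [hx, map_sum]
          simp
      _ ≤ ∑ i, ‖L (EuclideanSpace.single i 1)‖ * ‖x i‖ := by
          refine (norm_sum_le _ _).trans (Finset.sum_le_sum fun i _ => ?_)
          rw [norm_smul, mul_comm]
      _ ≤ √(∑ i, ‖L (EuclideanSpace.single i 1)‖ ^ 2) * √(∑ i, ‖x i‖ ^ 2) :=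
          Real.sum_mul_le_sqrt_mul_sqrt _ _ _
      _ = _ := by rw [← EuclideanSpace.norm_eq]
  calc ‖L‖ ^ 2 ≤ √(∑ i, ‖L (EuclideanSpace.single i 1)‖ ^ 2) ^ 2 := by gcongr
    _ = _ := Real.sq_sqrt (by positivity)

/-- The symbol of the `i`-th spatial derivative of a half-wave. -/
def derivSymbol (d : ℕ) (f : Euc d → ℂ) (i : Fin d) (ξ : Euc d) : ℂ :=
  2 * π * Complex.I * ((inner ℝ ξ (EuclideanSpace.single i 1 : Euc d) : ℝ) : ℂ) * f ξ

lemma norm_derivSymbol_le (d : ℕ) (f : Euc d → ℂ) (i : Fin d) (ξ : Euc d) :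
    ‖derivSymbol d f i ξ‖ ≤ 2 * π * ‖ξ‖ * ‖f ξ‖ := by
  unfold derivSymbol
  rw [norm_mul, norm_mul, norm_mul, norm_mul, Complex.norm_I, Complex.norm_real, Complex.norm_real,
    Real.norm_of_nonneg pi_pos.le, mul_one]
  have : ‖inner ℝ ξ (EuclideanSpace.single i 1 : Euc d)‖ ≤ ‖ξ‖ := by
    simpa using norm_inner_le_norm (𝕜 := ℝ) ξ (EuclideanSpace.single i 1 : Euc d)
  simp only [Complex.norm_ofNat]
  gcongr

lemma integrable_derivSymbol (d : ℕ) {f : Euc d → ℂ} (hf : Integrable f) {lam : ℝ}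
    (hfS : ∀ ξ, ξ ∉ shell d lam → f ξ = 0) (i : Fin d) : Integrable (derivSymbol d f i) := by
  have h := (integrable_moment_of_shell d hf hfS 1).const_mul (2 * π)
  refine h.mono' ?_ (Filter.Eventually.of_forall fun ξ => ?_)
  · unfold derivSymbol
    exact (Continuous.aestronglyMeasurable (by fun_prop)).mul hf.aestronglyMeasurable
  · simpa [mul_assoc] using norm_derivSymbol_le d f i ξ

lemma derivSymbol_eq_zero (d : ℕ) {f : Euc d → ℂ} {lam : ℝ}
    (hfS : ∀ ξ, ξ ∉ shell d lam → f ξ = 0) (i : Fin d) (ξ : Euc d) (hξ : ξ ∉ shell d lam) :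
    derivSymbol d f i ξ = 0 := by
  simp [derivSymbol, hfS ξ hξ]

lemma lintegral_derivSymbol_le (d : ℕ) {f : Euc d → ℂ} {lam : ℝ} (hlam : 0 < lam)
    (hfS : ∀ ξ, ξ ∉ shell d lam → f ξ = 0) (i : Fin d) :
    ∫⁻ ξ, ‖derivSymbol d f i ξ‖ₑ ^ 2 ≤ ENNReal.ofReal ((4 * π * lam) ^ 2) * ∫⁻ ξ, ‖f ξ‖ₑ ^ 2 := by
  rw [← lintegral_const_mul' _ _ ENNReal.ofReal_ne_top]
  refine lintegral_mono fun ξ => ?_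
  rw [ENNReal.ofReal_pow (by positivity), ← mul_pow]
  gcongr
  by_cases h : ξ ∈ shell d lam
  · rw [← ofReal_norm, ← ofReal_norm, ← ENNReal.ofReal_mul (by positivity)]
    apply ENNReal.ofReal_le_ofReal
    refine (norm_derivSymbol_le d f i ξ).trans ?_
    calc 2 * π * ‖ξ‖ * ‖f ξ‖ ≤ 2 * π * (2 * lam) * ‖f ξ‖ := by
          gcongr
          exact h.2.le
      _ = 4 * π * lam * ‖f ξ‖ := by ring
  · rw [derivSymbol_eq_zero d hfS i ξ h]
    simp

/-- The energy of a half-wave on a dyadic shell at scale `m`. -/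
def shellEnergy (d : ℕ) (f : Euc d → ℂ) (m R t : ℝ) : ℝ≥0∞ :=
  ENNReal.ofReal (2 * m) * (∫⁻ y in shell d R, ‖halfWave d f t y‖ₑ ^ 2) +
    ENNReal.ofReal m⁻¹ * ∑ i, ∫⁻ y in shell d R, ‖halfWave d (derivSymbol d f i) t y‖ₑ ^ 2

lemma shell_subset_ball (d : ℕ) (R : ℝ) : shell d R ⊆ Metric.ball (0 : Euc d) (2 * R) :=
  fun ξ hξ => by simpa using hξ.2

/-- Constant in the shell energy bounds. -/
def energyConst (d : ℕ) : ℝ :=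
  (2 + d * (4 * π) ^ 2) * (rexp (4 * π) * spaceConst d + rexp (5 * π) * timeConst d)

lemma energyConst_pos (d : ℕ) : 0 < energyConst d := by
  have := spaceConst_pos d
  have := timeConst_pos d
  unfold energyConst; positivity

lemma energy_combine (d : ℕ) {m lam a : ℝ} (hm : 0 < m) (hlam : 0 < lam) (hlm : lam ≤ m)
    (ha : 0 ≤ a) {X M : ℝ≥0∞} {Y : Fin d → ℝ≥0∞} (hX : X ≤ ENNReal.ofReal a * M)
    (hY : ∀ i, Y i ≤ ENNReal.ofReal a * (ENNReal.ofReal ((4 * π * lam) ^ 2) * M)) :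
    ENNReal.ofReal (2 * m) * X + ENNReal.ofReal m⁻¹ * ∑ i, Y i ≤
      ENNReal.ofReal ((2 + d * (4 * π) ^ 2) * a * m) * M := by
  have h1 : ∑ i, Y i ≤ d * (ENNReal.ofReal a * (ENNReal.ofReal ((4 * π * lam) ^ 2) * M)) := by
    refine (Finset.sum_le_sum fun i _ => hY i).trans (le_of_eq ?_)
    simp
  calc _ ≤ ENNReal.ofReal (2 * m) * (ENNReal.ofReal a * M) + ENNReal.ofReal m⁻¹ *
        (ENNReal.ofReal d * (ENNReal.ofReal a * (ENNReal.ofReal ((4 * π * lam) ^ 2) * M))) := by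
        rw [ENNReal.ofReal_natCast]
        gcongr
    _ = ENNReal.ofReal (2 * m * a + m⁻¹ * d * a * (4 * π * lam) ^ 2) * M := by
        rw [ENNReal.ofReal_add (by positivity) (by positivity), add_mul,
          ENNReal.ofReal_mul (p := 2 * m) (by positivity),
          ENNReal.ofReal_mul (p := m⁻¹ * d * a) (by positivity),
          ENNReal.ofReal_mul (p := m⁻¹ * d) (by positivity),
          ENNReal.ofReal_mul (p := m⁻¹) (by positivity)]
        ring
    _ ≤ _ := by
        gcongr
        have : m⁻¹ * lam ^ 2 ≤ m := by
          rw [inv_mul_le_iff₀ hm]; nlinarith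
        have h2 : 0 ≤ (d : ℝ) * a * (4 * π) ^ 2 := by positivity
        nlinarith

lemma shellEnergy_le (d : ℕ) {f : Euc d → ℂ} (hf : Integrable f) {lam R m : ℝ}
    (hlam : 0 < lam) (hR : 0 < R) (hm : lam ≤ m) (hfS : ∀ ξ, ξ ∉ shell d lam → f ξ = 0) (t : ℝ) :
    shellEnergy d f m R t ≤
      ENNReal.ofReal (energyConst d * (min 1 (lam * R) ^ d * m)) * ∫⁻ ξ, ‖f ξ‖ₑ ^ 2 := by
  have hs := spaceConst_pos d
  have ht := timeConst_pos d
  have hm0 : 0 < m := hlam.trans_le hm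
  have hmin : 0 < min 1 (lam * R) := by positivity
  unfold shellEnergy
  refine (energy_combine d hm0 hlam hm (a := rexp (4 * π) * spaceConst d * min 1 (lam * R) ^ d)
    (M := ∫⁻ ξ, ‖f ξ‖ₑ ^ 2)
    (by positivity) ?_ fun i => ?_).trans ?_
  · exact (lintegral_mono_set (shell_subset_ball d R)).trans
      (lintegral_ball_halfWave_le d hf hlam hR hfS t)
  · refine (lintegral_mono_set (shell_subset_ball d R)).trans
      ((lintegral_ball_halfWave_le d (integrable_derivSymbol d hf hfS i) hlam hR
        (derivSymbol_eq_zero d hfS i) t).trans ?_)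
    gcongr
    exact lintegral_derivSymbol_le d hlam hfS i
  · refine mul_le_mul_left (ENNReal.ofReal_le_ofReal ?_) _
    unfold energyConst
    have h0 : 0 ≤ (2 + d * (4 * π) ^ 2) * (rexp (5 * π) * timeConst d) *
      (min 1 (lam * R) ^ d * m) := by positivity
    linarith

lemma measurable_lintegral_shell_halfWave (d : ℕ) {f : Euc d → ℂ} (hf : Integrable f) {lam : ℝ}
    (hfS : ∀ ξ, ξ ∉ shell d lam → f ξ = 0) (R q : ℝ) :
    Measurable (fun t => ∫⁻ y in shell d R, ‖halfWave d f t y‖ₑ ^ q) := by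
  have h : Measurable (fun p : ℝ × Euc d => ‖halfWave d f p.1 p.2‖ₑ ^ q) :=
    ((continuous_halfWave_of_shell d hf hfS).measurable.enorm).pow_const q
  exact h.lintegral_prod_right'

lemma lintegral_shellEnergy_le {d : ℕ} (hd : 1 ≤ d) {f : Euc d → ℂ} (hf : Integrable f)
    {lam R m : ℝ} (hlam : 0 < lam) (hR : 0 < R) (hm : lam ≤ m)
    (hfS : ∀ ξ, ξ ∉ shell d lam → f ξ = 0) :
    ∫⁻ t, shellEnergy d f m R t ≤
      ENNReal.ofReal (energyConst d * (R * min 1 (lam * R) ^ (d - 1) * m)) *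
        ∫⁻ ξ, ‖f ξ‖ₑ ^ 2 := by
  have hs := spaceConst_pos d
  have ht := timeConst_pos d
  have hm0 : 0 < m := hlam.trans_le hm
  have hmin : 0 < min 1 (lam * R) := by positivity
  have hmeas : ∀ g : Euc d → ℂ, Integrable g → (∀ ξ, ξ ∉ shell d lam → g ξ = 0) →
      Measurable (fun t => ∫⁻ y in shell d R, ‖halfWave d g t y‖ₑ ^ 2) := by
    intro g hg hgS
    simpa using measurable_lintegral_shell_halfWave d hg hgS R 2
  unfold shellEnergy
  rw [lintegral_add_left ((hmeas f hf hfS).const_mul _), lintegral_const_mul' _ _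
    ENNReal.ofReal_ne_top, lintegral_const_mul' _ _ ENNReal.ofReal_ne_top,
    lintegral_finsetSum _ fun i _ => hmeas _ (integrable_derivSymbol d hf hfS i)
      (derivSymbol_eq_zero d hfS i)]
  refine (energy_combine d hm0 hlam hm
    (a := rexp (5 * π) * timeConst d * (R * min 1 (lam * R) ^ (d - 1)))
    (M := ∫⁻ ξ, ‖f ξ‖ₑ ^ 2)
    (by positivity) ?_ fun i => ?_).trans ?_
  · exact (lintegral_mono fun t => lintegral_mono_set (shell_subset_ball d R)).trans
      (lintegral_time_ball_halfWave_le hd hf hlam hR hfS)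
  · refine (lintegral_mono fun t => lintegral_mono_set (shell_subset_ball d R)).trans
      ((lintegral_time_ball_halfWave_le hd (integrable_derivSymbol d hf hfS i) hlam hR
        (derivSymbol_eq_zero d hfS i)).trans ?_)
    gcongr
    exact lintegral_derivSymbol_le d hlam hfS i
  · refine mul_le_mul_left (ENNReal.ofReal_le_ofReal ?_) _
    unfold energyConst
    have h0 : 0 ≤ (2 + d * (4 * π) ^ 2) * (rexp (4 * π) * spaceConst d) *
      (R * min 1 (lam * R) ^ (d - 1) * m) := by positivity
    linarith

lemma sobolev_halfWave_shell {d : ℕ} (hd : 1 ≤ d) {f : Euc d → ℂ} (hf : Integrable f)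
    (hrad : IsRadialC d f) {lam R m : ℝ} (hR : 0 < R) (hm : 1 / R ≤ m)
    (hfS : ∀ ξ, ξ ∉ shell d lam → f ξ = 0) (t : ℝ) {x : Euc d} (hx : x ∈ shell d R) :
    ENNReal.ofReal (R ^ (d - 1)) * ‖halfWave d f t x‖ₑ ^ 2 ≤
      ENNReal.ofReal (radialConst d) * shellEnergy d f m R t := by
  have hC : ContDiff ℝ 1 (halfWave d f t) := by
    have h := contDiff_halfWave d (integrable_moment_of_shell d hf hfS)
    have h2 : ContDiff ℝ (⊤ : ℕ∞) (fun x : Euc d => halfWave d f t x) :=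
      h.comp (g := fun p : ℝ × Euc d => halfWave d f p.1 p.2) (f := fun x : Euc d => (t, x))
        (by fun_prop)
    exact contDiff_infty.1 h2 1
  refine (radial_sobolev_shell hd hC (isRadialC_halfWave hrad t) hR hm hx).trans ?_
  unfold shellEnergy
  gcongr
  have hcm : ∀ i, Measurable (fun y => ‖halfWave d (derivSymbol d f i) t y‖ₑ ^ 2) := fun i =>
    (((continuous_halfWave_of_shell d (integrable_derivSymbol d hf hfS i)
      (derivSymbol_eq_zero d hfS i)).comp (by fun_prop : Continuous fun x : Euc d =>
        (t, x))).measurable.enorm).pow_const 2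
  rw [← lintegral_finsetSum _ fun i _ => hcm i]
  refine lintegral_mono fun y => ?_
  have hder : ∀ i, fderiv ℝ (halfWave d f t) y (EuclideanSpace.single i 1) =
      halfWave d (derivSymbol d f i) t y := fun i =>
    (fderiv_halfWave_space d hf (by simpa using integrable_moment_of_shell d hf hfS 1) t y _).2
  have := norm_sq_le_sum_single d (fderiv ℝ (halfWave d f t) y)
  simp_rw [hder] at this
  simp_rw [← ofReal_norm, ← ENNReal.ofReal_pow (norm_nonneg _)]
  rw [← ENNReal.ofReal_sum_of_nonneg fun i _ => by positivity]
  exact ENNReal.ofReal_le_ofReal this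

lemma ennreal_iSup_rpow {ι : Type*} (g : ι → ℝ≥0∞) {r : ℝ} (hr : 0 < r) :
    (⨆ i, g i) ^ r = ⨆ i, g i ^ r :=
  (ENNReal.orderIsoRpow r hr).map_iSup g

lemma tsum_rpow_le_tsum_rpow {ι : Type*} (g : ι → ℝ≥0∞) {e : ℝ} (he : 0 < e) (he1 : e ≤ 1) :
    (∑' i, g i) ^ e ≤ ∑' i, g i ^ e := by
  rw [ENNReal.tsum_eq_iSup_sum, ennreal_iSup_rpow _ he]
  refine iSup_le fun s => le_trans ?_ (ENNReal.sum_le_tsum s)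
  classical
  induction s using Finset.induction_on with
  | empty => simp [he]
  | insert a s ha ih =>
    rw [Finset.sum_insert ha, Finset.sum_insert ha]
    exact (ENNReal.rpow_add_le_add_rpow _ _ he.le he1).trans (add_le_add_right ih _)

lemma lintegral_Lp_sum_le {α ι : Type*} [MeasurableSpace α] {μ : Measure α} (s : Finset ι)
    {r : ℝ} (hr : 1 ≤ r) {g : ι → α → ℝ≥0∞} (hg : ∀ i, Measurable (g i)) :
    (∫⁻ x, (∑ i ∈ s, g i x) ^ r ∂μ) ^ (1 / r) ≤ ∑ i ∈ s, (∫⁻ x, g i x ^ r ∂μ) ^ (1 / r) := by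
  have hr0 : 0 < r := by linarith
  classical
  induction s using Finset.induction_on with
  | empty => simp [hr0]
  | insert a s ha ih =>
    simp_rw [Finset.sum_insert ha]
    refine le_trans ?_ (add_le_add_right ih _)
    exact ENNReal.lintegral_Lp_add_le (hg a).aemeasurable
      (Finset.measurable_sum s fun i _ => hg i).aemeasurable hr

lemma lintegral_Lp_tsum_le {α ι : Type*} [Countable ι] [MeasurableSpace α] {μ : Measure α}
    {r : ℝ} (hr : 1 ≤ r) {g : ι → α → ℝ≥0∞} (hg : ∀ i, Measurable (g i)) :
    (∫⁻ x, (∑' i, g i x) ^ r ∂μ) ^ (1 / r) ≤ ∑' i, (∫⁻ x, g i x ^ r ∂μ) ^ (1 / r) := by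
  have hr0 : 0 < r := by linarith
  classical
  have h1 : ∀ x, (∑' i, g i x) ^ r = ⨆ s : Finset ι, (∑ i ∈ s, g i x) ^ r := fun x => by
    rw [ENNReal.tsum_eq_iSup_sum, ennreal_iSup_rpow _ hr0]
  simp_rw [h1]
  rw [lintegral_iSup_directed (fun s => ((Finset.measurable_sum s fun i _ => hg i).pow_const
    r).aemeasurable), ennreal_iSup_rpow _ (by positivity)]
  · exact iSup_le fun s => (lintegral_Lp_sum_le s hr hg).trans (ENNReal.sum_le_tsum s)
  · refine Monotone.directed_le fun s s' h x => ?_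
    dsimp only
    gcongr

lemma tsum_sq_le_weighted {ι : Type*} (v a : ι → ℝ≥0∞) (hv : ∀ i, v i ≠ 0)
    (hv' : ∀ i, v i ≠ ⊤) :
    (∑' i, a i) ^ 2 ≤ (∑' i, v i) * ∑' i, (v i)⁻¹ * a i ^ 2 := by
  let : MeasurableSpace ι := ⊤
  have h := ENNReal.lintegral_mul_le_Lp_mul_Lq (α := ι) Measure.count (p := 2) (q := 2)
    (Real.holderConjugate_iff.2 (by norm_num))
    (f := fun i => v i ^ (1 / 2 : ℝ)) (g := fun i => (v i)⁻¹ ^ (1 / 2 : ℝ) * a i)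
    (measurable_from_top.aemeasurable) (measurable_from_top.aemeasurable)
  rw [lintegral_count' measurable_from_top, lintegral_count' measurable_from_top,
    lintegral_count' measurable_from_top] at h
  have e1 : ∀ i, ((fun i => v i ^ (1 / 2 : ℝ)) * (fun i => (v i)⁻¹ ^ (1 / 2 : ℝ) * a i)) i = a i := by
    intro i
    simp only [Pi.mul_apply]
    rw [← mul_assoc, ← ENNReal.mul_rpow_of_nonneg _ _ (by norm_num),
      ENNReal.mul_inv_cancel (hv i) (hv' i), ENNReal.one_rpow, one_mul]
  have e2 : ∀ i, (v i ^ (1 / 2 : ℝ)) ^ (2 : ℝ) = v i := fun i => by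
    rw [← ENNReal.rpow_mul]; norm_num
  have e3 : ∀ i, ((v i)⁻¹ ^ (1 / 2 : ℝ) * a i) ^ (2 : ℝ) = (v i)⁻¹ * a i ^ 2 := fun i => by
    rw [ENNReal.mul_rpow_of_nonneg _ _ (by norm_num), ← ENNReal.rpow_mul, ENNReal.rpow_two]
    norm_num
  simp_rw [e1, e2, e3] at h
  calc (∑' i, a i) ^ 2 ≤ ((∑' i, v i) ^ (1 / 2 : ℝ) *
        (∑' i, (v i)⁻¹ * a i ^ 2) ^ (1 / 2 : ℝ)) ^ 2 := by gcongr
    _ = _ := by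
      rw [mul_pow, ← ENNReal.rpow_two, ← ENNReal.rpow_two, ← ENNReal.rpow_mul, ← ENNReal.rpow_mul]
      norm_num

/-- The properties of the norm `L^{1/(2P)}` (in time) used to sum dyadic pieces; point
evaluations have them for `P = 0`. -/
structure IsTimeFunctional (Λ : (ℝ → ℝ≥0∞) → ℝ≥0∞) (P : ℝ) : Prop where
  mono : ∀ g h : ℝ → ℝ≥0∞, (∀ t, g t ≤ h t) → Λ g ≤ Λ h
  const_mul : ∀ (c : ℝ≥0∞) (g : ℝ → ℝ≥0∞), c ≠ ⊤ → Λ (fun t => c * g t) ≤ c * Λ g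
  tsum : ∀ g : ℤ → ℝ → ℝ≥0∞, (∀ i, Measurable (g i)) →
    Λ (fun t => ∑' i, g i t) ≤ ∑' i, Λ (g i)
  interp : ∀ (g : ℝ → ℝ≥0∞) (a b : ℝ≥0∞), a ≠ ⊤ → (∀ t, g t ≤ a) → ∫⁻ t, g t ≤ b →
    Λ g ≤ a ^ (1 - 2 * P) * b ^ (2 * P)

lemma isTimeFunctional_eval (t : ℝ) : IsTimeFunctional (fun g => g t) 0 where
  mono _ _ h := h t
  const_mul _ _ _ := le_rfl
  tsum _ _ := le_rfl
  interp g a b _ h _ := by simpa using h t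

lemma isTimeFunctional_Lp {r : ℝ} (hr : 1 ≤ r) :
    IsTimeFunctional (fun g => (∫⁻ t, g t ^ r) ^ (1 / r)) (1 / (2 * r)) where
  mono g h hgh := by
    have hr0 : 0 < r := by linarith
    gcongr with t
    exact hgh t
  const_mul c g hc := by
    have hr0 : 0 < r := by linarith
    simp_rw [ENNReal.mul_rpow_of_nonneg _ _ hr0.le]
    rw [lintegral_const_mul' _ _ (ENNReal.rpow_ne_top_of_nonneg hr0.le hc),
      ENNReal.mul_rpow_of_nonneg _ _ (by positivity), ← ENNReal.rpow_mul,
      mul_one_div_cancel hr0.ne', ENNReal.rpow_one]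
  tsum g hg := lintegral_Lp_tsum_le hr hg
  interp g a b ha h hb := by
    have hr0 : 0 < r := by linarith
    have h1 : ∫⁻ t, g t ^ r ≤ a ^ (r - 1) * b := by
      calc ∫⁻ t, g t ^ r ≤ ∫⁻ t, a ^ (r - 1) * g t := by
            refine lintegral_mono fun t => ?_
            have : g t ^ r = g t ^ (r - 1) * g t := by
              conv_rhs => rw [← ENNReal.rpow_one (g t), ← ENNReal.rpow_mul,
                ← ENNReal.rpow_add_of_nonneg _ _ (by linarith) zero_le_one]
              congr 1; ring
            rw [this]
            have := h t
            have h2 : (0 : ℝ) ≤ r - 1 := by linarith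
            gcongr
        _ = a ^ (r - 1) * ∫⁻ t, g t :=
            lintegral_const_mul' _ _ (ENNReal.rpow_ne_top_of_nonneg (by linarith) ha)
        _ ≤ _ := by gcongr
    calc (∫⁻ t, g t ^ r) ^ (1 / r) ≤ (a ^ (r - 1) * b) ^ (1 / r) := by gcongr
      _ = _ := by
        rw [ENNReal.mul_rpow_of_nonneg _ _ (by positivity), ← ENNReal.rpow_mul]
        congr 2 <;> field_simp

lemma lintegral_rpow_le_of_sq_le {α : Type*} [MeasurableSpace α] {μ : Measure α} {g : α → ℝ≥0∞}
    {A : Set α} (hA : MeasurableSet A) {S : ℝ≥0∞} (hS : S ≠ ⊤) {q : ℝ} (hq : 2 < q)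
    (h : ∀ x ∈ A, g x ^ 2 ≤ S) :
    (∫⁻ x in A, g x ^ q ∂μ) ^ (2 / q) ≤ S ^ (1 - 2 / q) * (∫⁻ x in A, g x ^ 2 ∂μ) ^ (2 / q) := by
  have hq0 : 0 < q := by linarith
  have h1 : ∫⁻ x in A, g x ^ q ∂μ ≤ S ^ ((q - 2) / 2) * ∫⁻ x in A, g x ^ 2 ∂μ := by
    rw [← lintegral_const_mul' _ _ (ENNReal.rpow_ne_top_of_nonneg (by linarith) hS)]
    refine setLIntegral_mono' hA fun x hx => ?_
    have e : g x ^ q = (g x ^ 2) ^ ((q - 2) / 2) * g x ^ 2 := by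
      rw [← ENNReal.rpow_two, ← ENNReal.rpow_mul,
        ← ENNReal.rpow_add_of_nonneg _ _ (by linarith) (by norm_num)]
      congr 1; ring
    rw [e]
    have h2 : (0 : ℝ) ≤ (q - 2) / 2 := by linarith
    have := h x hx
    gcongr
  calc _ ≤ (S ^ ((q - 2) / 2) * ∫⁻ x in A, g x ^ 2 ∂μ) ^ (2 / q) := by gcongr
    _ = _ := by
      rw [ENNReal.mul_rpow_of_nonneg _ _ (by positivity), ← ENNReal.rpow_mul]
      congr 2; field_simp

lemma shell_exponent_le {d : ℕ} (hd : 1 ≤ d) {c E P Q γ β a b : ℝ} (hc : 0 < c) (hE : 0 < E)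
    (hQ : 0 ≤ Q) (hβ : β ≤ (d - 1) * (1 - 2 * Q) - 2 * P) (hβ' : β ≤ 2 * d * Q)
    (hγ : P + d * Q = d / 2 - γ) {lam R m θ : ℝ} (hlam : lam = 2 ^ a) (hR : R = 2 ^ b)
    (hm : m = max lam (1 / R)) (hθ : θ = min 1 (lam * R)) :
    (c / R ^ (d - 1)) ^ (1 - 2 * Q) * (1 / (2 * m)) ^ (2 * Q) *
        ((E * (θ ^ d * m)) ^ (1 - 2 * P) * (E * (R * θ ^ (d - 1) * m)) ^ (2 * P)) ≤
      c ^ (1 - 2 * Q) * E * (lam ^ (2 * γ) * 2 ^ (-(β * |a + b|))) := by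
  have h2 : (0 : ℝ) < 2 := two_pos
  obtain ⟨x, rfl⟩ : ∃ x : ℝ, c = 2 ^ x := ⟨Real.logb 2 c, by
    rw [Real.rpow_logb h2 (by norm_num) hc]⟩
  obtain ⟨y, rfl⟩ : ∃ x : ℝ, E = 2 ^ x := ⟨Real.logb 2 E, by
    rw [Real.rpow_logb h2 (by norm_num) hE]⟩
  have hlR : lam * R = 2 ^ (a + b) := by rw [hlam, hR, Real.rpow_add h2]
  have hRi : 1 / R = 2 ^ (-b) := by rw [hR, Real.rpow_neg h2.le, one_div]
  have hdc : ((d - 1 : ℕ) : ℝ) = d - 1 := by push_cast [Nat.cast_sub hd]; ring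
  obtain ⟨e, f, hm', hθ', hcase⟩ : ∃ e f : ℝ, m = 2 ^ e ∧ θ = 2 ^ f ∧
      ((0 ≤ a + b ∧ e = a ∧ f = 0) ∨ (a + b ≤ 0 ∧ e = -b ∧ f = a + b)) := by
    rcases le_total 0 (a + b) with h | h
    · refine ⟨a, 0, ?_, ?_, Or.inl ⟨h, rfl, rfl⟩⟩
      · rw [hm, hRi, hlam]
        exact max_eq_left (Real.rpow_le_rpow_of_exponent_le one_le_two (by linarith))
      · rw [hθ, hlR, Real.rpow_zero]
        exact min_eq_left (Real.one_le_rpow one_le_two h)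
    · refine ⟨-b, a + b, ?_, ?_, Or.inr ⟨h, rfl, rfl⟩⟩
      · rw [hm, hRi, hlam]
        exact max_eq_right (Real.rpow_le_rpow_of_exponent_le one_le_two (by linarith))
      · rw [hθ, hlR]
        exact min_eq_right (Real.rpow_le_one_of_one_le_of_nonpos one_le_two h)
  have e2 : 1 / (2 * m) = 2 ^ (-(1 + e)) := by
    rw [hm', Real.rpow_neg h2.le, Real.rpow_add h2, Real.rpow_one, one_div]
  have e1 : (2 : ℝ) ^ x / R ^ (d - 1) = 2 ^ (x - b * (d - 1)) := by
    rw [Real.rpow_sub h2, Real.rpow_mul h2.le, ← hdc, Real.rpow_natCast, hR]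
  have e3 : (2 : ℝ) ^ y * (θ ^ d * m) = 2 ^ (y + f * d + e) := by
    rw [Real.rpow_add h2, Real.rpow_add h2, Real.rpow_mul h2.le, Real.rpow_natCast, hθ', hm']
    ring
  have e4 : (2 : ℝ) ^ y * (R * θ ^ (d - 1) * m) = 2 ^ (y + b + f * (d - 1) + e) := by
    rw [Real.rpow_add h2, Real.rpow_add h2, Real.rpow_add h2, Real.rpow_mul h2.le, ← hdc,
      Real.rpow_natCast, hθ', hm', hR]
    ring
  rw [e1, e2, e3, e4, hlam]
  simp only [← Real.rpow_mul h2.le, ← Real.rpow_add h2]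
  refine Real.rpow_le_rpow_of_exponent_le one_le_two ?_
  obtain rfl : γ = d / 2 - P - d * Q := by linarith
  rcases hcase with ⟨h, rfl, rfl⟩ | ⟨h, rfl, rfl⟩
  · rw [abs_of_nonneg h]
    nlinarith [mul_le_mul_of_nonneg_right hβ h]
  · rw [abs_of_nonpos h]
    nlinarith [mul_le_mul_of_nonneg_right hβ' (neg_nonneg.2 h)]

/-- The square of the spatial `L^q` norm of a half-wave on a dyadic shell. -/
def shellLq (d : ℕ) (q : ℝ) (f : Euc d → ℂ) (R t : ℝ) : ℝ≥0∞ :=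
  (∫⁻ y in shell d R, ‖halfWave d f t y‖ₑ ^ q) ^ (2 / q)

lemma shellLq_le_shellEnergy {d : ℕ} (hd : 1 ≤ d) {f : Euc d → ℂ} (hf : Integrable f)
    (hrad : IsRadialC d f) {lam R m q : ℝ} (hlam : 0 < lam) (hR : 0 < R) (hlm : lam ≤ m)
    (hm : 1 / R ≤ m) (hq : 2 < q) (hM : ∫⁻ ξ, ‖f ξ‖ₑ ^ 2 ≠ ⊤)
    (hfS : ∀ ξ, ξ ∉ shell d lam → f ξ = 0) (t : ℝ) :
    shellLq d q f R t ≤ ENNReal.ofReal ((radialConst d / R ^ (d - 1)) ^ (1 - 2 / q) *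
      (1 / (2 * m)) ^ (2 / q)) * shellEnergy d f m R t := by
  have hq0 : 0 < q := by linarith
  have hm0 : 0 < m := hlam.trans_le hlm
  have hq1 : 0 ≤ 1 - 2 / q := by
    rw [sub_nonneg, div_le_one hq0]; exact hq.le
  have hc := radialConst_pos hd
  set N := shellEnergy d f m R t with hN
  have hNtop : N ≠ ⊤ := ne_top_of_le_ne_top (ENNReal.mul_ne_top ENNReal.ofReal_ne_top hM)
    (shellEnergy_le d hf hlam hR hlm hfS t)
  have h1 : ∀ x ∈ shell d R, ‖halfWave d f t x‖ₑ ^ 2 ≤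
      ENNReal.ofReal (radialConst d / R ^ (d - 1)) * N := fun x hx => by
    have h := sobolev_halfWave_shell hd hf hrad hR hm hfS t hx
    rw [div_eq_inv_mul, ENNReal.ofReal_mul (by positivity),
      ENNReal.ofReal_inv_of_pos (by positivity), mul_assoc,
      ← ENNReal.mul_le_iff_le_inv (by simp; positivity) ENNReal.ofReal_ne_top]
    exact h
  have h2 : ∫⁻ y in shell d R, ‖halfWave d f t y‖ₑ ^ 2 ≤ ENNReal.ofReal (1 / (2 * m)) * N := by
    rw [one_div, ENNReal.ofReal_inv_of_pos (by positivity),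
      ← ENNReal.mul_le_iff_le_inv (by simp; positivity) ENNReal.ofReal_ne_top]
    exact le_self_add
  refine (lintegral_rpow_le_of_sq_le (measurableSet_shell d R)
    (ENNReal.mul_ne_top ENNReal.ofReal_ne_top hNtop) hq h1).trans ?_
  calc _ ≤ (ENNReal.ofReal (radialConst d / R ^ (d - 1)) * N) ^ (1 - 2 / q) *
        (ENNReal.ofReal (1 / (2 * m)) * N) ^ (2 / q) := by gcongr
    _ = _ := by
      rw [ENNReal.mul_rpow_of_nonneg _ _ hq1, ENNReal.mul_rpow_of_nonneg _ _ (by positivity),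
        ENNReal.ofReal_rpow_of_pos (by positivity), ENNReal.ofReal_rpow_of_pos (by positivity),
        mul_mul_mul_comm, ← ENNReal.ofReal_mul (by positivity),
        ← ENNReal.rpow_add_of_nonneg _ _ hq1 (by positivity)]
      simp

/-- The constant in the frequency-localized estimate on a dyadic shell. -/
def shellConst (d : ℕ) (q : ℝ) : ℝ := radialConst d ^ (1 - 2 * q⁻¹) * energyConst d

lemma shellConst_pos {d : ℕ} (hd : 1 ≤ d) (q : ℝ) : 0 < shellConst d q := by
  have := radialConst_pos hd
  have := energyConst_pos d
  unfold shellConst; positivity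

lemma timeFunctional_shellLq_le {d : ℕ} (hd : 1 ≤ d) {Λ : (ℝ → ℝ≥0∞) → ℝ≥0∞} {P q γ β : ℝ}
    (hΛ : IsTimeFunctional Λ P) (hP : 0 ≤ P) (hP' : P ≤ 1 / 2) (hq : 2 < q) (hγ0 : 0 ≤ γ)
    (hβ : β ≤ (d - 1) * (1 - 2 * q⁻¹) - 2 * P) (hβ' : β ≤ 2 * d * q⁻¹)
    (hγ : P + d * q⁻¹ = d / 2 - γ) {f : Euc d → ℂ} (hf : Integrable f) (hrad : IsRadialC d f)
    {a b : ℝ} (hfS : ∀ ξ, ξ ∉ shell d (2 ^ a) → f ξ = 0) :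
    Λ (shellLq d q f (2 ^ b)) ≤ ENNReal.ofReal (shellConst d q * 2 ^ (-(β * |a + b|))) *
      ∫⁻ ξ, ENNReal.ofReal (‖ξ‖ ^ (2 * γ)) * ‖f ξ‖ₑ ^ 2 := by
  have hc := radialConst_pos hd
  have hE := energyConst_pos d
  have hS := shellConst_pos hd q
  have hq0 : 0 < q := by linarith
  have hlam : (0 : ℝ) < 2 ^ a := by positivity
  have hR : (0 : ℝ) < 2 ^ b := by positivity
  have hΦ : ENNReal.ofReal ((2 ^ a) ^ (2 * γ)) * ∫⁻ ξ, ‖f ξ‖ₑ ^ 2 ≤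
      ∫⁻ ξ, ENNReal.ofReal (‖ξ‖ ^ (2 * γ)) * ‖f ξ‖ₑ ^ 2 := by
    rw [← lintegral_const_mul' _ _ ENNReal.ofReal_ne_top]
    refine lintegral_mono fun ξ => ?_
    by_cases h : ξ ∈ shell d (2 ^ a)
    · have := h.1
      gcongr
    · simp [hfS ξ h]
  by_cases hM : ∫⁻ ξ, ‖f ξ‖ₑ ^ 2 = ⊤
  · have : ∫⁻ ξ, ENNReal.ofReal (‖ξ‖ ^ (2 * γ)) * ‖f ξ‖ₑ ^ 2 = ⊤ := by
      rw [hM, ENNReal.mul_top (by simp; positivity)] at hΦ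
      exact top_le_iff.1 hΦ
    rw [this, ENNReal.mul_top (by simp; positivity)]
    exact le_top
  set lam : ℝ := 2 ^ a with hlamdef
  set R : ℝ := 2 ^ b with hRdef
  set m := max lam (1 / R) with hmdef
  set θ := min 1 (lam * R) with hθdef
  have hm0 : 0 < m := hlam.trans_le (le_max_left _ _)
  have hθ0 : 0 < θ := by positivity
  set M := ∫⁻ ξ, ‖f ξ‖ₑ ^ 2 with hMdef
  set D := (radialConst d / R ^ (d - 1)) ^ (1 - 2 / q) * (1 / (2 * m)) ^ (2 / q) with hD
  have hD0 : 0 < D := by positivity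
  calc Λ (shellLq d q f R) ≤ Λ (fun t => ENNReal.ofReal D * shellEnergy d f m R t) :=
        hΛ.mono _ _ fun t => shellLq_le_shellEnergy hd hf hrad hlam hR (le_max_left _ _)
          (le_max_right _ _) hq hM hfS t
    _ ≤ ENNReal.ofReal D * Λ (shellEnergy d f m R) := hΛ.const_mul _ _ ENNReal.ofReal_ne_top
    _ ≤ ENNReal.ofReal D * ((ENNReal.ofReal (energyConst d * (θ ^ d * m)) * M) ^ (1 - 2 * P) *
        (ENNReal.ofReal (energyConst d * (R * θ ^ (d - 1) * m)) * M) ^ (2 * P)) := by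
        gcongr
        exact hΛ.interp _ _ _ (ENNReal.mul_ne_top ENNReal.ofReal_ne_top hM)
          (shellEnergy_le d hf hlam hR (le_max_left _ _) hfS)
          (lintegral_shellEnergy_le hd hf hlam hR (le_max_left _ _) hfS)
    _ = ENNReal.ofReal (D * ((energyConst d * (θ ^ d * m)) ^ (1 - 2 * P) *
        (energyConst d * (R * θ ^ (d - 1) * m)) ^ (2 * P))) * M := by
        have h1 : 0 ≤ 1 - 2 * P := by linarith
        rw [ENNReal.mul_rpow_of_nonneg _ _ h1, ENNReal.mul_rpow_of_nonneg _ _ (by positivity),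
          ENNReal.ofReal_rpow_of_pos (by positivity), ENNReal.ofReal_rpow_of_pos (by positivity),
          mul_mul_mul_comm, ← ENNReal.ofReal_mul (by positivity),
          ← ENNReal.rpow_add_of_nonneg _ _ h1 (by positivity), ← mul_assoc,
          ← ENNReal.ofReal_mul (by positivity)]
        simp
    _ ≤ ENNReal.ofReal (shellConst d q * (lam ^ (2 * γ) * 2 ^ (-(β * |a + b|)))) * M := by
        refine mul_le_mul_left (ENNReal.ofReal_le_ofReal ?_) _
        have := shell_exponent_le hd hc hE (by positivity) hβ hβ' hγ hlamdef hRdef hmdef hθdef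
        simpa only [shellConst, hD, div_eq_mul_inv 2 q] using this
    _ = ENNReal.ofReal (shellConst d q * 2 ^ (-(β * |a + b|))) *
        (ENNReal.ofReal (lam ^ (2 * γ)) * M) := by
        rw [← mul_assoc (ENNReal.ofReal _), ← ENNReal.ofReal_mul (by positivity)]
        congr 2; ring
    _ ≤ _ := by gcongr

lemma pairwise_disjoint_shell (d : ℕ) :
    Pairwise (Function.onFun Disjoint fun j : ℤ => shell d (2 ^ (j : ℝ))) := by
  have key : ∀ j k : ℤ, ∀ ξ : Euc d, ξ ∈ shell d (2 ^ (j : ℝ)) → ξ ∈ shell d (2 ^ (k : ℝ)) →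
      j ≤ k := by
    intro j k ξ hj hk
    have h : (2 : ℝ) ^ (j : ℝ) < 2 ^ ((k : ℝ) + 1) := by
      rw [Real.rpow_add two_pos, Real.rpow_one, mul_comm]
      exact hj.1.trans_lt hk.2
    rw [Real.rpow_lt_rpow_left_iff one_lt_two] at h
    exact Int.lt_add_one_iff.1 (by exact_mod_cast h)
  intro j k hjk
  refine Set.disjoint_left.2 fun ξ hj hk => hjk ?_
  exact le_antisymm (key j k ξ hj hk) (key k j ξ hk hj)

lemma iUnion_shell (d : ℕ) : ⋃ j : ℤ, shell d (2 ^ (j : ℝ)) = {0}ᶜ := by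
  ext ξ
  simp only [mem_iUnion, mem_compl_iff, mem_singleton_iff]
  constructor
  · rintro ⟨j, hj⟩ rfl
    have := hj.1
    rw [norm_zero] at this
    exact absurd this (not_le.2 (by positivity))
  · intro h
    obtain ⟨n, hn⟩ := exists_mem_Ico_zpow (norm_pos_iff.2 h) one_lt_two
    refine ⟨n, ?_, ?_⟩
    · rw [Real.rpow_intCast]; exact hn.1
    · rw [Real.rpow_intCast, mul_comm, ← zpow_add_one₀ two_ne_zero]; exact hn.2

lemma iUnion_shell_ae_eq_univ {d : ℕ} (hd : 1 ≤ d) :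
    (⋃ j : ℤ, shell d (2 ^ (j : ℝ)) : Set (Euc d)) =ᵐ[volume] univ := by
  have : Nonempty (Fin d) := ⟨⟨0, hd⟩⟩
  have : Nontrivial (Euc d) := inferInstance
  rw [iUnion_shell, ae_eq_univ, compl_compl]
  simp

lemma tsum_lintegral_shell {d : ℕ} (hd : 1 ≤ d) (g : Euc d → ℝ≥0∞) :
    ∑' j : ℤ, ∫⁻ x in shell d (2 ^ (j : ℝ)), g x = ∫⁻ x, g x := by
  rw [← lintegral_iUnion (fun j => measurableSet_shell d _) (pairwise_disjoint_shell d),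
    setLIntegral_congr (iUnion_shell_ae_eq_univ hd), setLIntegral_univ]

/-- The restriction of a frequency profile to a dyadic shell. -/
def dyadicPiece (d : ℕ) (f : Euc d → ℂ) (j : ℤ) : Euc d → ℂ :=
  (shell d (2 ^ (j : ℝ))).indicator f

lemma integrable_dyadicPiece (d : ℕ) {f : Euc d → ℂ} (hf : Integrable f) (j : ℤ) :
    Integrable (dyadicPiece d f j) :=
  hf.indicator (measurableSet_shell d _)

lemma dyadicPiece_eq_zero (d : ℕ) (f : Euc d → ℂ) (j : ℤ) (ξ : Euc d)
    (h : ξ ∉ shell d (2 ^ (j : ℝ))) : dyadicPiece d f j ξ = 0 :=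
  indicator_of_notMem h _

lemma isRadialC_dyadicPiece (d : ℕ) {f : Euc d → ℂ} (hf : IsRadialC d f) (j : ℤ) :
    IsRadialC d (dyadicPiece d f j) := by
  rw [isRadialC_iff] at hf ⊢
  intro x y h
  unfold dyadicPiece
  have hs : x ∈ shell d (2 ^ (j : ℝ)) ↔ y ∈ shell d (2 ^ (j : ℝ)) := by simp [shell, h]
  by_cases hx : x ∈ shell d (2 ^ (j : ℝ))
  · rw [indicator_of_mem hx, indicator_of_mem (hs.1 hx), hf x y h]
  · rw [indicator_of_notMem hx, indicator_of_notMem (fun h => hx (hs.2 h))]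

lemma enorm_halfWave_le_tsum {d : ℕ} (hd : 1 ≤ d) {f : Euc d → ℂ} (hf : Integrable f) (t : ℝ)
    (x : Euc d) : ‖halfWave d f t x‖ₑ ≤ ∑' j, ‖halfWave d (dyadicPiece d f j) t x‖ₑ := by
  set G : Euc d → ℂ := fun ξ =>
    Complex.exp (((2 * π * (inner ℝ ξ x + t * ‖ξ‖) : ℝ) : ℂ) * Complex.I) * f ξ with hG
  have hGi : Integrable G := by
    refine hf.bdd_mul (c := 1) (Continuous.aestronglyMeasurable (by fun_prop))
      (Filter.Eventually.of_forall fun ξ => ?_)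
    rw [Complex.norm_exp_ofReal_mul_I]
  have hsum := hasSum_integral_iUnion (μ := volume)
    (fun j : ℤ => measurableSet_shell d (2 ^ (j : ℝ))) (pairwise_disjoint_shell d)
    (hGi.integrableOn)
  rw [setIntegral_congr_set (iUnion_shell_ae_eq_univ hd), setIntegral_univ] at hsum
  have e : ∀ j : ℤ, ∫ ξ in shell d (2 ^ (j : ℝ)), G ξ = halfWave d (dyadicPiece d f j) t x := by
    intro j
    rw [← integral_indicator (measurableSet_shell d _)]
    unfold halfWave
    congr 1
    ext ξ
    by_cases h : ξ ∈ shell d (2 ^ (j : ℝ)) <;>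
      simp only [dyadicPiece, hG, indicator, h, if_true, if_false, mul_zero]
  simp_rw [e] at hsum
  change ‖∫ ξ, G ξ‖ₑ ≤ _
  rw [← hsum.tsum_eq]
  exact enorm_tsum_le_tsum_enorm

lemma tsum_lintegral_dyadicPiece {d : ℕ} (hd : 1 ≤ d) (f : Euc d → ℂ) (w : Euc d → ℝ≥0∞) :
    ∑' j, ∫⁻ ξ, w ξ * ‖dyadicPiece d f j ξ‖ₑ ^ 2 = ∫⁻ ξ, w ξ * ‖f ξ‖ₑ ^ 2 := by
  rw [← tsum_lintegral_shell hd]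
  congr 1
  ext j
  rw [← lintegral_indicator (measurableSet_shell d _)]
  congr 1
  ext ξ
  by_cases h : ξ ∈ shell d (2 ^ (j : ℝ)) <;>
    simp only [dyadicPiece, indicator, h, if_true, if_false, enorm_zero, ne_eq,
      OfNat.ofNat_ne_zero, not_false_eq_true, zero_pow, mul_zero]

lemma summable_two_rpow_neg_abs {b : ℝ} (hb : 0 < b) :
    Summable (fun n : ℤ => (2 : ℝ) ^ (-(b * |(n : ℝ)|))) := by
  have h : Summable (fun n : ℕ => (2 : ℝ) ^ (-(b * |((n : ℤ) : ℝ)|))) := by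
    have h0 : Summable (fun n : ℕ => ((2 : ℝ) ^ (-b)) ^ n) :=
      summable_geometric_of_lt_one (by positivity)
        (Real.rpow_lt_one_of_one_lt_of_neg one_lt_two (by linarith))
    refine h0.congr fun n => ?_
    rw [← Real.rpow_natCast, ← Real.rpow_mul two_pos.le]
    simp
  refine summable_int_iff_summable_nat_and_neg.2 ⟨h, ?_⟩
  simpa using h

/-- The off-diagonal decay weight. -/
def decayWeight (b : ℝ) (n : ℤ) : ℝ≥0∞ := ENNReal.ofReal (2 ^ (-(b * |(n : ℝ)|)))

lemma decayWeight_ne_zero (b : ℝ) (n : ℤ) : decayWeight b n ≠ 0 := by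
  unfold decayWeight; simp; positivity

lemma decayWeight_ne_top (b : ℝ) (n : ℤ) : decayWeight b n ≠ ⊤ := ENNReal.ofReal_ne_top

lemma tsum_decayWeight_add_right (b : ℝ) (k : ℤ) :
    ∑' j, decayWeight b (j + k) = ∑' n, decayWeight b n :=
  (Equiv.addRight k).tsum_eq (decayWeight b)

lemma tsum_decayWeight_add_left (b : ℝ) (j : ℤ) :
    ∑' k, decayWeight b (j + k) = ∑' n, decayWeight b n :=
  (Equiv.addLeft j).tsum_eq (decayWeight b)

lemma tsum_decayWeight_ne_top {b : ℝ} (hb : 0 < b) : ∑' n, decayWeight b n ≠ ⊤ := by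
  unfold decayWeight
  rw [← ENNReal.ofReal_tsum_of_nonneg (fun n => by positivity) (summable_two_rpow_neg_abs hb)]
  exact ENNReal.ofReal_ne_top

lemma inv_decayWeight_half_mul (b : ℝ) (n : ℤ) :
    (decayWeight (b / 2) n)⁻¹ * decayWeight b n = decayWeight (b / 2) n := by
  have : decayWeight b n = decayWeight (b / 2) n * decayWeight (b / 2) n := by
    unfold decayWeight
    rw [← ENNReal.ofReal_mul (by positivity), ← Real.rpow_add two_pos]
    congr 2; ring
  rw [this, ← mul_assoc, ENNReal.inv_mul_cancel (decayWeight_ne_zero _ _) (decayWeight_ne_top _ _),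
    one_mul]

lemma measurable_halfWave_slice (d : ℕ) {f : Euc d → ℂ} (hf : Integrable f) {lam : ℝ}
    (hfS : ∀ ξ, ξ ∉ shell d lam → f ξ = 0) (t : ℝ) : Measurable (halfWave d f t) :=
  ((continuous_halfWave_of_shell d hf hfS).comp
    (by fun_prop : Continuous fun x : Euc d => (t, x))).measurable

lemma lintegral_halfWave_rpow_le {d : ℕ} (hd : 1 ≤ d) {f : Euc d → ℂ} (hf : Integrable f)
    {q : ℝ} (hq : 2 < q) (b t : ℝ) :
    (∫⁻ x, ‖halfWave d f t x‖ₑ ^ q) ^ (2 / q) ≤ (∑' n, decayWeight b n) * ∑' k : ℤ, ∑' j : ℤ,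
      (decayWeight b (j + k))⁻¹ * shellLq d q (dyadicPiece d f j) (2 ^ (k : ℝ)) t := by
  have hq0 : 0 < q := by linarith
  have sq : ∀ X : ℝ≥0∞, X ^ (2 / q) = (X ^ (1 / q)) ^ 2 := fun X => by
    rw [← ENNReal.rpow_two, ← ENNReal.rpow_mul]; congr 1; ring
  have hk : ∀ k : ℤ, (∫⁻ x in shell d (2 ^ (k : ℝ)), ‖halfWave d f t x‖ₑ ^ q) ^ (2 / q) ≤
      (∑' n, decayWeight b n) * ∑' j : ℤ,
      (decayWeight b (j + k))⁻¹ * shellLq d q (dyadicPiece d f j) (2 ^ (k : ℝ)) t := by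
    intro k
    have h1 : (∫⁻ x in shell d (2 ^ (k : ℝ)), ‖halfWave d f t x‖ₑ ^ q) ^ (1 / q) ≤
        ∑' j, (∫⁻ x in shell d (2 ^ (k : ℝ)), ‖halfWave d (dyadicPiece d f j) t x‖ₑ ^ q) ^
          (1 / q) := by
      refine le_trans ?_ (lintegral_Lp_tsum_le (by linarith) fun j =>
        (measurable_halfWave_slice d (integrable_dyadicPiece d hf j)
          (dyadicPiece_eq_zero d f j) t).enorm)
      gcongr with x
      exact enorm_halfWave_le_tsum hd hf t x
    have h2 := tsum_sq_le_weighted (fun j => decayWeight b (j + k))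
      (fun j => (∫⁻ x in shell d (2 ^ (k : ℝ)), ‖halfWave d (dyadicPiece d f j) t x‖ₑ ^ q) ^
          (1 / q)) (fun j => decayWeight_ne_zero _ _) (fun j => decayWeight_ne_top _ _)
    rw [tsum_decayWeight_add_right] at h2
    simp_rw [← sq] at h2
    rw [sq]
    exact (pow_le_pow_left' h1 2).trans h2
  calc _ = (∑' k : ℤ, ∫⁻ x in shell d (2 ^ (k : ℝ)), ‖halfWave d f t x‖ₑ ^ q) ^ (2 / q) := by
        rw [tsum_lintegral_shell hd]
    _ ≤ ∑' k : ℤ, (∫⁻ x in shell d (2 ^ (k : ℝ)), ‖halfWave d f t x‖ₑ ^ q) ^ (2 / q) :=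
        tsum_rpow_le_tsum_rpow _ (by positivity) (by rw [div_le_one hq0]; exact hq.le)
    _ ≤ _ := by
        rw [← ENNReal.tsum_mul_left]
        exact ENNReal.tsum_le_tsum hk

lemma exists_timeFunctional_halfWave_le {d : ℕ} (hd : 2 ≤ d) {P q γ : ℝ} (hP : 0 ≤ P)
    (hP' : P ≤ 1 / 2) (hq : 2 < q) (hγ0 : 0 ≤ γ) (hadm : P + (d - 1) * q⁻¹ < ((d : ℝ) - 1) / 2)
    (hγ : P + d * q⁻¹ = d / 2 - γ) :
    ∃ C : ℝ, 0 < C ∧ ∀ Λ : (ℝ → ℝ≥0∞) → ℝ≥0∞, IsTimeFunctional Λ P → ∀ f : Euc d → ℂ,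
      Integrable f → IsRadialC d f →
      Λ (fun t => (∫⁻ x, ‖halfWave d f t x‖ₑ ^ q) ^ (2 / q)) ≤
        ENNReal.ofReal C * ∫⁻ ξ, ENNReal.ofReal (‖ξ‖ ^ (2 * γ)) * ‖f ξ‖ₑ ^ 2 := by
  have hd1 : 1 ≤ d := by omega
  have hd0 : (0 : ℝ) < d := by positivity
  have hq0 : 0 < q := by linarith
  have hα : 0 < ((d : ℝ) - 1) * (1 - 2 * q⁻¹) - 2 * P := by linarith
  have hα' : 0 < 2 * d * q⁻¹ := by positivity
  set β := min (((d : ℝ) - 1) * (1 - 2 * q⁻¹) - 2 * P) (2 * d * q⁻¹) with hβdef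
  have hβ : 0 < β := lt_min hα hα'
  set V := ∑' n, decayWeight (β / 2) n with hV
  have hVtop : V ≠ ⊤ := tsum_decayWeight_ne_top (by positivity)
  have hV0 : V ≠ 0 := fun h => decayWeight_ne_zero (β / 2) 0 (ENNReal.tsum_eq_zero.1 h 0)
  have hS := shellConst_pos hd1 q
  refine ⟨V.toReal * V.toReal * shellConst d q, ?_, fun Λ hΛ f hf hrad => ?_⟩
  · have := ENNReal.toReal_pos hV0 hVtop
    positivity
  set Φ : ℤ → ℝ≥0∞ := fun j => ∫⁻ ξ, ENNReal.ofReal (‖ξ‖ ^ (2 * γ)) * ‖dyadicPiece d f j ξ‖ₑ ^ 2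
    with hΦ
  have hmeas : ∀ j k : ℤ, Measurable (fun t => (decayWeight (β / 2) (j + k))⁻¹ *
      shellLq d q (dyadicPiece d f j) (2 ^ (k : ℝ)) t) := fun j k =>
    ((measurable_lintegral_shell_halfWave d (integrable_dyadicPiece d hf j)
      (dyadicPiece_eq_zero d f j) _ q).pow_const _).const_mul _
  have hpiece : ∀ j k : ℤ, Λ (fun t => (decayWeight (β / 2) (j + k))⁻¹ *
      shellLq d q (dyadicPiece d f j) (2 ^ (k : ℝ)) t) ≤
      ENNReal.ofReal (shellConst d q) * decayWeight (β / 2) (j + k) * Φ j := by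
    intro j k
    refine (hΛ.const_mul _ _ (ENNReal.inv_ne_top.2 (decayWeight_ne_zero _ _))).trans ?_
    have h := timeFunctional_shellLq_le hd1 hΛ hP hP' hq hγ0 (min_le_left _ _) (min_le_right _ _)
      hγ (integrable_dyadicPiece d hf j) (isRadialC_dyadicPiece d hrad j) (b := k)
      (dyadicPiece_eq_zero d f j)
    rw [← hβdef] at h
    calc _ ≤ (decayWeight (β / 2) (j + k))⁻¹ *
          (ENNReal.ofReal (shellConst d q * 2 ^ (-(β * |(j : ℝ) + k|))) * Φ j) := by gcongr
      _ = (decayWeight (β / 2) (j + k))⁻¹ *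
          (ENNReal.ofReal (shellConst d q) * decayWeight β (j + k) * Φ j) := by
          rw [ENNReal.ofReal_mul hS.le, decayWeight, decayWeight]
          push_cast
          rfl
      _ = ENNReal.ofReal (shellConst d q) *
          ((decayWeight (β / 2) (j + k))⁻¹ * decayWeight β (j + k)) * Φ j := by ring
      _ = _ := by rw [inv_decayWeight_half_mul]
  calc Λ (fun t => (∫⁻ x, ‖halfWave d f t x‖ₑ ^ q) ^ (2 / q))
      ≤ Λ (fun t => V * ∑' k : ℤ, ∑' j : ℤ, (decayWeight (β / 2) (j + k))⁻¹ *
          shellLq d q (dyadicPiece d f j) (2 ^ (k : ℝ)) t) :=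
        hΛ.mono _ _ fun t => lintegral_halfWave_rpow_le hd1 hf hq _ t
    _ ≤ V * Λ (fun t => ∑' k : ℤ, ∑' j : ℤ, (decayWeight (β / 2) (j + k))⁻¹ *
          shellLq d q (dyadicPiece d f j) (2 ^ (k : ℝ)) t) := hΛ.const_mul _ _ hVtop
    _ ≤ V * ∑' k : ℤ, ∑' j : ℤ, Λ (fun t => (decayWeight (β / 2) (j + k))⁻¹ *
          shellLq d q (dyadicPiece d f j) (2 ^ (k : ℝ)) t) := by
        gcongr
        refine (hΛ.tsum _ fun k => Measurable.tsum fun j => hmeas j k).trans ?_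
        exact ENNReal.tsum_le_tsum fun k => hΛ.tsum _ fun j => hmeas j k
    _ ≤ V * ∑' k : ℤ, ∑' j : ℤ,
          ENNReal.ofReal (shellConst d q) * decayWeight (β / 2) (j + k) * Φ j := by
        gcongr with k j
        exact hpiece j k
    _ = V * ∑' j : ℤ, ENNReal.ofReal (shellConst d q) * V * Φ j := by
        rw [ENNReal.tsum_comm]
        congr 2
        ext j
        rw [ENNReal.tsum_mul_right, ENNReal.tsum_mul_left, tsum_decayWeight_add_left]
    _ = _ := by
        rw [ENNReal.tsum_mul_left, tsum_lintegral_dyadicPiece hd1,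
          ENNReal.ofReal_mul (by positivity), ENNReal.ofReal_mul (by positivity),
          ENNReal.ofReal_toReal hVtop]
        ring

/-- The directional derivative of a complex-valued function on space-time. -/
def dirDerivC {d : ℕ} (v : ℝ × Euc d) (U : ℝ × Euc d → ℂ) (p : ℝ × Euc d) : ℂ := fderiv ℝ U p v

lemma contDiff_dirDerivC {d : ℕ} (v : ℝ × Euc d) {U : ℝ × Euc d → ℂ}
    (hU : ContDiff ℝ (⊤ : ℕ∞) U) : ContDiff ℝ (⊤ : ℕ∞) (dirDerivC v U) := by
  unfold dirDerivC
  exact (hU.fderiv_right (m := (⊤ : ℕ∞)) (by simp)).clm_apply contDiff_const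

lemma dirDeriv_clm_sub {d : ℕ} (L : ℂ →L[ℝ] ℝ) (v : ℝ × Euc d) {U V : ℝ × Euc d → ℂ}
    (hU : ContDiff ℝ (⊤ : ℕ∞) U) (hV : ContDiff ℝ (⊤ : ℕ∞) V) :
    dirDeriv v (fun p => L (U p - V p)) = fun p => L (dirDerivC v U p - dirDerivC v V p) := by
  ext p
  have h := L.hasFDerivAt.comp p ((hU.differentiable (by simp) p).hasFDerivAt.sub
    (hV.differentiable (by simp) p).hasFDerivAt)
  have h2 : HasFDerivAt (fun p => L (U p - V p)) (L ∘L (fderiv ℝ U p - fderiv ℝ V p)) p := h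
  rw [dirDeriv, h2.fderiv]
  simp [dirDerivC]

lemma deriv_time_eq_dirDerivC {d : ℕ} {U : ℝ × Euc d → ℂ} (hU : ContDiff ℝ (⊤ : ℕ∞) U) (t : ℝ)
    (x : Euc d) : deriv (fun s => U (s, x)) t = dirDerivC (tDir d) U (t, x) := by
  have h := (hU.differentiable (by simp) (t, x)).hasFDerivAt.comp_hasDerivAt t
    ((hasDerivAt_id t).prodMk (hasDerivAt_const t x))
  exact h.deriv

lemma fderiv_space_eq_dirDerivC {d : ℕ} {U : ℝ × Euc d → ℂ} (hU : ContDiff ℝ (⊤ : ℕ∞) U) (t : ℝ)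
    (x : Euc d) (i : Fin d) : fderiv ℝ (fun y => U (t, y)) x (EuclideanSpace.single i 1) =
      dirDerivC (xDir d i) U (t, x) := by
  have h := (hU.differentiable (by simp) (t, x)).hasFDerivAt.comp x
    ((hasFDerivAt_const t x).prodMk (hasFDerivAt_id x))
  have h2 : HasFDerivAt (fun y => U (t, y)) ((fderiv ℝ U (t, x)) ∘L
    (ContinuousLinearMap.prod 0 (ContinuousLinearMap.id ℝ (Euc d)))) x := h
  rw [h2.fderiv]
  simp [dirDerivC, xDir]

lemma timeDeriv2C_eq {d : ℕ} {u : ℝ → Euc d → ℂ}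
    (hu : ContDiff ℝ (⊤ : ℕ∞) (Function.uncurry u)) (t : ℝ) (x : Euc d) :
    timeDeriv2C d u t x =
      dirDerivC (tDir d) (dirDerivC (tDir d) (Function.uncurry u)) (t, x) := by
  unfold timeDeriv2C
  rw [← deriv_time_eq_dirDerivC (contDiff_dirDerivC _ hu)]
  congr 1
  ext s
  exact deriv_time_eq_dirDerivC hu s x

lemma spatialLapC_eq {d : ℕ} {u : ℝ → Euc d → ℂ}
    (hu : ContDiff ℝ (⊤ : ℕ∞) (Function.uncurry u)) (t : ℝ) (x : Euc d) :
    spatialLapC d (u t) x =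
      ∑ i, dirDerivC (xDir d i) (dirDerivC (xDir d i) (Function.uncurry u)) (t, x) := by
  unfold spatialLapC
  refine Finset.sum_congr rfl fun i _ => ?_
  rw [← fderiv_space_eq_dirDerivC (contDiff_dirDerivC _ hu)]
  congr 2
  ext y
  exact fderiv_space_eq_dirDerivC hu t y i

lemma wave_eq_of_data_eq {d : ℕ} {u v : ℝ → Euc d → ℂ}
    (hu : ContDiff ℝ (⊤ : ℕ∞) (Function.uncurry u)) (hv : ContDiff ℝ (⊤ : ℕ∞) (Function.uncurry v))
    (hu2 : ∀ t x, timeDeriv2C d u t x = spatialLapC d (u t) x)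
    (hv2 : ∀ t x, timeDeriv2C d v t x = spatialLapC d (v t) x)
    (h0 : ∀ x, u 0 x = v 0 x) (h1 : ∀ x, timeDerivC d u 0 x = timeDerivC d v 0 x) : u = v := by
  have key : ∀ L : ℂ →L[ℝ] ℝ, ∀ p : ℝ × Euc d,
      L (Function.uncurry u p - Function.uncurry v p) = 0 := by
    intro L p
    refine wave_unique d (w := fun p => L (Function.uncurry u p - Function.uncurry v p))
      (L.contDiff.comp (hu.sub hv)) ?_ ?_ ?_ p
    · rintro ⟨t, x⟩
      have hs : ∀ w, dirDeriv w (dirDeriv w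
          (fun p => L (Function.uncurry u p - Function.uncurry v p))) (t, x) =
          L (dirDerivC w (dirDerivC w (Function.uncurry u)) (t, x) -
            dirDerivC w (dirDerivC w (Function.uncurry v)) (t, x)) := by
        intro w
        rw [dirDeriv_clm_sub L w hu hv, dirDeriv_clm_sub L w (contDiff_dirDerivC _ hu)
          (contDiff_dirDerivC _ hv)]
      simp_rw [hs]
      rw [← map_sum, Finset.sum_sub_distrib, ← spatialLapC_eq hu, ← spatialLapC_eq hv,
        ← timeDeriv2C_eq hu, ← timeDeriv2C_eq hv, hu2, hv2]
    · intro x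
      simp [h0]
    · intro x
      rw [dirDeriv_clm_sub L _ hu hv]
      dsimp only
      rw [← deriv_time_eq_dirDerivC hu, ← deriv_time_eq_dirDerivC hv]
      have := h1 x
      unfold timeDerivC at this
      simp [this]
  ext t x
  have hre := key Complex.reCLM (t, x)
  have him := key Complex.imCLM (t, x)
  have : u t x - v t x = 0 := Complex.ext (by simpa using hre) (by simpa using him)
  exact sub_eq_zero.1 this

lemma halfWave_add (d : ℕ) {f g : Euc d → ℂ} (hf : Integrable f) (hg : Integrable g) (t : ℝ)
    (x : Euc d) : halfWave d (fun ξ => f ξ + g ξ) t x = halfWave d f t x + halfWave d g t x := by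
  have hi : ∀ {f : Euc d → ℂ}, Integrable f → Integrable (fun ξ =>
      Complex.exp (((2 * π * (inner ℝ ξ x + t * ‖ξ‖) : ℝ) : ℂ) * Complex.I) * f ξ) := by
    intro f hf
    refine hf.bdd_mul (c := 1) (Continuous.aestronglyMeasurable (by fun_prop))
      (Filter.Eventually.of_forall fun ξ => ?_)
    rw [Complex.norm_exp_ofReal_mul_I]
  unfold halfWave
  rw [← integral_add (hi hf) (hi hg)]
  simp_rw [mul_add]

lemma halfWave_neg (d : ℕ) (f : Euc d → ℂ) (t : ℝ) (x : Euc d) :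
    halfWave d (fun ξ => -f ξ) t x = -halfWave d f t x := by
  unfold halfWave
  rw [← integral_neg]
  simp_rw [mul_neg]

lemma halfWave_sum (d : ℕ) {ι : Type*} (s : Finset ι) {f : ι → Euc d → ℂ}
    (hf : ∀ i ∈ s, Integrable (f i)) (t : ℝ) (x : Euc d) :
    halfWave d (fun ξ => ∑ i ∈ s, f i ξ) t x = ∑ i ∈ s, halfWave d (f i) t x := by
  classical
  induction s using Finset.induction_on with
  | empty => simp [halfWave]
  | insert a s ha ih =>
    simp_rw [Finset.sum_insert ha]
    rw [halfWave_add d (hf a (by simp)) (integrable_finsetSum _ fun i hi => hf i (by simp [hi])),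
      ih fun i hi => hf i (by simp [hi])]

/-- All moments of a frequency profile are integrable. -/
def HasMoments (d : ℕ) (f : Euc d → ℂ) : Prop :=
  AEStronglyMeasurable f ∧ ∀ n : ℕ, Integrable (fun ξ => ‖ξ‖ ^ n * ‖f ξ‖)

lemma HasMoments.integrable {d : ℕ} {f : Euc d → ℂ} (hf : HasMoments d f) : Integrable f :=
  (integrable_norm_iff hf.1).1 (by simpa using hf.2 0)

lemma HasMoments.integrable_mul {d : ℕ} {f : Euc d → ℂ} (hf : HasMoments d f) :
    Integrable (fun ξ => ‖ξ‖ * ‖f ξ‖) := by simpa using hf.2 1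

lemma HasMoments.mul_of_le {d : ℕ} {f a : Euc d → ℂ} (hf : HasMoments d f) (ha : Continuous a)
    {c : ℝ} (hac : ∀ ξ, ‖a ξ‖ ≤ c * ‖ξ‖) : HasMoments d (fun ξ => a ξ * f ξ) := by
  refine ⟨ha.aestronglyMeasurable.mul hf.1, fun n => ?_⟩
  refine ((hf.2 (n + 1)).const_mul c).mono' ?_ (Filter.Eventually.of_forall fun ξ => ?_)
  · exact (Continuous.aestronglyMeasurable (by fun_prop)).mul
      (ha.aestronglyMeasurable.mul hf.1).norm
  · rw [norm_mul, norm_norm, norm_mul, norm_pow, norm_norm]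
    calc ‖ξ‖ ^ n * (‖a ξ‖ * ‖f ξ‖) ≤ ‖ξ‖ ^ n * (c * ‖ξ‖ * ‖f ξ‖) := by gcongr; exact hac ξ
      _ = c * (‖ξ‖ ^ (n + 1) * ‖f ξ‖) := by ring

lemma HasMoments.timeSymbol {d : ℕ} {f : Euc d → ℂ} (hf : HasMoments d f) :
    HasMoments d (fun ξ => 2 * π * Complex.I * (‖ξ‖ : ℂ) * f ξ) := by
  refine hf.mul_of_le (c := 2 * π) (by fun_prop) fun ξ => ?_
  simp [abs_of_pos pi_pos]

lemma HasMoments.spaceSymbol {d : ℕ} {f : Euc d → ℂ} (hf : HasMoments d f) (i : Fin d) :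
    HasMoments d (fun ξ => 2 * π * Complex.I *
      ((inner ℝ ξ (EuclideanSpace.single i 1 : Euc d) : ℝ) : ℂ) * f ξ) := by
  refine hf.mul_of_le (c := 2 * π) (by fun_prop) fun ξ => ?_
  have : ‖inner ℝ ξ (EuclideanSpace.single i 1 : Euc d)‖ ≤ ‖ξ‖ := by
    simpa using norm_inner_le_norm (𝕜 := ℝ) ξ (EuclideanSpace.single i 1 : Euc d)
  rw [norm_mul, norm_mul, norm_mul, Complex.norm_I, Complex.norm_real, Complex.norm_real,
    Real.norm_of_nonneg pi_pos.le, mul_one, Complex.norm_ofNat]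
  gcongr

/-- The superposition of two half-waves travelling in opposite directions. -/
def twoWave (d : ℕ) (f g : Euc d → ℂ) (t : ℝ) (x : Euc d) : ℂ :=
  halfWave d f t x + halfWave d g (-t) x

lemma contDiff_twoWave {d : ℕ} {f g : Euc d → ℂ} (hf : HasMoments d f) (hg : HasMoments d g) :
    ContDiff ℝ (⊤ : ℕ∞) (Function.uncurry (twoWave d f g)) := by
  have h1 := contDiff_halfWave d hf.2
  have h2 := (contDiff_halfWave d hg.2).comp (g := fun p : ℝ × Euc d => halfWave d g p.1 p.2)
    (f := fun p : ℝ × Euc d => (-p.1, p.2)) (by fun_prop)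
  exact h1.add h2

lemma hasDerivAt_twoWave {d : ℕ} {f g : Euc d → ℂ} (hf : HasMoments d f) (hg : HasMoments d g)
    (t : ℝ) (x : Euc d) : HasDerivAt (fun s => twoWave d f g s x)
      (twoWave d (fun ξ => 2 * π * Complex.I * (‖ξ‖ : ℂ) * f ξ)
        (fun ξ => -(2 * π * Complex.I * (‖ξ‖ : ℂ) * g ξ)) t x) t := by
  have h1 := hasDerivAt_halfWave_time d hf.integrable hf.integrable_mul t x
  have h2 := (hasDerivAt_halfWave_time d hg.integrable hg.integrable_mul (-t) x).scomp t
    (hasDerivAt_neg t)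
  unfold twoWave
  rw [halfWave_neg]
  simpa using! h1.add h2

lemma HasMoments.neg {d : ℕ} {f : Euc d → ℂ} (hf : HasMoments d f) :
    HasMoments d (fun ξ => -f ξ) :=
  ⟨hf.1.neg, fun n => by simpa using hf.2 n⟩

lemma fderiv_twoWave {d : ℕ} {f g : Euc d → ℂ} (hf : HasMoments d f) (hg : HasMoments d g)
    (t : ℝ) (x : Euc d) (i : Fin d) :
    fderiv ℝ (twoWave d f g t) x (EuclideanSpace.single i 1) =
      twoWave d
        (fun ξ => 2 * π * Complex.I *
          ((inner ℝ ξ (EuclideanSpace.single i 1 : Euc d) : ℝ) : ℂ) * f ξ)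
        (fun ξ => 2 * π * Complex.I *
          ((inner ℝ ξ (EuclideanSpace.single i 1 : Euc d) : ℝ) : ℂ) * g ξ) t x := by
  have h1 := fderiv_halfWave_space d hf.integrable hf.integrable_mul t x
    (EuclideanSpace.single i 1)
  have h2 := fderiv_halfWave_space d hg.integrable hg.integrable_mul (-t) x
    (EuclideanSpace.single i 1)
  have e : fderiv ℝ (twoWave d f g t) x =
      fderiv ℝ (halfWave d f t) x + fderiv ℝ (halfWave d g (-t)) x := fderiv_add h1.1 h2.1
  rw [e, add_apply, h1.2, h2.2]
  rfl

lemma sum_inner_single_sq (d : ℕ) (ξ : Euc d) (z : ℂ) :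
    ∑ i, 2 * π * Complex.I * ((inner ℝ ξ (EuclideanSpace.single i 1 : Euc d) : ℝ) : ℂ) *
      (2 * π * Complex.I * ((inner ℝ ξ (EuclideanSpace.single i 1 : Euc d) : ℝ) : ℂ) * z) =
    2 * π * Complex.I * (‖ξ‖ : ℂ) * (2 * π * Complex.I * (‖ξ‖ : ℂ) * z) := by
  have h : (‖ξ‖ : ℂ) ^ 2 =
      ∑ i, ((inner ℝ ξ (EuclideanSpace.single i 1 : Euc d) : ℝ) : ℂ) ^ 2 := by
    rw [← Complex.ofReal_pow, EuclideanSpace.real_norm_sq_eq]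
    simp [EuclideanSpace.inner_single_right]
  calc _ = ∑ i, ((inner ℝ ξ (EuclideanSpace.single i 1 : Euc d) : ℝ) : ℂ) ^ 2 *
        ((2 * π * Complex.I) ^ 2 * z) := Finset.sum_congr rfl fun i _ => by ring
    _ = _ := by rw [← Finset.sum_mul, ← h]; ring

lemma twoWave_wave_equation {d : ℕ} {f g : Euc d → ℂ} (hf : HasMoments d f)
    (hg : HasMoments d g) (t : ℝ) (x : Euc d) :
    timeDeriv2C d (twoWave d f g) t x = spatialLapC d (twoWave d f g t) x := by
  unfold timeDeriv2C spatialLapC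
  have e1 : deriv (fun s => twoWave d f g s x) = fun s =>
      twoWave d (fun ξ => 2 * π * Complex.I * (‖ξ‖ : ℂ) * f ξ)
        (fun ξ => -(2 * π * Complex.I * (‖ξ‖ : ℂ) * g ξ)) s x :=
    funext fun s => (hasDerivAt_twoWave hf hg s x).deriv
  rw [e1, (hasDerivAt_twoWave hf.timeSymbol hg.timeSymbol.neg t x).deriv]
  simp_rw [fderiv_twoWave hf hg]
  rw [Finset.sum_congr rfl fun i _ => fderiv_twoWave (hf.spaceSymbol i) (hg.spaceSymbol i) t x i]
  unfold twoWave
  rw [Finset.sum_add_distrib,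
    ← halfWave_sum d _ fun i _ => ((hf.spaceSymbol i).spaceSymbol i).integrable,
    ← halfWave_sum d _ fun i _ => ((hg.spaceSymbol i).spaceSymbol i).integrable]
  simp_rw [sum_inner_single_sq, mul_neg, neg_neg]

lemma HasMoments.add {d : ℕ} {f g : Euc d → ℂ} (hf : HasMoments d f) (hg : HasMoments d g) :
    HasMoments d (fun ξ => f ξ + g ξ) := by
  refine ⟨hf.1.add hg.1, fun n => ((hf.2 n).add (hg.2 n)).mono' ?_
    (Filter.Eventually.of_forall fun ξ => ?_)⟩
  · exact (Continuous.aestronglyMeasurable (by fun_prop)).mul (hf.1.add hg.1).norm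
  · rw [norm_mul, norm_norm, norm_pow, norm_norm, Pi.add_apply, ← mul_add]
    gcongr
    exact norm_add_le _ _

lemma HasMoments.const_mul {d : ℕ} {f : Euc d → ℂ} (hf : HasMoments d f) (c : ℂ) :
    HasMoments d (fun ξ => c * f ξ) := by
  refine ⟨hf.1.const_mul c, fun n => ?_⟩
  convert (hf.2 n).const_mul ‖c‖ using 2 with ξ
  rw [norm_mul]
  ring

lemma hasMoments_schwartz {d : ℕ} (ψ : SchwartzMap (Euc d) ℂ) : HasMoments d ψ :=
  ⟨ψ.continuous.aestronglyMeasurable, fun n => ψ.integrable_pow_mul volume n⟩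

lemma HasMoments.inv_norm_mul {d : ℕ} (hd : 2 ≤ d) {f : Euc d → ℂ} (hf : HasMoments d f)
    {K : ℝ} (hK : ∀ ξ, ‖f ξ‖ ≤ K) : HasMoments d (fun ξ => (‖ξ‖ : ℂ)⁻¹ * f ξ) := by
  have hm : AEStronglyMeasurable (fun ξ : Euc d => (‖ξ‖ : ℂ)⁻¹ * f ξ) :=
    (Measurable.aestronglyMeasurable (by fun_prop)).mul hf.1
  refine ⟨hm, fun n => ?_⟩
  have hm' : AEStronglyMeasurable (fun ξ : Euc d => ‖ξ‖ ^ n * ‖(‖ξ‖ : ℂ)⁻¹ * f ξ‖) :=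
    (Continuous.aestronglyMeasurable (by fun_prop)).mul hm.norm
  rw [← integrableOn_univ, ← union_compl_self (Metric.ball (0 : Euc d) 1)]
  refine IntegrableOn.union ?_ ?_
  · refine integrableOn_ball_of_norm_le_rpow (C := K) (α := 1) (by simp; lia)
      (by simp; lia) ?_ hm'
    refine (ae_restrict_iff' measurableSet_ball).2 (Filter.Eventually.of_forall fun ξ hξ => ?_)
    have h1 : ‖ξ‖ ≤ 1 := by
      rw [mem_ball_zero_iff] at hξ
      exact hξ.le
    rw [norm_mul, norm_norm, norm_pow, norm_norm, norm_mul, norm_inv, Complex.norm_real, norm_norm,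
      rpow_neg_one]
    calc ‖ξ‖ ^ n * (‖ξ‖⁻¹ * ‖f ξ‖) ≤ 1 * (‖ξ‖⁻¹ * K) := by
          gcongr
          · exact pow_le_one₀ (norm_nonneg _) h1
          · exact hK ξ
      _ = K * ‖ξ‖⁻¹ := by ring
  · refine (hf.2 n).integrableOn.mono' hm'.restrict ?_
    refine (ae_restrict_iff' measurableSet_ball.compl).2
      (Filter.Eventually.of_forall fun ξ hξ => ?_)
    have h1 : 1 ≤ ‖ξ‖ := by
      rw [mem_compl_iff, mem_ball_zero_iff, not_lt] at hξ
      exact hξ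
    rw [norm_mul, norm_norm, norm_pow, norm_norm, norm_mul, norm_inv, Complex.norm_real, norm_norm]
    gcongr
    exact mul_le_of_le_one_left (norm_nonneg _) (inv_le_one_of_one_le₀ h1)

/-- The frequency profile of the half-wave `exp(it|∇|)` part of the free wave whose initial
position and velocity have Fourier transforms `a` and `b`. -/
def waveProfile (d : ℕ) (a b : Euc d → ℂ) (ξ : Euc d) : ℂ :=
  2⁻¹ * (a ξ + (2 * π * Complex.I)⁻¹ * ((‖ξ‖ : ℂ)⁻¹ * b ξ))

lemma hasMoments_waveProfile {d : ℕ} (hd : 2 ≤ d) (a b : SchwartzMap (Euc d) ℂ) :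
    HasMoments d (waveProfile d a b) := by
  have hb := (hasMoments_schwartz b).inv_norm_mul hd (b.norm_le_seminorm ℝ)
  exact ((hasMoments_schwartz a).add (hb.const_mul _)).const_mul _

lemma isRadialC_waveProfile {d : ℕ} {a b : Euc d → ℂ} (ha : IsRadialC d a) (hb : IsRadialC d b) :
    IsRadialC d (waveProfile d a b) := by
  obtain ⟨g, hg⟩ := ha
  obtain ⟨h, hh⟩ := hb
  exact ⟨fun r => 2⁻¹ * (g r + (2 * π * Complex.I)⁻¹ * ((r : ℂ)⁻¹ * h r)),
    fun ξ => by rw [waveProfile, hg, hh]⟩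

lemma fourier_eq_halfWave {d : ℕ} (f : Euc d → ℂ) (x : Euc d) :
    𝓕 f x = halfWave d f 0 (-x) := by
  rw [Real.fourier_eq', halfWave]
  simp [inner_neg_right]

lemma fourierInv_eq_halfWave {d : ℕ} (f : Euc d → ℂ) (x : Euc d) :
    𝓕⁻ f x = halfWave d f 0 x := by
  rw [Real.fourierInv_eq', halfWave]
  simp

lemma isRadialC_fourier {d : ℕ} {f : Euc d → ℂ} (hf : IsRadialC d f) : IsRadialC d (𝓕 f) := by
  obtain ⟨g, hg⟩ := isRadialC_halfWave hf 0
  exact ⟨g, fun x => by rw [fourier_eq_halfWave, hg, norm_neg]⟩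

lemma halfWave_fourier_schwartz {d : ℕ} (φ : SchwartzMap (Euc d) ℂ) (x : Euc d) :
    halfWave d (𝓕 φ : SchwartzMap (Euc d) ℂ) 0 x = φ x := by
  rw [← fourierInv_eq_halfWave, ← SchwartzMap.fourierInv_coe]
  simp

lemma ae_norm_ne_zero {d : ℕ} (hd : 2 ≤ d) : ∀ᵐ ξ : Euc d, ‖ξ‖ ≠ 0 := by
  have : Nonempty (Fin d) := ⟨⟨0, by lia⟩⟩
  have h : ∀ᵐ ξ : Euc d, ξ ≠ 0 := by simp [ae_iff]
  filter_upwards [h] with ξ hξ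
  simpa using hξ

lemma halfWave_congr_ae {d : ℕ} {f g : Euc d → ℂ} (h : ∀ᵐ ξ, f ξ = g ξ) (t : ℝ) (x : Euc d) :
    halfWave d f t x = halfWave d g t x := by
  unfold halfWave
  refine integral_congr_ae ?_
  filter_upwards [h] with ξ hξ
  rw [hξ]

lemma eq_twoWave_of_wave_equation {d : ℕ} (hd : 2 ≤ d) {u : ℝ → Euc d → ℂ}
    (φ₀ φ₁ : SchwartzMap (Euc d) ℂ) (hu : ContDiff ℝ (⊤ : ℕ∞) (Function.uncurry u))
    (hwave : ∀ t x, timeDeriv2C d u t x = spatialLapC d (u t) x)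
    (h0 : ∀ x, u 0 x = φ₀ x) (h1 : ∀ x, timeDerivC d u 0 x = φ₁ x) :
    u = twoWave d (waveProfile d (𝓕 φ₀ : SchwartzMap (Euc d) ℂ) (𝓕 φ₁ : SchwartzMap (Euc d) ℂ))
      (waveProfile d (𝓕 φ₀ : SchwartzMap (Euc d) ℂ) (-𝓕 φ₁ : SchwartzMap (Euc d) ℂ)) := by
  have hp := hasMoments_waveProfile hd (𝓕 φ₀) (𝓕 φ₁)
  have hm := hasMoments_waveProfile hd (𝓕 φ₀) (-𝓕 φ₁)
  refine wave_eq_of_data_eq hu (contDiff_twoWave hp hm) hwave (twoWave_wave_equation hp hm)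
    (fun x => ?_) (fun x => ?_)
  · rw [h0, twoWave, neg_zero, ← halfWave_add d hp.integrable hm.integrable,
      ← halfWave_fourier_schwartz]
    congr 1
    ext ξ
    simp only [waveProfile, neg_apply]
    ring
  · rw [h1, timeDerivC, (hasDerivAt_twoWave hp hm 0 x).deriv, twoWave, neg_zero,
      ← halfWave_add d hp.timeSymbol.integrable hm.timeSymbol.neg.integrable,
      ← halfWave_fourier_schwartz]
    refine halfWave_congr_ae ?_ 0 x
    filter_upwards [ae_norm_ne_zero hd] with ξ hξ
    have hξ' : (‖ξ‖ : ℂ) ≠ 0 := Complex.ofReal_ne_zero.2 hξ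
    have hpi : (π : ℂ) ≠ 0 := Complex.ofReal_ne_zero.2 pi_ne_zero
    simp only [waveProfile, neg_apply]
    field_simp
    ring

lemma norm_waveProfile_sq_le (d : ℕ) (a b : Euc d → ℂ) (ξ : Euc d) :
    ‖waveProfile d a b ξ‖ ^ 2 ≤ ‖a ξ‖ ^ 2 + ‖ξ‖⁻¹ ^ 2 * ‖b ξ‖ ^ 2 := by
  have h2 : ‖(2 * π * Complex.I : ℂ)⁻¹‖ ≤ 1 := by
    rw [norm_inv, norm_mul, norm_mul, Complex.norm_I, Complex.norm_real, Complex.norm_ofNat,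
      Real.norm_of_nonneg pi_pos.le]
    exact inv_le_one_of_one_le₀ (by linarith [pi_gt_three])
  have h : ‖waveProfile d a b ξ‖ ≤ 2⁻¹ * (‖a ξ‖ + ‖ξ‖⁻¹ * ‖b ξ‖) := by
    rw [waveProfile, norm_mul, norm_inv, Complex.norm_ofNat]
    gcongr
    refine (norm_add_le _ _).trans ?_
    gcongr
    rw [norm_mul, norm_mul, norm_inv (‖ξ‖ : ℂ), Complex.norm_real, norm_norm]
    exact mul_le_of_le_one_left (by positivity) h2
  calc ‖waveProfile d a b ξ‖ ^ 2 ≤ (2⁻¹ * (‖a ξ‖ + ‖ξ‖⁻¹ * ‖b ξ‖)) ^ 2 := by gcongr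
    _ ≤ _ := by
      rw [← mul_pow]
      nlinarith [sq_nonneg (‖a ξ‖ - ‖ξ‖⁻¹ * ‖b ξ‖), sq_nonneg (‖a ξ‖), sq_nonneg (‖ξ‖⁻¹ * ‖b ξ‖)]

lemma lintegral_waveProfile_le {d : ℕ} (hd : 2 ≤ d) (γ : ℝ) {a b : Euc d → ℂ}
    (ha : Continuous a) :
    ∫⁻ ξ, ENNReal.ofReal (‖ξ‖ ^ (2 * γ)) * ‖waveProfile d a b ξ‖ₑ ^ 2 ≤
      (∫⁻ ξ, ENNReal.ofReal (‖ξ‖ ^ (2 * γ) * ‖a ξ‖ ^ 2)) +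
        ∫⁻ ξ, ENNReal.ofReal (‖ξ‖ ^ (2 * (γ - 1)) * ‖b ξ‖ ^ 2) := by
  rw [← lintegral_add_left (by fun_prop)]
  refine lintegral_mono_ae ?_
  filter_upwards [ae_norm_ne_zero hd] with ξ hξ
  rw [← ofReal_norm, ← ENNReal.ofReal_pow (norm_nonneg _),
    ← ENNReal.ofReal_mul (by positivity), ← ENNReal.ofReal_add (by positivity) (by positivity)]
  refine ENNReal.ofReal_le_ofReal ?_
  have hpos : 0 < ‖ξ‖ := lt_of_le_of_ne (norm_nonneg _) hξ.symm
  have e : ‖ξ‖ ^ (2 * (γ - 1)) = ‖ξ‖ ^ (2 * γ) * ‖ξ‖⁻¹ ^ 2 := by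
    rw [mul_sub, rpow_sub hpos, inv_pow, div_eq_mul_inv]
    norm_num
  rw [e, mul_assoc, ← mul_add]
  gcongr
  exact norm_waveProfile_sq_le d a b ξ

lemma sobolevNormC_sq (d : ℕ) (s : ℝ) (f : Euc d → ℂ) :
    sobolevNormC d s f ^ 2 =
      ∫⁻ ξ : Euc d, ENNReal.ofReal (‖ξ‖ ^ (2 * s) * ‖FourierTransform.fourier f ξ‖ ^ 2) := by
  rw [sobolevNormC, ← ENNReal.rpow_natCast, ← ENNReal.rpow_mul]
  norm_num

lemma measurable_eLpNorm_slice {d : ℕ} {q : ℝ≥0∞} (hq0 : q ≠ 0) (hq : q ≠ ∞)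
    {u : ℝ → Euc d → ℂ} (hu : Continuous (Function.uncurry u)) :
    Measurable (fun t => eLpNorm (u t) q volume) := by
  simp_rw [eLpNorm_eq_lintegral_rpow_enorm_toReal hq0 hq]
  refine Measurable.pow_const ?_ _
  exact Measurable.lintegral_prod_right'
    (f := fun z : ℝ × Euc d => ‖Function.uncurry u z‖ₑ ^ q.toReal)
    (hu.measurable.enorm.pow_const _)

lemma mixedNorm_add_le {d : ℕ} {p q : ℝ≥0∞} (hp : 1 ≤ p) (hq1 : 1 ≤ q) (hq : q ≠ ∞)
    {u v : ℝ → Euc d → ℂ} (hu : Continuous (Function.uncurry u))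
    (hv : Continuous (Function.uncurry v)) :
    mixedNorm d p q univ (fun t x => u t x + v t x) ≤
      mixedNorm d p q univ u + mixedNorm d p q univ v := by
  have hq0 : q ≠ 0 := (zero_lt_one.trans_le hq1).ne'
  have hut : ∀ t, Continuous (u t) := fun t => hu.comp (by fun_prop : Continuous fun x => (t, x))
  have hvt : ∀ t, Continuous (v t) := fun t => hv.comp (by fun_prop : Continuous fun x => (t, x))
  have key : ∀ t, eLpNorm (fun x => u t x + v t x) q volume ≤
      eLpNorm (u t) q volume + eLpNorm (v t) q volume := fun t =>
    eLpNorm_add_le (hut t).aestronglyMeasurable (hvt t).aestronglyMeasurable hq1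
  unfold mixedNorm
  split_ifs with h
  · exact (essSup_mono_ae (Filter.Eventually.of_forall key)).trans (ENNReal.essSup_add_le _ _)
  · have hp1 : 1 ≤ p.toReal := by
      rw [← ENNReal.toReal_one]
      exact ENNReal.toReal_mono h hp
    refine le_trans ?_ (ENNReal.lintegral_Lp_add_le
      (measurable_eLpNorm_slice hq0 hq hu).aemeasurable
      (measurable_eLpNorm_slice hq0 hq hv).aemeasurable hp1)
    gcongr with t
    exact key t

lemma mixedNorm_comp_neg_le {d : ℕ} {p q : ℝ≥0∞} (u : ℝ → Euc d → ℂ) :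
    mixedNorm d p q univ (fun t => u (-t)) ≤ mixedNorm d p q univ u := by
  unfold mixedNorm
  simp only [Measure.restrict_univ]
  split_ifs with h
  · refine essSup_le_of_ae_le _ ?_
    exact (Measure.measurePreserving_neg (volume : Measure ℝ)).quasiMeasurePreserving.ae
      (ae_le_essSup (f := fun t => eLpNorm (u t) q volume))
  · rw [lintegral_neg_eq_self (μ := volume) (fun t => eLpNorm (u t) q volume ^ p.toReal)]

lemma exists_mixedNorm_halfWave_le {d : ℕ} (hd : 2 ≤ d) {p q : ℝ≥0∞} {γ : ℝ} (hp : 2 ≤ p)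
    (hq2 : 2 ≤ q) (hq : q ≠ ∞)
    (hadmis : (1 / p).toReal + ((d : ℝ) - 1) * (1 / q).toReal < ((d : ℝ) - 1) / 2)
    (hscaling : (1 / p).toReal + (d : ℝ) * (1 / q).toReal = (d : ℝ) / 2 - γ) :
    ∃ C : ℝ, 0 < C ∧ ∀ f : Euc d → ℂ, Integrable f → IsRadialC d f → ∀ S : ℝ≥0∞,
      ∫⁻ ξ, ENNReal.ofReal (‖ξ‖ ^ (2 * γ)) * ‖f ξ‖ₑ ^ 2 ≤ S ^ 2 →
        mixedNorm d p q univ (halfWave d f) ≤ ENNReal.ofReal C * S := by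
  have hd' : (2 : ℝ) ≤ d := by exact_mod_cast hd
  have hq0 : q ≠ 0 := (zero_lt_two.trans_le hq2).ne'
  have hp0 : p ≠ 0 := (zero_lt_two.trans_le hp).ne'
  have hqr2 : (2 : ℝ) ≤ q.toReal := by
    rw [← ENNReal.toReal_ofNat]
    exact ENNReal.toReal_mono hq hq2
  have hQ : (1 / q).toReal = q.toReal⁻¹ := by rw [one_div, ENNReal.toReal_inv]
  have hP0 : 0 ≤ (1 / p).toReal := ENNReal.toReal_nonneg
  have hP2 : (1 / p).toReal ≤ 1 / 2 := by
    have : 1 / p ≤ 1 / 2 := ENNReal.div_le_div_left hp 1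
    simpa using ENNReal.toReal_mono (by simp) this
  rw [hQ] at hadmis hscaling
  have hQ2 : q.toReal⁻¹ < 1 / 2 := by
    by_contra! hcon
    nlinarith
  have hq2' : 2 < q.toReal := by
    rw [one_div] at hQ2
    exact (inv_lt_inv₀ (by linarith) zero_lt_two).1 hQ2
  obtain ⟨C, hC, H⟩ := exists_timeFunctional_halfWave_le hd hP0 hP2 hq2' (γ := γ)
    (by nlinarith) hadmis hscaling
  have hsqrt : ∀ {X S : ℝ≥0∞}, X ^ 2 ≤ ENNReal.ofReal C * S ^ 2 → X ≤ ENNReal.ofReal √C * S := by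
    intro X S h
    rw [← ENNReal.pow_le_pow_left_iff two_ne_zero, mul_pow,
      ← ENNReal.ofReal_pow (Real.sqrt_nonneg _), Real.sq_sqrt hC.le]
    exact h
  have hsq : ∀ u : Euc d → ℂ, (∫⁻ x, ‖u x‖ₑ ^ q.toReal) ^ (2 / q.toReal) =
      eLpNorm u q volume ^ (2 : ℝ) := by
    intro u
    rw [eLpNorm_eq_lintegral_rpow_enorm_toReal hq0 hq, ← ENNReal.rpow_mul]
    congr 1
    ring
  refine ⟨√C, Real.sqrt_pos.2 hC, fun f hf hrad S hS => ?_⟩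
  unfold mixedNorm
  split_ifs with h
  · refine essSup_le_of_ae_le _ (Filter.Eventually.of_forall fun t => hsqrt ?_)
    have h1 : IsTimeFunctional (fun g => g t) (1 / p).toReal := by
      have := isTimeFunctional_eval t
      simpa [h] using this
    have h2 := (H _ h1 f hf hrad).trans (mul_le_mul_right hS _)
    simp only [hsq] at h2
    simpa using h2
  · have hp2 : (2 : ℝ) ≤ p.toReal := by
      rw [← ENNReal.toReal_ofNat]
      exact ENNReal.toReal_mono h hp
    have h1 : IsTimeFunctional
        (fun g => (∫⁻ t, g t ^ (p.toReal / 2)) ^ (1 / (p.toReal / 2))) (1 / p).toReal := by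
      have := isTimeFunctional_Lp (r := p.toReal / 2) (by linarith)
      rwa [mul_div_cancel₀ _ (two_ne_zero' ℝ), one_div p.toReal, ← ENNReal.toReal_inv,
        ← one_div] at this
    have h2 := (H _ h1 f hf hrad).trans (mul_le_mul_right hS _)
    simp only [hsq, ← ENNReal.rpow_mul, mul_div_cancel₀ p.toReal (two_ne_zero' ℝ)] at h2
    refine hsqrt ?_
    rw [Measure.restrict_univ, ← ENNReal.rpow_natCast, ← ENNReal.rpow_mul]
    have e : 1 / p.toReal * ((2 : ℕ) : ℝ) = 1 / (p.toReal / 2) := by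
      rw [one_div_div, one_div_mul_eq_div]
      norm_num
    rw [e]
    exact h2

/-- **Radial Strichartz estimate** (Theorem 2.3, Sterbenz). Let `d ≥ 2` and let `u` solve
the free wave equation `∂ₜ²u = Δu` on `ℝ × ℝ^d` with radial Schwartz initial data
`(u₀, u₁)`. If `2 ≤ p ≤ ∞`, `2 ≤ q < ∞` and `γ` satisfy
`1/p + (d−1)/q < (d−1)/2` and `1/p + d/q = d/2 − γ`, then
`‖u‖_{L^p_t L^q_x(ℝ × ℝ^d)} ≤ C (‖u₀‖_{Ḣ^γ} + ‖u₁‖_{Ḣ^{γ−1}})`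
with `C` depending only on `d`, `p`, `q`. -/
theorem radial_strichartz_estimate (d : ℕ) (hd : 2 ≤ d)
    (p q : ℝ≥0∞) (γ : ℝ) (hp : 2 ≤ p) (hq2 : 2 ≤ q) (hq : q ≠ ∞)
    (hadmis : (1 / p).toReal + ((d : ℝ) - 1) * (1 / q).toReal < ((d : ℝ) - 1) / 2)
    (hscaling : (1 / p).toReal + (d : ℝ) * (1 / q).toReal = (d : ℝ) / 2 - γ) :
    ∃ C : ℝ, 0 < C ∧
      ∀ (u : ℝ → Euc d → ℂ) (u₀ u₁ : Euc d → ℂ),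
        ContDiff ℝ (⊤ : ℕ∞) (Function.uncurry u) →
        (∀ t, IsSchwartzC d (u t)) →
        (∀ t x, timeDeriv2C d u t x = spatialLapC d (u t) x) →
        (∀ x, u 0 x = u₀ x) → (∀ x, timeDerivC d u 0 x = u₁ x) →
        IsSchwartzC d u₀ → IsSchwartzC d u₁ → IsRadialC d u₀ → IsRadialC d u₁ →
        mixedNorm d p q univ u ≤
          ENNReal.ofReal C * (sobolevNormC d γ u₀ + sobolevNormC d (γ - 1) u₁) := by
  obtain ⟨C, hC, H⟩ := exists_mixedNorm_halfWave_le hd hp hq2 hq hadmis hscaling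
  refine ⟨2 * C, by positivity, ?_⟩
  rintro u u₀ u₁ hu - hwave h0 h1 ⟨φ₀, hφ₀⟩ ⟨φ₁, hφ₁⟩ hr0 hr1
  obtain rfl : u₀ = φ₀ := funext hφ₀
  obtain rfl : u₁ = φ₁ := funext hφ₁
  rw [eq_twoWave_of_wave_equation hd φ₀ φ₁ hu hwave h0 h1]
  set S := sobolevNormC d γ φ₀ + sobolevNormC d (γ - 1) φ₁ with hS
  have hr0' : IsRadialC d (𝓕 φ₀ : SchwartzMap (Euc d) ℂ) := isRadialC_fourier hr0
  have hr1' : IsRadialC d (𝓕 φ₁ : SchwartzMap (Euc d) ℂ) := isRadialC_fourier hr1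
  have hr1'' : IsRadialC d (-𝓕 φ₁ : SchwartzMap (Euc d) ℂ) := by
    obtain ⟨g, hg⟩ := hr1'
    exact ⟨fun r => -g r, fun x => by rw [neg_apply, hg]⟩
  have hsq : sobolevNormC d γ φ₀ ^ 2 + sobolevNormC d (γ - 1) φ₁ ^ 2 ≤ S ^ 2 := by
    rw [hS, add_sq]
    gcongr
    exact le_self_add
  have hbound : ∀ b : SchwartzMap (Euc d) ℂ, (∀ ξ, ‖b ξ‖ = ‖𝓕 (φ₁ : Euc d → ℂ) ξ‖) →
      IsRadialC d b →
      mixedNorm d p q univ (halfWave d (waveProfile d (𝓕 φ₀ : SchwartzMap (Euc d) ℂ) b)) ≤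
        ENNReal.ofReal C * S := by
    intro b hb hbr
    refine H _ (hasMoments_waveProfile hd _ _).integrable (isRadialC_waveProfile hr0' hbr) S
      (((lintegral_waveProfile_le hd γ (SchwartzMap.continuous _)).trans_eq ?_).trans hsq)
    rw [sobolevNormC_sq, sobolevNormC_sq, SchwartzMap.fourier_coe]
    simp_rw [hb]
  have hp1 : 1 ≤ p := one_le_two.trans hp
  have hq1 : 1 ≤ q := one_le_two.trans hq2
  have hcont : ∀ b : SchwartzMap (Euc d) ℂ, Continuous (Function.uncurry
      (halfWave d (waveProfile d (𝓕 φ₀ : SchwartzMap (Euc d) ℂ) b))) := fun b =>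
    (contDiff_halfWave d (hasMoments_waveProfile hd _ b).2).continuous
  have hneg : Continuous fun z : ℝ × Euc d => (-z.1, z.2) := by fun_prop
  have hcont' : Continuous (Function.uncurry fun t =>
      halfWave d (waveProfile d (𝓕 φ₀ : SchwartzMap (Euc d) ℂ)
        (-𝓕 φ₁ : SchwartzMap (Euc d) ℂ)) (-t)) := (hcont (-𝓕 φ₁)).comp hneg
  refine (mixedNorm_add_le hp1 hq1 hq (hcont (𝓕 φ₁)) hcont').trans ?_
  refine (add_le_add (hbound (𝓕 φ₁) (fun ξ => by rw [SchwartzMap.fourier_coe]) hr1')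
    ((mixedNorm_comp_neg_le _).trans (hbound (-𝓕 φ₁) (fun ξ => ?_) hr1''))).trans_eq ?_
  · rw [neg_apply, norm_neg, SchwartzMap.fourier_coe]
  · rw [← two_mul, ENNReal.ofReal_mul zero_le_two, ENNReal.ofReal_ofNat, mul_assoc]
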